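/- Let μ ∝ e^{−f} be a probability density on ℝ^d with f three times continuously differentiable, L-smooth, γL^{3/2}-strongly Hessian Lipschitz, and e^{−f} subexponential-tailed. There is a universal constant c > 0 such that for every integer ℓ ≥ 1 and every step size η > 0 with η² L ≤ 1, if (q_0, p_0) ~ μ × N(0, I_d) and (q_η, p_η) is one leapfrog step of step size η from (q_0, p_0), then with d_ℓ := d + 2(ℓ−1), ( E | −f(q_η) − ‖p_η‖²/2 + f(q_0) + ‖p_0‖²/2 |^ℓ )^{1/ℓ} ≤ c (γ + 1) ( η³ ℓ^{3/2} L^{3/2} d_ℓ^{1/2} + η⁵ ℓ^{1/2} L^{5/2} d_ℓ + η⁷ L^{7/2} d_ℓ^{3/2} ). -/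

import Mathlib

open MeasureTheory Real
open scoped ENNReal NNReal

noncomputable section

/-- The Euclidean space `ℝ^d`. -/
abbrev Euc (d : ℕ) := EuclideanSpace ℝ (Fin d)

/-- `leapfrog f η k (q₀,p₀)` is the `k`-th leapfrog iterate with step size `η` for the
potential `f`, starting at `(q₀,p₀)`. -/
def leapfrog {d : ℕ} (f : Euc d → ℝ) (η : ℝ) : ℕ → Euc d × Euc d → Euc d × Euc d
  | 0, z => z
  | (k+1), z =>
      let w := leapfrog f η k z
      let q' := w.1 + η • w.2 - (η^2/2) • gradient f w.1
      (q', w.2 - (η/2) • gradient f w.1 - (η/2) • gradient f q')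

/-- `f` is `L`-smooth: the Hessian has operator norm at most `L` everywhere. -/
def LSmooth {d : ℕ} (f : Euc d → ℝ) (L : ℝ) : Prop :=
  ∀ x, ‖fderiv ℝ (gradient f) x‖ ≤ L

/-- The entries of the third-derivative tensor of `f` at `x`. -/
def tensor3 {ι : Type*} [Fintype ι] [DecidableEq ι]
    (f : EuclideanSpace ℝ ι → ℝ) (x : EuclideanSpace ℝ ι) (i j k : ι) : ℝ :=
  iteratedFDeriv ℝ 3 f x
    ![EuclideanSpace.single i 1, EuclideanSpace.single j 1, EuclideanSpace.single k 1]

/-- The `{1,2,3}`-norm (Frobenius norm) of a 3-tensor. -/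
def norm123 {ι : Type*} [Fintype ι] (A : ι → ι → ι → ℝ) : ℝ :=
  Real.sqrt (∑ i, ∑ j, ∑ k, (A i j k)^2)

/-- The `{1,2}{3}`-norm of a 3-tensor. -/
def norm12_3 {ι : Type*} [Fintype ι] (A : ι → ι → ι → ℝ) : ℝ :=
  sSup { s | ∃ (X : ι → ι → ℝ) (y : ι → ℝ), (∑ i, ∑ j, (X i j)^2) ≤ 1 ∧
    (∑ k, (y k)^2) ≤ 1 ∧ s = ∑ i, ∑ j, ∑ k, A i j k * X i j * y k }

/-- `f` is `γ L^{3/2}`-strongly Hessian Lipschitz. -/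
def StronglyHessLip {d : ℕ} (f : Euc d → ℝ) (γ L : ℝ) : Prop :=
  ∀ x, norm12_3 (tensor3 f x) ≤ γ * L ^ ((3:ℝ)/2)

/-- Distance between two sets. -/
def setDistance {α : Type*} [PseudoMetricSpace α] (S T : Set α) : ℝ :=
  sInf { r | ∃ x ∈ S, ∃ y ∈ T, r = dist x y }

/-- Cheeger isoperimetric inequality with coefficient `ψ`. -/
def CheegerIso {d : ℕ} (μ : Measure (Euc d)) (ψ : ℝ) : Prop :=
  ∀ S1 S2 S3 : Set (Euc d), MeasurableSet S1 → MeasurableSet S2 → MeasurableSet S3 →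
    Disjoint S1 S2 → Disjoint S1 S3 → Disjoint S2 S3 → S1 ∪ S2 ∪ S3 = Set.univ →
    ψ * setDistance S1 S2 * (μ S1).toReal * (μ S2).toReal ≤ (μ S3).toReal

/-- The probability measure proportional to `e^{-f}`. -/
def targetMeasure {d : ℕ} (f : Euc d → ℝ) : Measure (Euc d) :=
  ((volume.withDensity fun x => ENNReal.ofReal (Real.exp (-f x))) Set.univ)⁻¹ •
    (volume.withDensity fun x => ENNReal.ofReal (Real.exp (-f x)))

/-- The standard Gaussian measure `N(0, I_d)` on `ℝ^d`. -/
def stdGaussian (d : ℕ) : Measure (Euc d) :=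
  Measure.map (⇑(EuclideanSpace.equiv (Fin d) ℝ).symm)
    (Measure.pi fun _ : Fin d => ProbabilityTheory.gaussianReal 0 1)

/-- Metropolis acceptance probability of the HMC proposal. -/
def accProb {d : ℕ} (f : Euc d → ℝ) (K : ℕ) (η : ℝ) (q p : Euc d) : ℝ :=
  min 1 (Real.exp (-(f (leapfrog f η K (q,p)).1) - ‖(leapfrog f η K (q,p)).2‖^2/2
    + f q + ‖p‖^2/2))

/-- One step of Metropolized HMC with `K` leapfrog steps and step size `η`, from `q`. -/
def hmcKernel {d : ℕ} (f : Euc d → ℝ) (K : ℕ) (η : ℝ) (q : Euc d) : Measure (Euc d) :=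
  (stdGaussian d).bind fun p =>
    ENNReal.ofReal (accProb f K η q p) • Measure.dirac (leapfrog f η K (q,p)).1 +
    ENNReal.ofReal (1 - accProb f K η q p) • Measure.dirac q

/-- One step of the lazy version of Metropolized HMC. -/
def lazyHMC {d : ℕ} (f : Euc d → ℝ) (K : ℕ) (η : ℝ) (q : Euc d) : Measure (Euc d) :=
  (2:ℝ≥0∞)⁻¹ • Measure.dirac q + (2:ℝ≥0∞)⁻¹ • hmcKernel f K η q

/-- The law of the lazy Metropolized HMC chain after `n` steps started from `μ₀`. -/
def hmcIter {d : ℕ} (f : Euc d → ℝ) (K : ℕ) (η : ℝ) (μ0 : Measure (Euc d)) :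
    ℕ → Measure (Euc d)
  | 0 => μ0
  | (n+1) => (hmcIter f K η μ0 n).bind (lazyHMC f K η)

/-- Total variation distance between two measures. -/
def tvDist {α : Type*} [MeasurableSpace α] (P Q : Measure α) : ℝ :=
  sSup { r | ∃ A, MeasurableSet A ∧ r = |(P A).toReal - (Q A).toReal| }

/-- `ε`-mixing time of lazy Metropolized HMC started from `μ₀`, targetting `μ ∝ e^{-f}`. -/
def mixingTime {d : ℕ} (f : Euc d → ℝ) (K : ℕ) (η : ℝ) (μ0 : Measure (Euc d)) (ε : ℝ) : ℕ :=
  sInf { n : ℕ | tvDist (hmcIter f K η μ0 n) (targetMeasure f) ≤ ε }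

/-- `μ₀` is `M`-warm with respect to `μ`. -/
def Warm {α : Type*} [MeasurableSpace α] (μ0 μ : Measure α) (M : ℝ) : Prop :=
  ∀ S : Set α, MeasurableSet S → μ0 S ≤ ENNReal.ofReal M * μ S

/-- `e^{-f}` has subexponential tail. -/
def SubexpTail {d : ℕ} (f : Euc d → ℝ) : Prop :=
  ∃ lam > (0:ℝ), Filter.Tendsto (fun x : Euc d => Real.exp (lam * ‖x‖) * Real.exp (-f x))
    (Bornology.cobounded _) (nhds 0)

end

/-- A function whose norm is bounded by a polynomial in the norm of its argument. -/
def PolyGrowth {E F : Type*} [Norm E] [Norm F] (φ : E → F) : Prop :=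
  ∃ (C : ℝ) (k : ℕ), 0 ≤ C ∧ ∀ x, ‖φ x‖ ≤ C * (1 + ‖x‖) ^ k

namespace PolyGrowth

variable {E F G : Type*} [NormedAddCommGroup E] [NormedAddCommGroup F] [NormedAddCommGroup G]

lemma const (c : F) : PolyGrowth fun _ : E => c := ⟨‖c‖, 0, norm_nonneg _, fun x => by simp⟩

lemma id' : PolyGrowth fun x : E => x :=
  ⟨1, 1, zero_le_one, fun x => by simp⟩

lemma of_le {φ : E → F} {ψ : E → G} (hψ : PolyGrowth ψ) (h : ∀ x, ‖φ x‖ ≤ ‖ψ x‖) :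
    PolyGrowth φ := by
  obtain ⟨C, k, hC, hk⟩ := hψ
  exact ⟨C, k, hC, fun x => (h x).trans (hk x)⟩

lemma norm {φ : E → F} (hφ : PolyGrowth φ) : PolyGrowth fun x => ‖φ x‖ :=
  hφ.of_le fun x => by simp

lemma add {φ ψ : E → F} (hφ : PolyGrowth φ) (hψ : PolyGrowth ψ) :
    PolyGrowth fun x => φ x + ψ x := by
  obtain ⟨C, k, hC, hk⟩ := hφ
  obtain ⟨D, l, hD, hl⟩ := hψ
  refine ⟨C + D, k + l, by positivity, fun x => ?_⟩
  have h1 : (1:ℝ) ≤ 1 + ‖x‖ := by linarith [norm_nonneg x]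
  calc ‖φ x + ψ x‖ ≤ ‖φ x‖ + ‖ψ x‖ := norm_add_le _ _
    _ ≤ C * (1 + ‖x‖) ^ k + D * (1 + ‖x‖) ^ l := add_le_add (hk x) (hl x)
    _ ≤ C * (1 + ‖x‖) ^ (k + l) + D * (1 + ‖x‖) ^ (k + l) := by gcongr <;> simp
    _ = _ := by ring

lemma of_norm_le_mul {H : Type*} [NormedAddCommGroup H] {φ : E → F} {ψ : E → G} {χ : E → H}
    (hφ : PolyGrowth φ) (hψ : PolyGrowth ψ) (h : ∀ x, ‖χ x‖ ≤ ‖φ x‖ * ‖ψ x‖) :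
    PolyGrowth χ := by
  obtain ⟨C, k, hC, hk⟩ := hφ
  obtain ⟨D, l, hD, hl⟩ := hψ
  refine ⟨C * D, k + l, by positivity, fun x => (h x).trans ?_⟩
  calc ‖φ x‖ * ‖ψ x‖ ≤ (C * (1 + ‖x‖) ^ k) * (D * (1 + ‖x‖) ^ l) := by
        gcongr; exacts [hk x, hl x]
    _ = _ := by ring

lemma mul {φ ψ : E → ℝ} (hφ : PolyGrowth φ) (hψ : PolyGrowth ψ) :
    PolyGrowth fun x => φ x * ψ x := hφ.of_norm_le_mul hψ fun x => by simp

lemma pow {φ : E → ℝ} (hφ : PolyGrowth φ) (n : ℕ) : PolyGrowth fun x => φ x ^ n := by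
  induction n with
  | zero => simpa using const (1:ℝ)
  | succ n ih => simpa only [pow_succ] using ih.mul hφ

lemma smul [NormedSpace ℝ F] {φ : E → ℝ} {ψ : E → F} (hφ : PolyGrowth φ) (hψ : PolyGrowth ψ) :
    PolyGrowth fun x => φ x • ψ x := hφ.of_norm_le_mul hψ fun x => by simp [norm_smul]

lemma inner [InnerProductSpace ℝ F] {φ ψ : E → F} (hφ : PolyGrowth φ) (hψ : PolyGrowth ψ) :
    PolyGrowth fun x => inner ℝ (φ x) (ψ x) := hφ.of_norm_le_mul hψ fun _ => norm_inner_le_norm _ _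

lemma clm_apply [NormedSpace ℝ F] [NormedSpace ℝ G] {φ : E → F →L[ℝ] G} {ψ : E → F}
    (hφ : PolyGrowth φ) (hψ : PolyGrowth ψ) : PolyGrowth fun x => φ x (ψ x) :=
  hφ.of_norm_le_mul hψ fun x => (φ x).le_opNorm _

lemma sum {ι : Type*} (s : Finset ι) {φ : ι → E → F} (h : ∀ i ∈ s, PolyGrowth (φ i)) :
    PolyGrowth fun x => ∑ i ∈ s, φ i x := by
  classical
  induction s using Finset.induction_on with
  | empty => simpa using const (0:F)
  | insert i s hi ih =>
    simp only [Finset.sum_insert hi]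
    exact (h i (by simp)).add (ih fun j hj => h j (by simp [hj]))

end PolyGrowth

section Tails

variable {d : ℕ} {V : Euc d → ℝ}

lemma SubexpTail.exists_le (hV : Continuous V) (h : SubexpTail V) :
    ∃ lam > 0, ∃ C, 0 ≤ C ∧ ∀ x, exp (-V x) ≤ C * exp (-(lam * ‖x‖)) := by
  obtain ⟨lam, hlam, ht⟩ := h
  refine ⟨lam, hlam, ?_⟩
  have hev : ∀ᶠ x in Bornology.cobounded (Euc d), exp (lam * ‖x‖) * exp (-V x) ≤ 1 :=
    (ht.eventually (gt_mem_nhds zero_lt_one)).mono fun x hx => hx.le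
  rw [Metric.cobounded_eq_cocompact, Filter.eventually_iff, Filter.mem_cocompact] at hev
  obtain ⟨K, hK, hKs⟩ := hev
  have hc : Continuous fun x : Euc d => exp (lam * ‖x‖) * exp (-V x) := by fun_prop
  obtain ⟨C, hC⟩ := hK.bddAbove_image hc.continuousOn
  refine ⟨max C 1, by positivity, fun x => ?_⟩
  have hx : exp (lam * ‖x‖) * exp (-V x) ≤ max C 1 := by
    by_cases hxK : x ∈ K
    · exact le_max_of_le_left (hC ⟨x, hxK, rfl⟩)
    · exact le_max_of_le_right (hKs hxK)
  rw [exp_neg (lam * ‖x‖), ← div_eq_mul_inv, le_div_iff₀ (exp_pos _)]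
  linarith

lemma PolyGrowth.integrable_exp_smul {F : Type*} [NormedAddCommGroup F] [NormedSpace ℝ F]
    (hV : Continuous V) (h : SubexpTail V) {φ : Euc d → F} (hφ : PolyGrowth φ)
    (hc : Continuous φ) : Integrable (fun x => exp (-V x) • φ x) volume := by
  obtain ⟨lam, hlam, C, hC, hCV⟩ := h.exists_le hV
  obtain ⟨D, k, hD, hk⟩ := hφ
  have hInt := (integrable_one_add_norm (E := Euc d) (μ := volume) (r := (d + 1 : ℕ))
    (by simp)).const_mul (C * D * exp lam * (k + (d + 1)).factorial / lam ^ (k + (d + 1)))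
  refine hInt.mono' (by fun_prop) (Filter.Eventually.of_forall fun x => ?_)
  have h1 : (0:ℝ) < 1 + ‖x‖ := by positivity
  have h2 := Real.pow_div_factorial_le_exp (lam * (1 + ‖x‖)) (by positivity) (k + (d + 1))
  rw [div_le_iff₀ (by positivity), mul_pow] at h2
  rw [norm_smul, Real.norm_of_nonneg (exp_pos _).le, Real.rpow_neg h1.le, Real.rpow_natCast]
  have h3 : (1 + ‖x‖) ^ (k + (d + 1)) * exp (-(lam * ‖x‖)) ≤
      exp lam * (k + (d + 1)).factorial / lam ^ (k + (d + 1)) := by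
    rw [le_div_iff₀ (by positivity)]
    have : exp lam = exp (lam * (1 + ‖x‖)) * exp (-(lam * ‖x‖)) := by
      rw [← exp_add]; ring_nf
    rw [this]
    have := mul_le_mul_of_nonneg_right h2 (exp_pos (-(lam * ‖x‖))).le
    linarith
  calc exp (-V x) * ‖φ x‖ ≤ (C * exp (-(lam * ‖x‖))) * (D * (1 + ‖x‖) ^ k) := by
        gcongr; exacts [hCV x, hk x]
    _ = C * D * ((1 + ‖x‖) ^ (k + (d + 1)) * exp (-(lam * ‖x‖))) * ((1 + ‖x‖) ^ (d + 1))⁻¹ := by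
        rw [pow_add]; field_simp
    _ ≤ C * D * (exp lam * (k + (d + 1)).factorial / lam ^ (k + (d + 1))) *
          ((1 + ‖x‖) ^ (d + 1))⁻¹ := by gcongr
    _ = _ := by ring

lemma targetMeasure_integral {F : Type*} [NormedAddCommGroup F] [NormedSpace ℝ F]
    (hV : Continuous V) (φ : Euc d → F) :
    ∫ x, φ x ∂(targetMeasure V) =
      ((volume.withDensity fun x => ENNReal.ofReal (exp (-V x))) Set.univ)⁻¹.toReal •
        ∫ x, exp (-V x) • φ x := by
  rw [targetMeasure, integral_smul_measure, integral_withDensity_eq_integral_toReal_smul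
    (by fun_prop) (by simp)]
  simp [ENNReal.toReal_ofReal (exp_pos _).le]

lemma PolyGrowth.integrable_targetMeasure {F : Type*} [NormedAddCommGroup F] [NormedSpace ℝ F]
    (hV : Continuous V) (h : SubexpTail V) {φ : Euc d → F} (hφ : PolyGrowth φ)
    (hc : Continuous φ) : Integrable φ (targetMeasure V) := by
  refine Integrable.smul_measure ?_ ?_
  · rw [integrable_withDensity_iff_integrable_smul' (by fun_prop) (by simp)]
    simpa [ENNReal.toReal_ofReal (exp_pos _).le] using hφ.integrable_exp_smul hV h hc
  · simp only [ne_eq, ENNReal.inv_eq_top, Measure.measure_univ_eq_zero]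
    intro h0
    have := (withDensity_eq_zero_iff (μ := (volume : Measure (Euc d)))
      (f := fun x => ENNReal.ofReal (exp (-V x))) (by fun_prop)).1 h0
    obtain ⟨x, hx⟩ := this.exists
    simp [not_le.2 (exp_pos _)] at hx

/-- Integration by parts against a density `e^{-V}`. -/
lemma integral_inner_gradient_targetMeasure (hV : ContDiff ℝ 1 V) (h : SubexpTail V)
    {F : Euc d → Euc d} {F' : Euc d → Euc d →L[ℝ] Euc d} (hF : ∀ x, HasFDerivAt F (F' x) x)
    (hF'c : Continuous F') (hFg : PolyGrowth F) (hF'g : PolyGrowth F')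
    (hVg : PolyGrowth (gradient V)) :
    ∫ x, inner ℝ (gradient V x) (F x) ∂(targetMeasure V) =
      ∫ x, ∑ i, inner ℝ (F' x (EuclideanSpace.basisFun (Fin d) ℝ i))
        (EuclideanSpace.basisFun (Fin d) ℝ i) ∂(targetMeasure V) := by
  set b := EuclideanSpace.basisFun (Fin d) ℝ with hb
  have hVd : Differentiable ℝ V := hV.differentiable (by simp)
  have hVc : Continuous V := hV.continuous
  have hFc : Continuous F := continuous_iff_continuousAt.2 fun x => (hF x).continuousAt
  have hgc : Continuous (gradient V) := by
    unfold gradient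
    exact (InnerProductSpace.toDual ℝ (Euc d)).symm.continuous.comp (hV.continuous_fderiv (by simp))
  rw [targetMeasure_integral hVc, targetMeasure_integral hVc]
  congr 1
  have hfd : ∀ x v, fderiv ℝ V x v = inner ℝ (gradient V x) v := fun x v => by
    simp [gradient]
  have hexp : ∀ x v, fderiv ℝ (fun x => exp (-V x)) x v =
      -(exp (-V x) * inner ℝ (gradient V x) v) := fun x v => by
    rw [(((hVd x).hasFDerivAt.fun_neg).exp).fderiv]
    rw [smul_neg, neg_apply, smul_apply, hfd, smul_eq_mul]
  have hFi : ∀ i x, HasFDerivAt (fun x => inner ℝ (F x) (b i))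
      ((innerSL ℝ (b i)).comp (F' x)) x := fun i x => by
    have := (innerSL ℝ (b i)).hasFDerivAt.comp x (hF x)
    refine this.congr_of_eventuallyEq (Filter.Eventually.of_forall fun y => ?_)
    simp [real_inner_comm]
  have key : ∀ i, ∫ x, exp (-V x) * inner ℝ (F' x (b i)) (b i) =
      ∫ x, exp (-V x) * (inner ℝ (gradient V x) (b i) * inner ℝ (F x) (b i)) := by
    intro i
    have := integral_mul_fderiv_eq_neg_fderiv_mul_of_integrable (μ := (volume : Measure (Euc d)))
      (f := fun x => exp (-V x)) (g := fun x => inner ℝ (F x) (b i)) (v := b i) ?_ ?_ ?_ ?_ ?_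
    · simp only [(hFi i _).fderiv, hexp] at this
      simp only [ContinuousLinearMap.comp_apply, innerSL_apply_apply, neg_mul] at this
      rw [integral_neg, neg_neg] at this
      simp only [real_inner_comm (b i)] at this
      simpa only [mul_assoc, real_inner_comm (b i)] using this
    · simp only [hexp]
      have := (((hVg.inner (.const (b i))).mul (hFg.inner (.const (b i)))).integrable_exp_smul hVc h
        (by fun_prop)).neg
      refine this.congr (Filter.Eventually.of_forall fun x => ?_)
      simp [mul_assoc]
    · simp only [(hFi i _).fderiv]
      exact ((PolyGrowth.inner (.const (b i)) (hF'g.clm_apply (.const (b i))))).integrable_exp_smul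
        hVc h (by fun_prop)
    · exact (hFg.inner (.const (b i))).integrable_exp_smul hVc h (by fun_prop)
    · intro x _
      exact ((hVd x).neg).exp
    · intro x _
      exact (hFi i x).differentiableAt
  have e1 : ∀ x, exp (-V x) • (inner ℝ (gradient V x) (F x) : ℝ) =
      ∑ i, exp (-V x) * (inner ℝ (gradient V x) (b i) * inner ℝ (F x) (b i)) := fun x => by
    rw [← Finset.mul_sum, smul_eq_mul, ← b.sum_inner_mul_inner]
    simp only [real_inner_comm (F x)]
  have e2 : ∀ x, exp (-V x) • ∑ i, (inner ℝ (F' x (b i)) (b i) : ℝ) =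
      ∑ i, exp (-V x) * inner ℝ (F' x (b i)) (b i) := fun x => by
    rw [smul_eq_mul, Finset.mul_sum]
  simp only [e1, e2]
  rw [integral_finsetSum, integral_finsetSum]
  · exact Finset.sum_congr rfl fun i _ => (key i).symm
  · intro i _
    exact (((hF'g.clm_apply (.const (b i))).inner (.const (b i)))).integrable_exp_smul
        hVc h (by fun_prop)
  · intro i _
    exact ((hVg.inner (.const (b i))).mul (hFg.inner (.const (b i)))).integrable_exp_smul hVc h
        (by fun_prop)

end Tails

section GradientMoments

variable {d : ℕ} {V : Euc d → ℝ}

/-- The divergence of a linear vector field, i.e. the trace of a continuous linear map. -/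
noncomputable def divergence {d : ℕ} (A : Euc d →L[ℝ] Euc d) : ℝ :=
  ∑ i, inner ℝ (A (EuclideanSpace.basisFun (Fin d) ℝ i)) (EuclideanSpace.basisFun (Fin d) ℝ i)

lemma divergence_add (A B : Euc d →L[ℝ] Euc d) :
    divergence (A + B) = divergence A + divergence B := by
  simp [divergence, inner_add_left, Finset.sum_add_distrib]

lemma divergence_smul (c : ℝ) (A : Euc d →L[ℝ] Euc d) :
    divergence (c • A) = c * divergence A := by
  simp only [divergence, smul_apply, real_inner_smul_left, Finset.mul_sum]

lemma divergence_smulRight (l : Euc d →L[ℝ] ℝ) (v : Euc d) :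
    divergence (l.smulRight v) = l v := by
  have h := (EuclideanSpace.basisFun (Fin d) ℝ).sum_repr v
  conv_rhs => rw [← h, map_sum]
  simp only [divergence, ContinuousLinearMap.smulRight_apply, real_inner_smul_left, map_smul,
    smul_eq_mul]
  refine Finset.sum_congr rfl fun i _ => ?_
  rw [mul_comm, OrthonormalBasis.repr_apply_apply, real_inner_comm]

lemma continuous_divergence {X : Type*} [TopologicalSpace X] {A : X → Euc d →L[ℝ] Euc d}
    (hA : Continuous A) : Continuous fun x => divergence (A x) := by
  unfold divergence; fun_prop

lemma PolyGrowth.divergence {A : Euc d → Euc d →L[ℝ] Euc d} (hA : PolyGrowth A) :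
    PolyGrowth fun x => divergence (A x) :=
  PolyGrowth.sum _ fun _ _ => (hA.clm_apply (.const _)).inner (.const _)

lemma abs_divergence_le (A : Euc d →L[ℝ] Euc d) : |divergence A| ≤ d * ‖A‖ := by
  refine (Finset.abs_sum_le_sum_abs _ _).trans ?_
  refine (Finset.sum_le_sum (g := fun _ => ‖A‖) fun i _ => ?_).trans (by simp)
  refine (abs_real_inner_le_norm _ _).trans ?_
  have := A.le_opNorm (EuclideanSpace.basisFun (Fin d) ℝ i)
  simpa using this

/-- Integration by parts against a density `e^{-V}` for a vector field `φ • W`. -/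
lemma integral_mul_inner_gradient_targetMeasure (hV : ContDiff ℝ 1 V) (h : SubexpTail V)
    (hVg : PolyGrowth (gradient V))
    {φ : Euc d → ℝ} {φ' : Euc d → Euc d →L[ℝ] ℝ} (hφ : ∀ x, HasFDerivAt φ (φ' x) x)
    (hφ'c : Continuous φ') (hφg : PolyGrowth φ) (hφ'g : PolyGrowth φ')
    {W : Euc d → Euc d} {W' : Euc d → Euc d →L[ℝ] Euc d} (hW : ∀ x, HasFDerivAt W (W' x) x)
    (hW'c : Continuous W') (hWg : PolyGrowth W) (hW'g : PolyGrowth W') :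
    ∫ x, φ x * inner ℝ (gradient V x) (W x) ∂(targetMeasure V) =
      ∫ x, (φ x * divergence (W' x) + φ' x (W x)) ∂(targetMeasure V) := by
  have hφc : Continuous φ := continuous_iff_continuousAt.2 fun x => (hφ x).continuousAt
  have hWc : Continuous W := continuous_iff_continuousAt.2 fun x => (hW x).continuousAt
  have := integral_inner_gradient_targetMeasure hV h
    (fun x => (hφ x).smul (hW x)) (by fun_prop) (hφg.smul hWg)
    ((hφg.smul hW'g).add (hφ'g.of_norm_le_mul hWg fun x => by simp)) hVg
  simp only [Pi.smul_apply', real_inner_smul_right] at this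
  rw [this]
  refine integral_congr_ae (Filter.Eventually.of_forall fun x => ?_)
  change divergence (φ x • W' x + (φ' x).smulRight (W x)) = _
  rw [divergence_add, divergence_smul, divergence_smulRight]

lemma SubexpTail.isProbabilityMeasure (hV : Continuous V) (h : SubexpTail V) :
    IsProbabilityMeasure (targetMeasure V) := by
  have hInt : Integrable (fun _ : Euc d => (1:ℝ)) (targetMeasure V) :=
    (PolyGrowth.const (1:ℝ)).integrable_targetMeasure hV h continuous_const
  have hfin : IsFiniteMeasure (targetMeasure V) := by
    simpa [integrable_const_iff] using hInt
  constructor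
  rw [targetMeasure, Measure.smul_apply, smul_eq_mul]
  refine ENNReal.inv_mul_cancel ?_ ?_
  · intro h0
    have := (withDensity_eq_zero_iff (μ := (volume : Measure (Euc d)))
      (f := fun x => ENNReal.ofReal (exp (-V x))) (by fun_prop)).1
        (Measure.measure_univ_eq_zero.1 h0)
    obtain ⟨x, hx⟩ := this.exists
    simp [not_le.2 (exp_pos _)] at hx
  · have := (PolyGrowth.const (E := Euc d) (1:ℝ)).integrable_exp_smul hV h continuous_const
    rw [withDensity_apply _ MeasurableSet.univ, Measure.restrict_univ]
    refine (lt_of_eq_of_lt ?_ this.hasFiniteIntegral).ne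
    refine lintegral_congr fun x => ?_
    rw [Real.enorm_eq_ofReal (by positivity)]
    simp

lemma contDiff_gradient {n : WithTop ℕ∞} (hV : ContDiff ℝ (n + 1) V) : ContDiff ℝ n (gradient V) :=
  (InnerProductSpace.toDual ℝ (Euc d)).symm.toContinuousLinearEquiv.contDiff.comp
    (hV.fderiv_right le_rfl)

lemma LSmooth.nonneg {L : ℝ} (hL : LSmooth V L) : 0 ≤ L := (norm_nonneg _).trans (hL 0)

lemma LSmooth.norm_gradient_sub_le {L : ℝ} (hV : ContDiff ℝ 2 V) (hL : LSmooth V L)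
    (x y : Euc d) : ‖gradient V x - gradient V y‖ ≤ L * ‖x - y‖ :=
  Convex.norm_image_sub_le_of_norm_fderiv_le (𝕜 := ℝ) (s := Set.univ)
    (fun z _ => (contDiff_gradient (n := 1) hV).differentiable (by simp) z)
    (fun z _ => hL z) convex_univ (Set.mem_univ y) (Set.mem_univ x)

lemma LSmooth.polyGrowth_gradient {L : ℝ} (hV : ContDiff ℝ 2 V) (hL : LSmooth V L) :
    PolyGrowth (gradient V) := by
  have h0 := hL.nonneg
  refine ⟨‖gradient V 0‖ + L, 1, by positivity, fun x => ?_⟩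
  have h1 := hL.norm_gradient_sub_le hV x 0
  have h2 := norm_le_norm_add_norm_sub' (gradient V x) (gradient V 0)
  rw [sub_zero] at h1
  have := mul_nonneg (norm_nonneg (gradient V 0)) (norm_nonneg x)
  nlinarith

/-- An integration by parts inequality against a density `e^{-V}` for a vector field `u ^ n • W`. -/
lemma integral_pow_mul_inner_gradient_le (hV : ContDiff ℝ 1 V) (h : SubexpTail V)
    (hVg : PolyGrowth (gradient V)) (n : ℕ)
    {u : Euc d → ℝ} {u' : Euc d → Euc d →L[ℝ] ℝ} (hu : ∀ x, HasFDerivAt u (u' x) x)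
    (hu'c : Continuous u') (hug : PolyGrowth u) (hu'g : PolyGrowth u')
    {W : Euc d → Euc d} {W' : Euc d → Euc d →L[ℝ] Euc d} (hW : ∀ x, HasFDerivAt W (W' x) x)
    (hW'c : Continuous W') (hWg : PolyGrowth W) (hW'g : PolyGrowth W')
    {B : Euc d → ℝ} (hBc : Continuous B) (hBg : PolyGrowth B)
    (hB : ∀ x, u x ^ n * divergence (W' x) + n * u x ^ (n - 1) * u' x (W x) ≤ B x) :
    ∫ x, u x ^ n * inner ℝ (gradient V x) (W x) ∂(targetMeasure V) ≤
      ∫ x, B x ∂(targetMeasure V) := by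
  have huc : Continuous u := continuous_iff_continuousAt.2 fun x => (hu x).continuousAt
  have hWc : Continuous W := continuous_iff_continuousAt.2 fun x => (hW x).continuousAt
  have hpow : ∀ x, HasFDerivAt (fun x => u x ^ n) ((n * u x ^ (n - 1)) • u' x) x := fun x => by
    simpa using (hu x).pow n
  have hng : PolyGrowth fun x => (n * u x ^ (n - 1)) • u' x :=
    ((PolyGrowth.const (n : ℝ)).mul (hug.pow (n - 1))).smul hu'g
  rw [integral_mul_inner_gradient_targetMeasure hV h hVg hpow (by fun_prop) (hug.pow n) hng
    hW hW'c hWg hW'g]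
  refine integral_mono (PolyGrowth.integrable_targetMeasure hV.continuous h ?_ ?_)
    (hBg.integrable_targetMeasure hV.continuous h hBc) fun x => ?_
  · exact ((hug.pow n).mul hW'g.divergence).add (hng.clm_apply hWg)
  · exact ((huc.pow n).mul (continuous_divergence hW'c)).add (by fun_prop)
  · simpa [mul_assoc] using hB x

lemma hasFDerivAt_norm_sq_comp {W : Euc d → Euc d} {W' : Euc d →L[ℝ] Euc d} {x : Euc d}
    (hW : HasFDerivAt W W' x) :
    HasFDerivAt (fun x => ‖W x‖ ^ 2) ((innerSL ℝ ((2:ℝ) • W x)).comp W') x := by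
  refine hW.norm_sq.congr_fderiv ?_
  ext y
  simp [two_smul]

lemma LSmooth.integral_norm_sq_gradient_pow_succ_le {L : ℝ} (hV : ContDiff ℝ 2 V)
    (h : SubexpTail V) (hL : LSmooth V L) (n : ℕ) :
    ∫ x, (‖gradient V x‖ ^ 2) ^ (n + 1) ∂(targetMeasure V) ≤
      L * (d + 2 * n) * ∫ x, (‖gradient V x‖ ^ 2) ^ n ∂(targetMeasure V) := by
  have hg := contDiff_gradient (n := 1) hV
  have hgd : ∀ x, HasFDerivAt (gradient V) (fderiv ℝ (gradient V) x) x := fun x =>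
    (hg.differentiable (by simp) x).hasFDerivAt
  have hgc := hg.continuous
  have hg'c := hg.continuous_fderiv (by simp)
  have hpg := hL.polyGrowth_gradient hV
  have hpg' : PolyGrowth (fderiv ℝ (gradient V)) :=
    (PolyGrowth.const L).of_le fun x => (hL x).trans (le_abs_self _)
  have hpu : PolyGrowth fun x => ‖gradient V x‖ ^ 2 := hpg.norm.pow 2
  have key := integral_pow_mul_inner_gradient_le (hV.of_le (by norm_num)) h hpg n
    (fun x => hasFDerivAt_norm_sq_comp (hgd x)) (by fun_prop) hpu
    (((PolyGrowth.const (2:ℝ)).smul hpg).of_norm_le_mul hpg' fun x =>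
      (ContinuousLinearMap.opNorm_comp_le _ _).trans_eq (by rw [innerSL_apply_norm])) hgd hg'c hpg
      hpg'
    (B := fun x => L * (d + 2 * n) * (‖gradient V x‖ ^ 2) ^ n) (by fun_prop)
    ((PolyGrowth.const _).mul (hpu.pow n)) fun x => ?_
  · simpa only [real_inner_self_eq_norm_sq, ← pow_succ, integral_const_mul] using key
  · have h1 := (abs_le.1 (abs_divergence_le (fderiv ℝ (gradient V) x))).2
    have h2 : divergence (fderiv ℝ (gradient V) x) ≤ d * L :=
      h1.trans (mul_le_mul_of_nonneg_left (hL x) (by positivity))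
    have h3 : inner ℝ (gradient V x) (fderiv ℝ (gradient V) x (gradient V x)) ≤
        L * ‖gradient V x‖ ^ 2 := by
      refine (real_inner_le_norm _ _).trans ?_
      have := (fderiv ℝ (gradient V) x).le_of_opNorm_le (hL x) (gradient V x)
      nlinarith [norm_nonneg (gradient V x)]
    have hu0 : 0 ≤ ‖gradient V x‖ ^ 2 := by positivity
    simp only [ContinuousLinearMap.comp_apply, innerSL_apply_apply, real_inner_smul_left]
    have h4 : (n : ℝ) * (‖gradient V x‖ ^ 2) ^ (n - 1) * (‖gradient V x‖ ^ 2) =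
        n * (‖gradient V x‖ ^ 2) ^ n := by
      cases n with
      | zero => simp
      | succ n => simp [pow_succ, mul_assoc]
    have h5 := mul_le_mul_of_nonneg_left h2 (pow_nonneg hu0 n)
    have h6 := mul_le_mul_of_nonneg_left h3
      (mul_nonneg (Nat.cast_nonneg n) (pow_nonneg hu0 (n - 1)) :
        0 ≤ (n : ℝ) * (‖gradient V x‖ ^ 2) ^ (n - 1))
    linear_combination h5 + 2 * h6 + 2 * L * h4

/-- The moments of the gradient under the measure with density `e^{-V}`. -/
lemma LSmooth.integral_norm_sq_gradient_pow_le {L : ℝ} (hV : ContDiff ℝ 2 V)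
    (h : SubexpTail V) (hL : LSmooth V L) {m : ℕ} (hm : 1 ≤ m) :
    ∫ x, (‖gradient V x‖ ^ 2) ^ m ∂(targetMeasure V) ≤ (L * (d + 2 * ((m : ℝ) - 1))) ^ m := by
  have hL0 := hL.nonneg
  have := h.isProbabilityMeasure hV.continuous
  have hm' : (1:ℝ) ≤ m := by exact_mod_cast hm
  suffices H : ∀ n ≤ m, ∫ x, (‖gradient V x‖ ^ 2) ^ n ∂(targetMeasure V) ≤
      (L * (d + 2 * ((m : ℝ) - 1))) ^ n from H m le_rfl
  intro n
  induction n with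
  | zero => simp
  | succ n ih =>
    intro hn
    have hn' : (n:ℝ) + 1 ≤ m := by exact_mod_cast hn
    refine (hL.integral_norm_sq_gradient_pow_succ_le hV h n).trans ?_
    rw [pow_succ']
    refine mul_le_mul (by gcongr; linarith) (ih (by omega))
      (integral_nonneg fun x => by positivity) (mul_nonneg hL0 ?_)
    have : (0:ℝ) ≤ d := by positivity
    linarith

end GradientMoments

section AbsorbedMoments

variable {d : ℕ} {V : Euc d → ℝ}

lemma pow_mul_le_add_pow_succ {u x : ℝ} (hu : 0 ≤ u) (hx : 0 ≤ x) (n : ℕ) :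
    u ^ n * x ≤ u ^ (n + 1) / 4 + 4 ^ n * x ^ (n + 1) := by
  rcases le_total (4 * x) u with h | h
  · have h1 : u ^ n * x ≤ u ^ n * (u / 4) := by gcongr; linarith
    have h2 : 0 ≤ 4 ^ n * x ^ (n + 1) := by positivity
    rw [pow_succ]
    linarith
  · have h1 : u ^ n * x ≤ (4 * x) ^ n * x := by gcongr
    have h2 : 0 ≤ u ^ (n + 1) / 4 := by positivity
    rw [mul_pow] at h1
    rw [pow_succ x]
    linarith

/-- If the moments of `u` are controlled by lower moments of `u` multiplied by `u / 4 + x`, then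
they are controlled by the moments of `x`. -/
lemma integral_pow_succ_le_of_absorb (hV : Continuous V) (h : SubexpTail V) (n : ℕ)
    {u x : Euc d → ℝ} (hu : ∀ p, 0 ≤ u p) (hx : ∀ p, 0 ≤ x p) (huc : Continuous u)
    (hxc : Continuous x) (hug : PolyGrowth u) (hxg : PolyGrowth x)
    (hle : ∫ p, u p ^ (n + 1) ∂(targetMeasure V) ≤
      ∫ p, u p ^ n * (u p / 4 + x p) ∂(targetMeasure V)) :
    ∫ p, u p ^ (n + 1) ∂(targetMeasure V) ≤
      2 * 4 ^ n * ∫ p, x p ^ (n + 1) ∂(targetMeasure V) := by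
  have hi : Integrable (fun p => u p ^ (n + 1)) (targetMeasure V) :=
    (hug.pow _).integrable_targetMeasure hV h (by fun_prop)
  have hix : Integrable (fun p => x p ^ (n + 1)) (targetMeasure V) :=
    (hxg.pow _).integrable_targetMeasure hV h (by fun_prop)
  have hug4 : PolyGrowth fun p => u p / 4 := by
    simpa only [div_eq_mul_inv] using hug.mul (.const _)
  have hiux : Integrable (fun p => u p ^ n * (u p / 4 + x p)) (targetMeasure V) :=
    ((hug.pow _).mul (hug4.add hxg)).integrable_targetMeasure hV h (by fun_prop)
  have h1 : ∫ p, u p ^ n * (u p / 4 + x p) ∂(targetMeasure V) ≤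
      ∫ p, ((1 / 2) * u p ^ (n + 1) + 4 ^ n * x p ^ (n + 1)) ∂(targetMeasure V) := by
    refine integral_mono hiux ((hi.const_mul _).add (hix.const_mul _)) fun p => ?_
    have := pow_mul_le_add_pow_succ (hu p) (hx p) n
    simp only [pow_succ] at this ⊢
    linarith
  rw [integral_add (hi.const_mul _) (hix.const_mul _), integral_const_mul,
    integral_const_mul] at h1
  linarith

end AbsorbedMoments

section GaussianMoments

variable {d : ℕ}

/-- The potential of the standard Gaussian measure. -/
noncomputable def gaussianPotential (d : ℕ) (x : Euc d) : ℝ := ‖x‖ ^ 2 / 2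

lemma contDiff_gaussianPotential {n : WithTop ℕ∞} : ContDiff ℝ n (gaussianPotential d) :=
  (contDiff_norm_sq ℝ).div_const 2

lemma gradient_gaussianPotential : gradient (gaussianPotential d) = fun x => x := by
  funext x
  refine HasGradientAt.gradient ?_
  rw [hasGradientAt_iff_hasFDerivAt]
  have h : HasFDerivAt (fun x : Euc d => ‖x‖ ^ 2 * (2⁻¹ : ℝ)) _ x :=
    (hasFDerivAt_norm_sq_comp (hasFDerivAt_id x)).mul_const (2⁻¹ : ℝ)
  refine (h.congr_fderiv ?_).congr_of_eventuallyEq (.of_forall fun y => ?_)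
  · ext y
    simp
  · simp [gaussianPotential, div_eq_mul_inv]

lemma lSmooth_gaussianPotential : LSmooth (gaussianPotential d) 1 := fun x => by
  rw [gradient_gaussianPotential]
  simpa using ContinuousLinearMap.norm_id_le (𝕜 := ℝ) (E := Euc d)

lemma subexpTail_gaussianPotential : SubexpTail (gaussianPotential d) := by
  refine ⟨1, one_pos, ?_⟩
  have h : Filter.Tendsto (fun x : Euc d => exp (2 - ‖x‖)) (Bornology.cobounded _) (nhds 0) := by
    refine Real.tendsto_exp_atBot.comp ?_
    exact Filter.tendsto_atBot_add_const_left _ _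
      (Filter.tendsto_neg_atTop_atBot.comp tendsto_norm_cobounded_atTop)
  refine squeeze_zero (fun x => by positivity) (fun x => ?_) h
  rw [← exp_add, gaussianPotential]
  gcongr
  nlinarith [sq_nonneg (‖x‖ - 2)]

lemma polyGrowth_gradient_gaussianPotential : PolyGrowth (gradient (gaussianPotential d)) :=
  lSmooth_gaussianPotential.polyGrowth_gradient contDiff_gaussianPotential

instance : IsProbabilityMeasure (targetMeasure (gaussianPotential d)) :=
  subexpTail_gaussianPotential.isProbabilityMeasure
    (contDiff_gaussianPotential (n := 0)).continuous

lemma integral_norm_sq_pow_gaussian_le {m : ℕ} (hm : 1 ≤ m) :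
    ∫ p, (‖p‖ ^ 2) ^ m ∂(targetMeasure (gaussianPotential d)) ≤
      (d + 2 * ((m : ℝ) - 1)) ^ m := by
  simpa [gradient_gaussianPotential] using
    lSmooth_gaussianPotential.integral_norm_sq_gradient_pow_le (d := d)
      contDiff_gaussianPotential subexpTail_gaussianPotential hm

/-- Gaussian integration by parts, as an inequality. -/
lemma integral_pow_mul_inner_gaussian_le (n : ℕ)
    {u : Euc d → ℝ} {u' : Euc d → Euc d →L[ℝ] ℝ} (hu : ∀ x, HasFDerivAt u (u' x) x)
    (hu'c : Continuous u') (hug : PolyGrowth u) (hu'g : PolyGrowth u')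
    {W : Euc d → Euc d} {W' : Euc d → Euc d →L[ℝ] Euc d} (hW : ∀ x, HasFDerivAt W (W' x) x)
    (hW'c : Continuous W') (hWg : PolyGrowth W) (hW'g : PolyGrowth W')
    {B : Euc d → ℝ} (hBc : Continuous B) (hBg : PolyGrowth B)
    (hB : ∀ x, u x ^ n * divergence (W' x) + n * u x ^ (n - 1) * u' x (W x) ≤ B x) :
    ∫ x, u x ^ n * inner ℝ x (W x) ∂(targetMeasure (gaussianPotential d)) ≤
      ∫ x, B x ∂(targetMeasure (gaussianPotential d)) := by
  simpa [gradient_gaussianPotential] using integral_pow_mul_inner_gradient_le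
    contDiff_gaussianPotential subexpTail_gaussianPotential polyGrowth_gradient_gaussianPotential
    n hu hu'c hug hu'g hW hW'c hWg hW'g hBc hBg hB

lemma PolyGrowth.integrable_gaussian {F : Type*} [NormedAddCommGroup F] [NormedSpace ℝ F]
    {φ : Euc d → F} (hφ : PolyGrowth φ) (hc : Continuous φ) :
    Integrable φ (targetMeasure (gaussianPotential d)) :=
  hφ.integrable_targetMeasure (contDiff_gaussianPotential (n := 0)).continuous
    subexpTail_gaussianPotential hc

lemma integral_pow_succ_gaussian_le_of_absorb (n : ℕ)
    {u x : Euc d → ℝ} (hu : ∀ p, 0 ≤ u p) (hx : ∀ p, 0 ≤ x p) (huc : Continuous u)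
    (hxc : Continuous x) (hug : PolyGrowth u) (hxg : PolyGrowth x)
    (hle : ∫ p, u p ^ (n + 1) ∂(targetMeasure (gaussianPotential d)) ≤
      ∫ p, u p ^ n * (u p / 4 + x p) ∂(targetMeasure (gaussianPotential d))) :
    ∫ p, u p ^ (n + 1) ∂(targetMeasure (gaussianPotential d)) ≤
      2 * 4 ^ n * ∫ p, x p ^ (n + 1) ∂(targetMeasure (gaussianPotential d)) :=
  integral_pow_succ_le_of_absorb (contDiff_gaussianPotential (n := 0)).continuous
    subexpTail_gaussianPotential n hu hx huc hxc hug hxg hle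

lemma polyGrowth_inner_left (w : Euc d) : PolyGrowth fun p : Euc d => inner ℝ w p :=
  (PolyGrowth.const w).inner .id'

lemma integral_inner_sq_pow_succ_gaussian_le (w : Euc d) (n : ℕ) :
    ∫ p, (inner ℝ w p ^ 2) ^ (n + 1) ∂(targetMeasure (gaussianPotential d)) ≤
      (2 * n + 1) * ‖w‖ ^ 2 *
        ∫ p, (inner ℝ w p ^ 2) ^ n ∂(targetMeasure (gaussianPotential d)) := by
  have hu : ∀ p : Euc d, HasFDerivAt (fun p => inner ℝ w p) (innerSL ℝ w) p := fun p =>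
    (innerSL ℝ w).hasFDerivAt
  have key := integral_pow_mul_inner_gaussian_le (2 * n + 1) hu (by fun_prop)
    (polyGrowth_inner_left w) (.const _) (fun p => hasFDerivAt_const w p) (by fun_prop)
    (.const _) (.const _) (B := fun p => (2 * n + 1) * ‖w‖ ^ 2 * (inner ℝ w p ^ 2) ^ n)
    (by fun_prop) ((PolyGrowth.const _).mul (((polyGrowth_inner_left w).pow 2).pow n)) fun p => ?_
  · rw [integral_const_mul] at key
    refine le_of_eq_of_le (integral_congr_ae (.of_forall fun p => ?_)) key
    have : inner ℝ p w = inner ℝ w p := real_inner_comm w p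
    simp only [this]
    ring
  · have : divergence (0 : Euc d →L[ℝ] Euc d) = 0 := by simp [divergence]
    simp only [this, innerSL_apply_apply, real_inner_self_eq_norm_sq, ← pow_mul]
    push_cast
    exact le_of_eq (by ring)

/-- Moments of linear functionals under the Gaussian measure. -/
lemma integral_inner_sq_pow_gaussian_le (w : Euc d) (m : ℕ) :
    ∫ p, (inner ℝ w p ^ 2) ^ m ∂(targetMeasure (gaussianPotential d)) ≤
      (2 * m * ‖w‖ ^ 2) ^ m := by
  suffices H : ∀ n ≤ m, ∫ p, (inner ℝ w p ^ 2) ^ n ∂(targetMeasure (gaussianPotential d)) ≤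
      (2 * m * ‖w‖ ^ 2) ^ n from H m le_rfl
  intro n
  induction n with
  | zero => simp
  | succ n ih =>
    intro hn
    have hn' : (n:ℝ) + 1 ≤ m := by exact_mod_cast hn
    refine (integral_inner_sq_pow_succ_gaussian_le w n).trans ?_
    rw [pow_succ' (2 * _ * _)]
    refine mul_le_mul (by gcongr; linarith) (ih (by omega))
      (integral_nonneg fun x => by positivity) (by positivity)

/-- Symmetric bilinear maps `M` such that the trilinear form `⟪M x y, z⟫` is symmetric and has
`{1,2}{3}`-norm at most `τ`. -/
structure CubicBound (M : Euc d →L[ℝ] Euc d →L[ℝ] Euc d) (τ : ℝ) : Prop where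
  nonneg : 0 ≤ τ
  symm : ∀ x y, M x y = M y x
  inner_comm : ∀ x y z, inner ℝ (M x y) z = inner ℝ (M x z) y
  norm_le : ∀ x y, ‖M x y‖ ≤ τ * ‖x‖ * ‖y‖
  norm_trace_le : ‖∑ i, M (EuclideanSpace.basisFun (Fin d) ℝ i)
    (EuclideanSpace.basisFun (Fin d) ℝ i)‖ ≤ τ * √d
  sum_norm_sq_le : ∀ p, ∑ i, ‖M (EuclideanSpace.basisFun (Fin d) ℝ i) p‖ ^ 2 ≤ τ ^ 2 * ‖p‖ ^ 2

namespace CubicBound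

variable {M : Euc d →L[ℝ] Euc d →L[ℝ] Euc d} {τ : ℝ}

lemma hasFDerivAt_diag (hM : CubicBound M τ) (p : Euc d) :
    HasFDerivAt (fun p => M p p) ((2:ℝ) • M p) p := by
  refine (M.hasFDerivAt.clm_apply (hasFDerivAt_id p)).congr_fderiv ?_
  ext1 y
  simp [two_smul, hM.symm y p]

lemma polyGrowth_apply (M : Euc d →L[ℝ] Euc d →L[ℝ] Euc d) : PolyGrowth fun p => M p :=
  (PolyGrowth.const M).clm_apply .id'

lemma polyGrowth_diag (M : Euc d →L[ℝ] Euc d →L[ℝ] Euc d) : PolyGrowth fun p => M p p :=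
  (polyGrowth_apply M).clm_apply .id'

lemma divergence_apply (hM : CubicBound M τ) (v : Euc d) :
    divergence (M v) = inner ℝ (∑ i, M (EuclideanSpace.basisFun (Fin d) ℝ i)
      (EuclideanSpace.basisFun (Fin d) ℝ i)) v := by
  rw [divergence, sum_inner]
  refine Finset.sum_congr rfl fun i _ => ?_
  rw [hM.symm, hM.inner_comm]

lemma integral_norm_sq_diag_pow_succ_le (hM : CubicBound M τ) (n : ℕ) :
    ∫ p, (‖M p p‖ ^ 2) ^ (n + 1) ∂(targetMeasure (gaussianPotential d)) ≤
      ∫ p, (‖M p p‖ ^ 2) ^ n * (‖M p p‖ ^ 2 / 4 + τ ^ 2 * (d + (4 * n + 2) * ‖p‖ ^ 2))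
        ∂(targetMeasure (gaussianPotential d)) := by
  have hV := hM.hasFDerivAt_diag
  have hVg := polyGrowth_diag M
  have hMg := polyGrowth_apply M
  have hW : ∀ p, HasFDerivAt (fun p => M p (M p p))
      ((2:ℝ) • (M p).comp (M p) + M (M p p)) p := fun p => by
    refine (M.hasFDerivAt.clm_apply (hV p)).congr_fderiv ?_
    ext1 y
    simp [hM.symm y (M p p)]
  have hug : PolyGrowth fun p => ‖M p p‖ ^ 2 := hVg.norm.pow 2
  have key := integral_pow_mul_inner_gaussian_le n
    (fun p => hasFDerivAt_norm_sq_comp (hV p)) (by fun_prop) hug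
    (((PolyGrowth.const (2:ℝ)).smul hVg).of_norm_le_mul ((PolyGrowth.const (2:ℝ)).smul hMg)
      fun x => (ContinuousLinearMap.opNorm_comp_le _ _).trans_eq (by rw [innerSL_apply_norm]))
    hW (by fun_prop) (hMg.clm_apply hVg)
    (((PolyGrowth.const (2:ℝ)).smul (hMg.of_norm_le_mul hMg fun x =>
      ContinuousLinearMap.opNorm_comp_le _ _)).add ((PolyGrowth.const M).clm_apply hVg))
    (B := fun p => (‖M p p‖ ^ 2) ^ n *
      (‖M p p‖ ^ 2 / 4 + τ ^ 2 * (d + (4 * n + 2) * ‖p‖ ^ 2))) (by fun_prop) ?_ fun p => ?_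
  · refine le_of_eq_of_le (integral_congr_ae (.of_forall fun p => ?_)) key
    simp only [real_inner_comm (M p (M p p)) p, hM.inner_comm p (M p p) p,
      real_inner_self_eq_norm_sq, pow_succ]
  · refine (hug.pow n).mul (PolyGrowth.add ?_ ((PolyGrowth.const _).mul
      ((PolyGrowth.const _).add ((PolyGrowth.const _).mul (PolyGrowth.id'.norm.pow 2)))))
    simpa only [div_eq_mul_inv] using hug.mul (.const _)
  · have hdiv : divergence ((2:ℝ) • (M p).comp (M p) + M (M p p)) ≤
        ‖M p p‖ ^ 2 / 4 + τ ^ 2 * d + 2 * (τ ^ 2 * ‖p‖ ^ 2) := by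
      rw [divergence_add, divergence_smul, hM.divergence_apply]
      have h1 : divergence ((M p).comp (M p)) ≤ τ ^ 2 * ‖p‖ ^ 2 := by
        refine le_of_eq_of_le ?_ (hM.sum_norm_sq_le p)
        refine Finset.sum_congr rfl fun i _ => ?_
        rw [ContinuousLinearMap.comp_apply, hM.inner_comm, real_inner_self_eq_norm_sq, hM.symm]
      have h2 := (real_inner_le_norm (∑ i, M (EuclideanSpace.basisFun (Fin d) ℝ i)
        (EuclideanSpace.basisFun (Fin d) ℝ i)) (M p p)).trans
          (mul_le_mul_of_nonneg_right hM.norm_trace_le (norm_nonneg _))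
      nlinarith [sq_nonneg (‖M p p‖ / 2 - τ * √d), Real.sq_sqrt (Nat.cast_nonneg (α := ℝ) d)]
    have h3 : inner ℝ (M p p) (M p (M p (M p p))) ≤ τ ^ 2 * ‖p‖ ^ 2 * ‖M p p‖ ^ 2 := by
      rw [real_inner_comm, hM.inner_comm, real_inner_self_eq_norm_sq, ← mul_pow, ← mul_pow]
      exact pow_le_pow_left₀ (norm_nonneg _) (hM.norm_le p _) 2
    have hu0 : 0 ≤ ‖M p p‖ ^ 2 := by positivity
    have h4 : (n : ℝ) * (‖M p p‖ ^ 2) ^ (n - 1) * (‖M p p‖ ^ 2) = n * (‖M p p‖ ^ 2) ^ n := by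
      cases n with
      | zero => simp
      | succ n => simp [pow_succ, mul_assoc]
    simp only [ContinuousLinearMap.comp_apply, innerSL_apply_apply, real_inner_smul_left,
      smul_apply, real_inner_smul_right]
    have h5 := mul_le_mul_of_nonneg_left hdiv (pow_nonneg hu0 n)
    have h6 := mul_le_mul_of_nonneg_left h3
      (mul_nonneg (Nat.cast_nonneg n) (pow_nonneg hu0 (n - 1)) :
        0 ≤ (n : ℝ) * (‖M p p‖ ^ 2) ^ (n - 1))
    linear_combination h5 + 4 * h6 + 4 * τ ^ 2 * ‖p‖ ^ 2 * h4

lemma integral_norm_sq_diag_pow_le (hM : CubicBound M τ) {m : ℕ} (hm : 1 ≤ m) :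
    ∫ p, (‖M p p‖ ^ 2) ^ m ∂(targetMeasure (gaussianPotential d)) ≤
      (32 * m * (d + 2 * ((m : ℝ) - 1)) * τ ^ 2) ^ m := by
  obtain ⟨n, rfl⟩ : ∃ n, m = n + 1 := ⟨m - 1, by omega⟩
  have hd : (0:ℝ) ≤ d := Nat.cast_nonneg d
  have hn : (0:ℝ) ≤ n := Nat.cast_nonneg n
  have hpg : PolyGrowth fun p : Euc d => ‖p‖ ^ 2 := PolyGrowth.id'.norm.pow 2
  have h1 := integral_pow_succ_gaussian_le_of_absorb n (fun p => by positivity)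
    (x := fun p => τ ^ 2 * (d + (4 * n + 2) * ‖p‖ ^ 2)) (fun p => by positivity) (by fun_prop)
    (by fun_prop) ((polyGrowth_diag M).norm.pow 2)
    ((PolyGrowth.const _).mul ((PolyGrowth.const _).add ((PolyGrowth.const _).mul hpg)))
    (hM.integral_norm_sq_diag_pow_succ_le n)
  refine h1.trans ?_
  have h2 := integral_norm_sq_pow_gaussian_le (d := d) (m := n + 1) (by omega)
  have hi : Integrable (fun p : Euc d => (‖p‖ ^ 2) ^ (n + 1))
    (targetMeasure (gaussianPotential d)) := (hpg.pow _).integrable_gaussian (by fun_prop)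
  push_cast at h2 ⊢
  rw [add_sub_cancel_right] at h2 ⊢
  set D : ℝ := d + 2 * n
  have h3 : ∫ p, (τ ^ 2 * (d + (4 * n + 2) * ‖p‖ ^ 2)) ^ (n + 1)
      ∂(targetMeasure (gaussianPotential d)) ≤
      ∫ p, ((τ ^ 2) ^ (n + 1) * 2 ^ n * (4 * (n + 1)) ^ (n + 1) *
        (D ^ (n + 1) + (‖p‖ ^ 2) ^ (n + 1))) ∂(targetMeasure (gaussianPotential d)) := by
    refine integral_mono ?_ (((integrable_const _).add hi).const_mul _) fun p => ?_
    · exact (((PolyGrowth.const _).mul ((PolyGrowth.const _).add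
        ((PolyGrowth.const _).mul hpg))).pow _).integrable_gaussian (by fun_prop)
    · calc (τ ^ 2 * (d + (4 * n + 2) * ‖p‖ ^ 2)) ^ (n + 1)
        _ ≤ (τ ^ 2 * (4 * (n + 1) * (D + ‖p‖ ^ 2))) ^ (n + 1) := by
            gcongr
            simp only [D]
            nlinarith [sq_nonneg ‖p‖, mul_nonneg hn hd]
        _ = (τ ^ 2) ^ (n + 1) * (4 * (n + 1)) ^ (n + 1) * (D + ‖p‖ ^ 2) ^ (n + 1) := by
            rw [mul_pow, mul_pow (4 * ((n:ℝ) + 1)), mul_assoc]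
        _ ≤ (τ ^ 2) ^ (n + 1) * (4 * (n + 1)) ^ (n + 1) *
            (2 ^ n * (D ^ (n + 1) + (‖p‖ ^ 2) ^ (n + 1))) := by
            gcongr
            exact add_pow_le (by positivity) (by positivity) _
        _ = _ := by ring
  rw [integral_const_mul, integral_add (integrable_const _) hi, integral_const] at h3
  simp only [probReal_univ, one_smul] at h3
  calc _ ≤ 2 * 4 ^ n * ((τ ^ 2) ^ (n + 1) * 2 ^ n * (4 * (n + 1)) ^ (n + 1) *
        (D ^ (n + 1) + D ^ (n + 1))) := by
        gcongr
        exact h3.trans (by gcongr)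
    _ = (2 * 4 ^ n) * ((8 * (n + 1) * D * τ ^ 2) ^ (n + 1)) := by
        simp only [mul_pow, show (8:ℝ) = 2 * 4 by norm_num]
        ring
    _ ≤ 4 ^ (n + 1) * ((8 * (n + 1) * D * τ ^ 2) ^ (n + 1)) := by
        gcongr
        rw [pow_succ]
        have : (0:ℝ) ≤ 4 ^ n := by positivity
        linarith
    _ = _ := by rw [← mul_pow]; ring

set_option maxHeartbeats 1000000 in
lemma integral_inner_diag_sq_pow_succ_le (hM : CubicBound M τ) (n : ℕ) :
    ∫ p, (inner ℝ (M p p) p ^ 2) ^ (n + 1) ∂(targetMeasure (gaussianPotential d)) ≤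
      ∫ p, (inner ℝ (M p p) p ^ 2) ^ n * (inner ℝ (M p p) p ^ 2 / 4 +
        (4 * inner ℝ (∑ i, M (EuclideanSpace.basisFun (Fin d) ℝ i)
          (EuclideanSpace.basisFun (Fin d) ℝ i)) p ^ 2 + 6 * (n + 1) * ‖M p p‖ ^ 2))
        ∂(targetMeasure (gaussianPotential d)) := by
  have hV := hM.hasFDerivAt_diag
  have hVg := polyGrowth_diag M
  have hMg := polyGrowth_apply M
  have hu : ∀ p, HasFDerivAt (fun p => inner ℝ (M p p) p)
      ((3:ℝ) • innerSL ℝ (M p p)) p := fun p => by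
    refine ((hV p).inner ℝ (hasFDerivAt_id p)).congr_fderiv ?_
    ext1 y
    simp only [ContinuousLinearMap.comp_apply, fderivInnerCLM_apply, smul_apply,
      ContinuousLinearMap.prod_apply, ContinuousLinearMap.id_apply, id, innerSL_apply_apply,
      real_inner_smul_left, smul_eq_mul]
    rw [hM.inner_comm p y p]
    ring
  have hug : PolyGrowth fun p => inner ℝ (M p p) p := hVg.inner .id'
  have hu'g : PolyGrowth fun p => (3:ℝ) • innerSL ℝ (M p p) :=
    hVg.of_norm_le_mul (.const (3:ℝ)) fun p => by
      rw [norm_smul, innerSL_apply_norm, mul_comm]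
  set T := ∑ i, M (EuclideanSpace.basisFun (Fin d) ℝ i) (EuclideanSpace.basisFun (Fin d) ℝ i)
    with hT
  have key := integral_pow_mul_inner_gaussian_le (2 * n + 1) hu (by fun_prop) hug
    hu'g hV (by fun_prop) hVg ((PolyGrowth.const (2:ℝ)).smul hMg)
    (B := fun p => (inner ℝ (M p p) p ^ 2) ^ n * (inner ℝ (M p p) p ^ 2 / 4 +
        (4 * inner ℝ T p ^ 2 + 6 * (n + 1) * ‖M p p‖ ^ 2))) (by fun_prop) ?_ fun p => ?_
  · refine le_of_eq_of_le (integral_congr_ae (.of_forall fun p => ?_)) key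
    simp only [real_inner_comm (M p p) p]
    ring
  · refine ((hug.pow 2).pow n).mul (PolyGrowth.add ?_ (((PolyGrowth.const _).mul
      ((polyGrowth_inner_left T).pow 2)).add ((PolyGrowth.const _).mul (hVg.norm.pow 2))))
    simpa only [div_eq_mul_inv] using (hug.pow 2).mul (.const _)
  · rw [divergence_smul, hM.divergence_apply, ← hT]
    simp only [smul_apply, innerSL_apply_apply, real_inner_self_eq_norm_sq, smul_eq_mul,
      Nat.add_sub_cancel]
    set S := inner ℝ (M p p) p
    set t := inner ℝ T p
    have h0 : 0 ≤ (S ^ 2) ^ n := by positivity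
    have h1 : S * (2 * t) + (2 * n + 1) * (3 * ‖M p p‖ ^ 2) ≤
        S ^ 2 / 4 + (4 * t ^ 2 + 6 * (n + 1) * ‖M p p‖ ^ 2) := by
      nlinarith [sq_nonneg (S / 2 - 2 * t), sq_nonneg ‖M p p‖]
    have h2 := mul_le_mul_of_nonneg_left h1 h0
    refine le_of_eq_of_le ?_ h2
    push_cast
    ring

/-- Moments of the cubic form under the Gaussian measure. -/
lemma integral_inner_diag_sq_pow_le (hM : CubicBound M τ) {m : ℕ} (hm : 1 ≤ m) :
    ∫ p, (inner ℝ (M p p) p ^ 2) ^ m ∂(targetMeasure (gaussianPotential d)) ≤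
      (1536 * m ^ 2 * (d + 2 * ((m : ℝ) - 1)) * τ ^ 2) ^ m := by
  have hu := hM.integral_norm_sq_diag_pow_le hm
  obtain ⟨n, rfl⟩ : ∃ n, m = n + 1 := ⟨m - 1, by omega⟩
  have hd : (0:ℝ) ≤ d := Nat.cast_nonneg d
  have hn : (0:ℝ) ≤ n := Nat.cast_nonneg n
  have hVg := (polyGrowth_diag M)
  have h1 := hM.integral_inner_diag_sq_pow_succ_le n
  set T := ∑ i, M (EuclideanSpace.basisFun (Fin d) ℝ i) (EuclideanSpace.basisFun (Fin d) ℝ i)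
    with hT
  have hTg : PolyGrowth fun p : Euc d => 4 * inner ℝ T p ^ 2 :=
    (PolyGrowth.const _).mul ((polyGrowth_inner_left T).pow 2)
  have hug : PolyGrowth fun p : Euc d => 6 * ((n:ℝ) + 1) * ‖M p p‖ ^ 2 :=
    (PolyGrowth.const _).mul (hVg.norm.pow 2)
  replace h1 := integral_pow_succ_gaussian_le_of_absorb n (fun p => by positivity)
    (x := fun p => 4 * inner ℝ T p ^ 2 + 6 * (n + 1) * ‖M p p‖ ^ 2) (fun p => by positivity)
    (by fun_prop) (by fun_prop) ((hVg.inner .id').pow 2) (hTg.add hug) h1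
  refine h1.trans ?_
  have h2 := integral_inner_sq_pow_gaussian_le T (n + 1)
  have hi : Integrable (fun p : Euc d => (inner ℝ T p ^ 2) ^ (n + 1))
    (targetMeasure (gaussianPotential d)) :=
    (((polyGrowth_inner_left T).pow 2).pow _).integrable_gaussian (by fun_prop)
  have hi' : Integrable (fun p : Euc d => (‖M p p‖ ^ 2) ^ (n + 1))
    (targetMeasure (gaussianPotential d)) :=
    ((hVg.norm.pow 2).pow _).integrable_gaussian (by fun_prop)
  push_cast at h2 hu ⊢
  rw [add_sub_cancel_right] at hu ⊢
  set D : ℝ := d + 2 * n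
  have hD : 0 ≤ D := by positivity
  have hTD : ‖T‖ ^ 2 ≤ τ ^ 2 * D := by
    have := pow_le_pow_left₀ (norm_nonneg _) hM.norm_trace_le 2
    rw [mul_pow, Real.sq_sqrt hd] at this
    refine this.trans ?_
    gcongr
    simp only [D]
    linarith
  have h3 : ∫ p, (4 * inner ℝ T p ^ 2 + 6 * (n + 1) * ‖M p p‖ ^ 2) ^ (n + 1)
      ∂(targetMeasure (gaussianPotential d)) ≤
      ∫ p, (2 ^ n * (4 ^ (n + 1) * (inner ℝ T p ^ 2) ^ (n + 1) +
        (6 * (n + 1)) ^ (n + 1) * (‖M p p‖ ^ 2) ^ (n + 1)))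
        ∂(targetMeasure (gaussianPotential d)) := by
    refine integral_mono ((hTg.add hug).pow _ |>.integrable_gaussian (by fun_prop))
      (((hi.const_mul _).add (hi'.const_mul _)).const_mul _) fun p => ?_
    dsimp only
    rw [← mul_pow, ← mul_pow]
    exact add_pow_le (by positivity) (by positivity) _
  rw [integral_const_mul, integral_add (hi.const_mul _) (hi'.const_mul _), integral_const_mul,
    integral_const_mul] at h3
  have h4 : 4 ^ (n + 1) * ∫ p, (inner ℝ T p ^ 2) ^ (n + 1)
      ∂(targetMeasure (gaussianPotential d)) ≤ (192 * (n + 1) ^ 2 * D * τ ^ 2) ^ (n + 1) := by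
    refine (mul_le_mul_of_nonneg_left h2 (by positivity)).trans ?_
    rw [← mul_pow]
    refine pow_le_pow_left₀ (by positivity) ?_ _
    calc 4 * (2 * ((n:ℝ) + 1) * ‖T‖ ^ 2) = 8 * ((n:ℝ) + 1) * ‖T‖ ^ 2 := by ring
      _ ≤ 192 * (n + 1) ^ 2 * (τ ^ 2 * D) := by
        refine mul_le_mul ?_ hTD (by positivity) (by positivity)
        nlinarith
      _ = _ := by ring
  have h5 : (6 * ((n:ℝ) + 1)) ^ (n + 1) * ∫ p, (‖M p p‖ ^ 2) ^ (n + 1)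
      ∂(targetMeasure (gaussianPotential d)) ≤ (192 * (n + 1) ^ 2 * D * τ ^ 2) ^ (n + 1) := by
    refine (mul_le_mul_of_nonneg_left hu (by positivity)).trans_eq ?_
    rw [← mul_pow]
    ring
  calc _ ≤ 2 * 4 ^ n * (2 ^ n * ((192 * (n + 1) ^ 2 * D * τ ^ 2) ^ (n + 1) +
        (192 * (n + 1) ^ 2 * D * τ ^ 2) ^ (n + 1))) := by
        gcongr
        refine h3.trans ?_
        gcongr
    _ = 4 ^ n * 2 ^ (n + 2) * (192 * (n + 1) ^ 2 * D * τ ^ 2) ^ (n + 1) := by ring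
    _ ≤ 8 ^ (n + 1) * (192 * (n + 1) ^ 2 * D * τ ^ 2) ^ (n + 1) := by
        gcongr
        rw [show (8:ℝ) = 4 * 2 by norm_num, mul_pow, pow_succ, pow_succ, pow_succ (4:ℝ)]
        have : (0:ℝ) ≤ 4 ^ n * 2 ^ n := by positivity
        linarith
    _ = _ := by rw [← mul_pow]; ring

end CubicBound

end GaussianMoments

section StdGaussian

variable {d : ℕ}

lemma stdGaussian_eq_targetMeasure : stdGaussian d = targetMeasure (gaussianPotential d) := by
  have h0 : stdGaussian d = ProbabilityTheory.stdGaussian (Euc d) :=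
    ProbabilityTheory.map_pi_eq_stdGaussian
  rw [h0]
  refine (Measure.ext_of_charFun (E := Euc d) (funext fun t => ?_)).symm
  rw [ProbabilityTheory.charFun_stdGaussian]
  obtain ⟨C, hC⟩ : ∃ C : ℂ, ∀ t, charFun (targetMeasure (gaussianPotential d)) t =
      C * Complex.exp (-(‖t‖ : ℂ) ^ 2 / 2) := by
    refine ⟨((((volume.withDensity fun x : Euc d =>
      ENNReal.ofReal (exp (-gaussianPotential d x))) Set.univ)⁻¹.toReal : ℝ) : ℂ) *
      (π / (1 / 2 : ℂ)) ^ (Module.finrank ℝ (Euc d) / 2 : ℂ), fun t => ?_⟩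
    rw [charFun_apply, targetMeasure_integral (contDiff_gaussianPotential (n := 0)).continuous]
    have h1 := GaussianFourier.integral_cexp_neg_mul_sq_norm_add (V := Euc d)
      (b := (1 / 2 : ℂ)) (by norm_num) Complex.I t
    rw [Complex.real_smul, mul_assoc]
    congr 1
    rw [show -(‖t‖ : ℂ) ^ 2 / 2 = Complex.I ^ 2 * ‖t‖ ^ 2 / (4 * (1 / 2)) by
      rw [Complex.I_sq]; ring, ← h1]
    refine integral_congr_ae (.of_forall fun x => ?_)
    simp only [Complex.real_smul, gaussianPotential, Complex.ofReal_exp]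
    rw [← Complex.exp_add, real_inner_comm t x]
    congr 1
    push_cast
    ring
  have h1 := hC 0
  rw [charFun_zero] at h1
  have h2 : C = 1 := by simpa using h1.symm
  rw [hC, h2, one_mul]

instance : IsProbabilityMeasure (stdGaussian d) := by
  rw [stdGaussian_eq_targetMeasure]; infer_instance

end StdGaussian

section TensorNorm

variable {ι : Type*} [Fintype ι]

lemma sum_le_norm12_3 (A : ι → ι → ι → ℝ) {X : ι → ι → ℝ} {y : ι → ℝ}
    (hX : ∑ i, ∑ j, X i j ^ 2 ≤ 1) (hy : ∑ k, y k ^ 2 ≤ 1) :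
    ∑ i, ∑ j, ∑ k, A i j k * X i j * y k ≤ norm12_3 A := by
  refine le_csSup ⟨∑ i, ∑ j, ∑ k, |A i j k|, ?_⟩ ⟨X, y, hX, hy, rfl⟩
  rintro s ⟨X, y, hX, hy, rfl⟩
  refine Finset.sum_le_sum fun i _ => Finset.sum_le_sum fun j _ => Finset.sum_le_sum fun k _ => ?_
  have h1 : |X i j| ≤ 1 := by
    rw [← sq_le_one_iff_abs_le_one]
    refine le_trans ?_ hX
    refine le_trans ?_ (Finset.single_le_sum (f := fun i => ∑ j, X i j ^ 2)
      (fun i _ => by positivity) (Finset.mem_univ i))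
    exact Finset.single_le_sum (f := fun j => X i j ^ 2) (fun j _ => by positivity)
      (Finset.mem_univ j)
  have h2 : |y k| ≤ 1 := by
    rw [← sq_le_one_iff_abs_le_one]
    exact le_trans (Finset.single_le_sum (f := fun j => y j ^ 2) (fun j _ => by positivity)
      (Finset.mem_univ k)) hy
  refine (le_abs_self _).trans ?_
  rw [abs_mul, abs_mul]
  calc |A i j k| * |X i j| * |y k| ≤ |A i j k| * 1 * 1 := by gcongr
    _ = _ := by ring

lemma norm12_3_nonneg (A : ι → ι → ι → ℝ) : 0 ≤ norm12_3 A := by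
  simpa using sum_le_norm12_3 A (X := fun _ _ => 0) (y := fun _ => 0) (by simp) (by simp)

lemma sum_le_norm12_3_mul (A : ι → ι → ι → ℝ) (X : ι → ι → ℝ) (y : ι → ℝ) :
    ∑ i, ∑ j, ∑ k, A i j k * X i j * y k ≤
      norm12_3 A * √(∑ i, ∑ j, X i j ^ 2) * √(∑ k, y k ^ 2) := by
  have hX0 : 0 ≤ ∑ i, ∑ j, X i j ^ 2 := by positivity
  have hy0 : 0 ≤ ∑ k, y k ^ 2 := by positivity
  rcases hX0.eq_or_lt with hX | hX
  · have : ∀ i j, X i j = 0 := fun i j => by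
      have h1 := (Finset.sum_eq_zero_iff_of_nonneg (fun i _ => by positivity)).1 hX.symm i
        (Finset.mem_univ i)
      have h2 := (Finset.sum_eq_zero_iff_of_nonneg (fun i _ => by positivity)).1 h1 j
        (Finset.mem_univ j)
      simpa using h2
    simp [this]
  rcases hy0.eq_or_lt with hy | hy
  · have : ∀ i, y i = 0 := fun i => by
      have h1 := (Finset.sum_eq_zero_iff_of_nonneg (fun i _ => by positivity)).1 hy.symm i
        (Finset.mem_univ i)
      simpa using h1
    simp [this]
  set a := √(∑ i, ∑ j, X i j ^ 2) with ha
  set b := √(∑ k, y k ^ 2) with hb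
  have ha0 : 0 < a := Real.sqrt_pos.2 hX
  have hb0 : 0 < b := Real.sqrt_pos.2 hy
  have key := sum_le_norm12_3 A (X := fun i j => X i j / a) (y := fun k => y k / b) ?_ ?_
  · have h : ∑ i, ∑ j, ∑ k, A i j k * X i j * y k =
        (∑ i, ∑ j, ∑ k, A i j k * (X i j / a) * (y k / b)) * (a * b) := by
      simp only [Finset.sum_mul]
      refine Finset.sum_congr rfl fun i _ => Finset.sum_congr rfl fun j _ =>
        Finset.sum_congr rfl fun k _ => ?_
      field_simp
    rw [h, mul_assoc]
    gcongr
  · simp only [div_pow, ← Finset.sum_div]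
    rw [ha, Real.sq_sqrt hX0, div_self hX.ne']
  · simp only [div_pow, ← Finset.sum_div]
    rw [hb, Real.sq_sqrt hy0, div_self hy.ne']

end TensorNorm

section ThirdDerivative

variable {d : ℕ} {f : Euc d → ℝ}

lemma fderiv_eq_innerSL_gradient (f : Euc d → ℝ) :
    fderiv ℝ f = fun x => innerSL ℝ (gradient f x) := by
  funext x
  exact ((InnerProductSpace.toDual ℝ (Euc d)).apply_symm_apply (fderiv ℝ f x)).symm

lemma fderiv_fderiv_apply (hf : ContDiff ℝ 2 f) (x y z : Euc d) :
    fderiv ℝ (fderiv ℝ f) x y z = inner ℝ (fderiv ℝ (gradient f) x y) z := by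
  have hg := ((contDiff_gradient (n := 1) hf).differentiable (by simp) x).hasFDerivAt
  have h : HasFDerivAt (fun x => innerSL ℝ (gradient f x)) _ x :=
    (innerSL ℝ (E := Euc d)).hasFDerivAt.comp x hg
  rw [fderiv_eq_innerSL_gradient, h.fderiv]
  rfl

lemma inner_hessian_comm (hf : ContDiff ℝ 2 f) (x y z : Euc d) :
    inner ℝ (fderiv ℝ (gradient f) x y) z = inner ℝ (fderiv ℝ (gradient f) x z) y := by
  rw [← fderiv_fderiv_apply hf, ← fderiv_fderiv_apply hf]
  exact (hf.contDiffAt.isSymmSndFDerivAt (by simp)) y z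

/-- The third derivative of `f`, as a bilinear map. -/
noncomputable def thirdDeriv (f : Euc d → ℝ) (x : Euc d) : Euc d →L[ℝ] Euc d →L[ℝ] Euc d :=
  fderiv ℝ (fderiv ℝ (gradient f)) x

lemma hasFDerivAt_hessian (hf : ContDiff ℝ 3 f) (x : Euc d) :
    HasFDerivAt (fderiv ℝ (gradient f)) (thirdDeriv f x) x :=
  (((contDiff_gradient (n := 2) (hf.of_le (by norm_num))).fderiv_right
    (m := 1) (by norm_num)).differentiable (by simp) x).hasFDerivAt

lemma continuous_thirdDeriv (hf : ContDiff ℝ 3 f) : Continuous (thirdDeriv f) :=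
  ((contDiff_gradient (n := 2) (hf.of_le (by norm_num))).fderiv_right
    (m := 1) (by norm_num)).continuous_fderiv (by simp)

lemma hasFDerivAt_inner_hessian (hf : ContDiff ℝ 3 f) (x a b : Euc d) :
    HasFDerivAt (fun x => inner ℝ (fderiv ℝ (gradient f) x a) b)
      ((innerSL ℝ b).comp ((thirdDeriv f x).flip a)) x := by
  refine (((hasFDerivAt_hessian hf x).clm_apply (hasFDerivAt_const a x)).inner ℝ
    (hasFDerivAt_const b x)).congr_fderiv ?_
  ext u
  simp [real_inner_comm]

lemma thirdDeriv_inner_comm (hf : ContDiff ℝ 3 f) (x u y z : Euc d) :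
    inner ℝ (thirdDeriv f x u y) z = inner ℝ (thirdDeriv f x u z) y := by
  have h1 := hasFDerivAt_inner_hessian hf x y z
  have h2 := hasFDerivAt_inner_hessian hf x z y
  simp only [inner_hessian_comm (hf.of_le (by norm_num)) _ y z] at h1
  have := congrArg (fun l => l u) (h1.unique h2)
  simpa [real_inner_comm] using this

lemma tensor3_eq (hf : ContDiff ℝ 3 f) (x : Euc d) (i j k : Fin d) :
    tensor3 f x i j k = inner ℝ (thirdDeriv f x (EuclideanSpace.basisFun (Fin d) ℝ i)
      (EuclideanSpace.basisFun (Fin d) ℝ j)) (EuclideanSpace.basisFun (Fin d) ℝ k) := by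
  have hD : HasFDerivAt (fderiv ℝ (fderiv ℝ f)) (fderiv ℝ (fderiv ℝ (fderiv ℝ f)) x) x :=
    (((hf.fderiv_right (m := 2) (by norm_num)).fderiv_right
      (m := 1) (by norm_num)).differentiable (by simp) x).hasFDerivAt
  have h (a b c : Euc d) : fderiv ℝ (fderiv ℝ (fderiv ℝ f)) x a b c =
      inner ℝ (thirdDeriv f x a b) c := by
    have h1 := (hD.clm_apply (hasFDerivAt_const b x)).clm_apply (hasFDerivAt_const c x)
    simp only [fderiv_fderiv_apply (hf.of_le (by norm_num))] at h1
    have := congrArg (fun l => l a) (h1.unique (hasFDerivAt_inner_hessian hf x b c))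
    simpa [real_inner_comm] using this
  rw [tensor3, iteratedFDeriv_succ_apply_right, iteratedFDeriv_two_apply, ← h]
  simp [Fin.init]

/-- The third derivative of a strongly Hessian Lipschitz function. -/
lemma StronglyHessLip.norm_sum_thirdDeriv_le (hf : ContDiff ℝ 3 f) {γ L : ℝ}
    (h : StronglyHessLip f γ L) (x : Euc d) (X : Fin d → Fin d → ℝ) :
    ‖∑ i, ∑ j, X i j • thirdDeriv f x (EuclideanSpace.basisFun (Fin d) ℝ i)
      (EuclideanSpace.basisFun (Fin d) ℝ j)‖ ≤
      γ * L ^ ((3:ℝ) / 2) * √(∑ i, ∑ j, X i j ^ 2) := by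
  set v := ∑ i, ∑ j, X i j • thirdDeriv f x (EuclideanSpace.basisFun (Fin d) ℝ i)
      (EuclideanSpace.basisFun (Fin d) ℝ j) with hv
  have h1 := sum_le_norm12_3_mul (tensor3 f x) X v
  have h2 : ∑ i, ∑ j, ∑ k, tensor3 f x i j k * X i j * v k = ‖v‖ ^ 2 := by
    have h3 (w : Euc d) : ∑ k, inner ℝ w (EuclideanSpace.basisFun (Fin d) ℝ k) * v k =
        inner ℝ w v := by
      rw [← (EuclideanSpace.basisFun (Fin d) ℝ).sum_inner_mul_inner w v]
      simp [EuclideanSpace.inner_single_left]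
    have h4 : ‖v‖ ^ 2 = inner ℝ (∑ i, ∑ j, X i j • thirdDeriv f x
        (EuclideanSpace.basisFun (Fin d) ℝ i) (EuclideanSpace.basisFun (Fin d) ℝ j)) v := by
      rw [← hv, real_inner_self_eq_norm_sq]
    rw [h4]
    simp only [sum_inner, real_inner_smul_left]
    refine Finset.sum_congr rfl fun i _ => Finset.sum_congr rfl fun j _ => ?_
    rw [← h3, Finset.mul_sum]
    exact Finset.sum_congr rfl fun k _ => by rw [tensor3_eq hf]; ring
  have h4 : √(∑ k, v k ^ 2) = ‖v‖ := by simp [EuclideanSpace.norm_eq]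
  rw [h2, h4] at h1
  have h5 := h1.trans (mul_le_mul_of_nonneg_right
    (mul_le_mul_of_nonneg_right (h x) (Real.sqrt_nonneg _)) (norm_nonneg _))
  rcases (norm_nonneg v).eq_or_lt with h0 | h0
  · rw [← h0]
    have := (norm12_3_nonneg _).trans (h x)
    positivity
  · exact le_of_mul_le_mul_right (by rwa [← sq]) h0

lemma StronglyHessLip.cubicBound (hf : ContDiff ℝ 3 f) {γ L : ℝ}
    (h : StronglyHessLip f γ L) (x : Euc d) :
    CubicBound (thirdDeriv f x) (γ * L ^ ((3:ℝ) / 2)) where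
  nonneg := (norm12_3_nonneg _).trans (h x)
  symm u v := ((contDiff_gradient (n := 2) (hf.of_le (by norm_num))).contDiffAt.isSymmSndFDerivAt
    (by simp)) u v
  inner_comm := thirdDeriv_inner_comm hf x
  norm_le u v := by
    have h1 := h.norm_sum_thirdDeriv_le hf x (fun i j => u i * v j)
    have h2 : ∑ i, ∑ j, (u i * v j) ^ 2 = (‖u‖ * ‖v‖) ^ 2 := by
      rw [mul_pow, EuclideanSpace.real_norm_sq_eq, EuclideanSpace.real_norm_sq_eq,
        Finset.sum_mul_sum]
      simp only [mul_pow]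
    rw [h2, Real.sqrt_sq (by positivity), ← mul_assoc] at h1
    refine le_of_eq_of_le ?_ h1
    have hu := (EuclideanSpace.basisFun (Fin d) ℝ).sum_repr u
    have hv := (EuclideanSpace.basisFun (Fin d) ℝ).sum_repr v
    conv_lhs => rw [← hu, ← hv]
    simp only [map_sum, map_smul, sum_apply, smul_apply, Finset.smul_sum,
      smul_smul]
    rw [Finset.sum_comm]
    simp [mul_comm]
  norm_trace_le := by
    have h1 := h.norm_sum_thirdDeriv_le hf x (fun i j => if i = j then 1 else 0)
    simpa using h1
  sum_norm_sq_le p := by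
    set b := EuclideanSpace.basisFun (Fin d) ℝ with hb
    set Y : Fin d → Fin d → ℝ := fun i j => inner ℝ (thirdDeriv f x (b i) p) (b j) with hY
    have h1 := h.norm_sum_thirdDeriv_le hf x Y
    have h2 : ∑ i, ‖thirdDeriv f x (b i) p‖ ^ 2 = ∑ i, ∑ j, Y i j ^ 2 := by
      refine Finset.sum_congr rfl fun i _ => ?_
      rw [← b.sum_sq_norm_inner_left]
      simp [hY, real_inner_comm]
    have h3 : ∑ i, ∑ j, Y i j ^ 2 =
        inner ℝ (∑ i, ∑ j, Y i j • thirdDeriv f x (b i) (b j)) p := by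
      simp only [sum_inner, real_inner_smul_left]
      refine Finset.sum_congr rfl fun i _ => Finset.sum_congr rfl fun j _ => ?_
      rw [thirdDeriv_inner_comm hf x (b i) (b j) p, sq]
    rw [h2]
    obtain ⟨s, hsY⟩ : ∃ s, s = ∑ i, ∑ j, Y i j ^ 2 := ⟨_, rfl⟩
    rw [← hsY] at h1 h3 ⊢
    have hs : 0 ≤ s := by rw [hsY]; positivity
    have h4 : s ≤ γ * L ^ ((3:ℝ) / 2) * √s * ‖p‖ :=
      h3.le.trans <| (real_inner_le_norm _ _).trans (mul_le_mul_of_nonneg_right h1 (norm_nonneg _))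
    have h0 : 0 ≤ γ * L ^ ((3:ℝ) / 2) := (norm12_3_nonneg _).trans (h x)
    rw [← mul_pow]
    have h5 := Real.sq_sqrt hs
    rcases (Real.sqrt_nonneg s).eq_or_lt with h6 | h6
    · have h7 : s = 0 := by rw [← h5, ← h6]; norm_num
      rw [h7]
      positivity
    · rw [← h5]
      refine pow_le_pow_left₀ h6.le (le_of_mul_le_mul_right ?_ h6) 2
      rw [← sq, h5]
      linarith

end ThirdDerivative

section
open scoped Manifold

theorem LipschitzWith.exists_global_integralCurve {E : Type*} [NormedAddCommGroup E]
    [NormedSpace ℝ E] [CompleteSpace E] {v : E → E} (hv : ContDiff ℝ 1 v) {K : ℝ≥0}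
    (hK : LipschitzWith K v) (x : E) :
    ∃ u : ℝ → E, u 0 = x ∧ ∀ t, HasDerivAt u (v (u t)) t := by
  have hε : (0:ℝ) < 1 / (2 * (K + 1)) := by positivity
  have key := exists_isMIntegralCurve_of_isMIntegralCurveOn (I := 𝓘(ℝ, E)) (M := E) (v := v)
    (contMDiff_vectorSpace_iff_contDiff.2 hv) hε ?_ x
  · obtain ⟨u, hu0, hu⟩ := key
    refine ⟨u, hu0, fun t => ?_⟩
    exact (hasMFDerivAt_iff_hasFDerivAt.1 (hu t) :
      HasFDerivAt u (ContinuousLinearMap.smulRight (1 : ℝ →L[ℝ] ℝ) (v (u t))) t)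
  · intro y
    have hP : IsPicardLindelof (fun _ => v) (tmin := -(1 / (2 * ((K:ℝ) + 1))))
        (tmax := 1 / (2 * ((K:ℝ) + 1))) ⟨0, by constructor <;> linarith⟩ y (‖v y‖₊ + 1) 0
        (‖v y‖₊ + K * (‖v y‖₊ + 1)) K := by
      refine IsPicardLindelof.of_time_independent (fun z hz => ?_) hK.lipschitzOnWith ?_
      · have h1 := hK.norm_sub_le z y
        have h2 : ‖z - y‖ ≤ ‖v y‖ + 1 := by simpa [dist_eq_norm] using hz
        have h3 := norm_add_le (v z - v y) (v y)
        rw [sub_add_cancel] at h3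
        push_cast
        nlinarith [K.2, mul_le_mul_of_nonneg_left h2 K.2]
      · push_cast
        simp only [sub_zero, zero_sub, neg_neg, max_self]
        rw [mul_one_div, div_le_iff₀ (by positivity)]
        nlinarith [K.2, norm_nonneg (v y), mul_nonneg K.2 (norm_nonneg (v y))]
    obtain ⟨u, hu0, hu⟩ := hP.exists_eq_forall_mem_Icc_hasDerivWithinAt₀
    refine ⟨u, hu0, fun t ht => ?_⟩
    exact hasMFDerivWithinAt_iff_hasFDerivWithinAt.2
      ((hu t ⟨ht.1.le, ht.2.le⟩).mono Set.Ioo_subset_Icc_self).hasFDerivWithinAt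

end

section

variable {d : ℕ} {f : Euc d → ℝ} {L : ℝ}

structure IsHamiltonianTrajectory (f : Euc d → ℝ) (Q P : ℝ → Euc d) : Prop where
  hasDerivAt_fst : ∀ t, HasDerivAt Q (P t) t
  hasDerivAt_snd : ∀ t, HasDerivAt P (-gradient f (Q t)) t

/-- `Φ z` is the trajectory of Hamilton's equations for `f q + ‖p‖ ^ 2 / 2` started at `z`. -/
def IsHamiltonianFlow (f : Euc d → ℝ) (Φ : Euc d × Euc d → ℝ → Euc d × Euc d) : Prop :=
  ∀ z, Φ z 0 = z ∧ IsHamiltonianTrajectory f (fun t => (Φ z t).1) (fun t => (Φ z t).2)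

theorem LSmooth.exists_isHamiltonianFlow (hf : ContDiff ℝ 2 f) (hL : LSmooth f L) :
    ∃ Φ, IsHamiltonianFlow f Φ := by
  have hv : ContDiff ℝ 1 (fun z : Euc d × Euc d => (z.2, -gradient f z.1)) :=
    contDiff_snd.prodMk ((contDiff_gradient (n := 1) hf).comp contDiff_fst).neg
  have hK : LipschitzWith (Real.toNNReal (L + 1))
      (fun z : Euc d × Euc d => (z.2, -gradient f z.1)) := by
    have hL0 := hL.nonneg
    refine LipschitzWith.of_dist_le_mul fun z w => ?_
    rw [Real.coe_toNNReal _ (by linarith), dist_eq_norm, dist_eq_norm, Prod.norm_def]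
    have h1 := norm_fst_le (z - w)
    have h2 := norm_snd_le (z - w)
    have h3 := hL.norm_gradient_sub_le hf w.1 z.1
    rw [norm_sub_rev w.1] at h3
    simp only [Prod.fst_sub, Prod.snd_sub] at *
    refine max_le (by nlinarith [norm_nonneg (z - w)]) ?_
    rw [neg_sub_neg]
    nlinarith [norm_nonneg (z - w), mul_le_mul_of_nonneg_left h1 hL0]
  choose Φ hΦ0 hΦ using hK.exists_global_integralCurve hv
  refine ⟨Φ, fun z => ⟨hΦ0 z, fun t => ?_, fun t => ?_⟩⟩
  · exact (hasFDerivAt_fst (𝕜 := ℝ) (p := Φ z t)).comp_hasDerivAt t (hΦ z t)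
  · exact (hasFDerivAt_snd (𝕜 := ℝ) (p := Φ z t)).comp_hasDerivAt t (hΦ z t)

theorem IsHamiltonianTrajectory.energy_eq (hf : ContDiff ℝ 2 f) {Q P : ℝ → Euc d}
    (h : IsHamiltonianTrajectory f Q P) (t : ℝ) :
    f (Q t) + ‖P t‖ ^ 2 / 2 = f (Q 0) + ‖P 0‖ ^ 2 / 2 := by
  have hd : ∀ s, HasDerivAt (fun s => f (Q s) + ‖P s‖ ^ 2 / 2) 0 s := fun s => by
    have h1 := ((hf.differentiable (by norm_num) (Q s)).hasFDerivAt).comp_hasDerivAt s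
      (h.hasDerivAt_fst s)
    rw [fderiv_eq_innerSL_gradient] at h1
    have h2 := (h.hasDerivAt_snd s).norm_sq.div_const 2
    refine (h1.add h2).congr_deriv ?_
    simp only [innerSL_apply_apply, inner_neg_right, real_inner_comm (P s)]
    ring
  exact is_const_of_deriv_eq_zero (fun s => (hd s).differentiableAt) (fun s => (hd s).deriv) t 0

theorem tendsto_iterate_of_consistent {E : Type*} [NormedAddCommGroup E] {Ψ : ℝ → E → E}
    {u : ℝ → E} {B C T : ℝ} (hB : 0 ≤ B) (hT : 0 ≤ T)
    (hΨ : ∀ h, 0 ≤ h → h ≤ 1 → ∀ x y, ‖Ψ h x - Ψ h y‖ ≤ (1 + B * h) * ‖x - y‖)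
    (hu : ∀ h t, 0 ≤ h → h ≤ 1 → 0 ≤ t → t + h ≤ T → ‖u (t + h) - Ψ h (u t)‖ ≤ C * h ^ 2) :
    Filter.Tendsto (fun N : ℕ => (Ψ (T / N))^[N] (u 0)) Filter.atTop (nhds (u T)) := by
  have hlim : Filter.Tendsto (fun N : ℕ => (C * T ^ 2 * exp (B * T)) / (N : ℝ))
      Filter.atTop (nhds 0) := tendsto_const_div_atTop_nhds_zero_nat _
  rw [tendsto_iff_norm_sub_tendsto_zero]
  refine squeeze_zero' (.of_forall fun _ => norm_nonneg _) ?_ hlim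
  obtain ⟨N₀, hN₀⟩ := exists_nat_ge T
  filter_upwards [Filter.eventually_ge_atTop (N₀ + 1)] with N hN
  have hNT : T ≤ N := hN₀.trans (by exact_mod_cast (by omega : N₀ ≤ N))
  have hNpos : (0 : ℝ) < N := by exact_mod_cast (by omega : 0 < N)
  set h : ℝ := T / N with hh
  have hNh : N * h = T := by rw [hh]; field_simp
  have h0 : 0 ≤ h := by positivity
  have h1 : h ≤ 1 := by rw [hh, div_le_one hNpos]; exact hNT
  have hstep : ∀ k : ℕ, k ≤ N →
      ‖u (k * h) - (Ψ h)^[k] (u 0)‖ ≤ k * (C * h ^ 2) * (1 + B * h) ^ k := by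
    intro k
    induction k with
    | zero => intro _; simp
    | succ k ih =>
      intro hk
      have hkh : (k : ℝ) * h + h ≤ T := by
        rw [← hNh]
        have : ((k + 1 : ℕ) : ℝ) ≤ N := by exact_mod_cast hk
        push_cast at this
        nlinarith
      rw [Function.iterate_succ_apply']
      have e1 := hu h (k * h) h0 h1 (by positivity) hkh
      have e2 := hΨ h h0 h1 (u (k * h)) ((Ψ h)^[k] (u 0))
      have e3 := ih (by omega)
      have e4 := norm_sub_le_norm_sub_add_norm_sub (u (k * h + h)) (Ψ h (u (k * h)))
        (Ψ h ((Ψ h)^[k] (u 0)))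
      have hBh : 0 ≤ B * h := by positivity
      have e5 : 1 ≤ (1 + B * h) ^ (k + 1) := one_le_pow₀ (by linarith)
      have e6 := mul_le_mul_of_nonneg_left e3 (by linarith : 0 ≤ 1 + B * h)
      have e7 : 0 ≤ C * h ^ 2 := (norm_nonneg _).trans e1
      push_cast
      rw [add_mul, one_mul]
      calc _ ≤ C * h ^ 2 * 1 + (1 + B * h) * (k * (C * h ^ 2) * (1 + B * h) ^ k) := by linarith
        _ ≤ C * h ^ 2 * (1 + B * h) ^ (k + 1)
            + (1 + B * h) * (k * (C * h ^ 2) * (1 + B * h) ^ k) := by gcongr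
        _ = _ := by ring
  have hN' := hstep N le_rfl
  rw [hNh, norm_sub_rev] at hN'
  have e7 : 0 ≤ C * h ^ 2 := by
    have := hu h 0 h0 h1 le_rfl
      (by rw [zero_add, ← hNh]; nlinarith [(by exact_mod_cast (by omega : 1 ≤ N) : (1:ℝ) ≤ N)])
    exact (norm_nonneg _).trans this
  refine hN'.trans ?_
  have e8 : (1 + B * h) ^ N ≤ exp (B * T) := by
    calc (1 + B * h) ^ N ≤ (exp (B * h)) ^ N := by
          have := add_one_le_exp (B * h)
          exact pow_le_pow_left₀ (by positivity) (by linarith) _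
      _ = exp (B * T) := by rw [← Real.exp_nat_mul, ← hNh]; ring_nf
  calc _ ≤ N * (C * h ^ 2) * exp (B * T) := by gcongr
    _ = _ := by rw [hh]; field_simp

/-- One step of the symplectic Euler method. -/
noncomputable def symplecticEuler (f : Euc d → ℝ) (h : ℝ) (z : Euc d × Euc d) : Euc d × Euc d :=
  (z.1 + h • z.2, z.2 - h • gradient f (z.1 + h • z.2))

theorem LSmooth.norm_symplecticEuler_sub_le (hf : ContDiff ℝ 2 f) (hL : LSmooth f L) {h : ℝ}
    (h0 : 0 ≤ h) (h1 : h ≤ 1) (z w : Euc d × Euc d) :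
    ‖symplecticEuler f h z - symplecticEuler f h w‖ ≤ (1 + (1 + 2 * L) * h) * ‖z - w‖ := by
  have hL0 := hL.nonneg
  have e1 := norm_fst_le (z - w)
  have e2 := norm_snd_le (z - w)
  rw [Prod.fst_sub] at e1
  rw [Prod.snd_sub] at e2
  have e3 : ‖(z.1 + h • z.2) - (w.1 + h • w.2)‖ ≤ (1 + h) * ‖z - w‖ := by
    have : (z.1 + h • z.2) - (w.1 + h • w.2) = (z.1 - w.1) + h • (z.2 - w.2) := by module
    rw [this]
    refine (norm_add_le _ _).trans ?_
    rw [norm_smul, Real.norm_of_nonneg h0]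
    nlinarith
  have e4 := hL.norm_gradient_sub_le hf (z.1 + h • z.2) (w.1 + h • w.2)
  have hn := norm_nonneg (z - w)
  rw [Prod.norm_def]
  refine max_le ?_ ?_
  · refine e3.trans (mul_le_mul_of_nonneg_right ?_ hn)
    nlinarith [mul_nonneg hL0 h0]
  · have : (symplecticEuler f h z - symplecticEuler f h w).2 = (z.2 - w.2)
        - h • (gradient f (z.1 + h • z.2) - gradient f (w.1 + h • w.2)) := by
      simp only [symplecticEuler, Prod.snd_sub]; module
    rw [this]
    refine (norm_sub_le _ _).trans ?_
    rw [norm_smul, Real.norm_of_nonneg h0]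
    have e5 : ‖gradient f (z.1 + h • z.2) - gradient f (w.1 + h • w.2)‖ ≤ L * (2 * ‖z - w‖) :=
      e4.trans (mul_le_mul_of_nonneg_left (e3.trans (by nlinarith)) hL0)
    nlinarith [mul_le_mul_of_nonneg_left e5 h0, mul_nonneg h0 hn]

theorem IsHamiltonianTrajectory.exists_norm_sub_symplecticEuler_le (hf : ContDiff ℝ 2 f)
    (hL : LSmooth f L) {Q P : ℝ → Euc d} (hQP : IsHamiltonianTrajectory f Q P) (T : ℝ) :
    ∃ C, ∀ h t, 0 ≤ h → 0 ≤ t → t + h ≤ T →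
      ‖(Q (t + h), P (t + h)) - symplecticEuler f h (Q t, P t)‖ ≤ C * h ^ 2 := by
  have hL0 := hL.nonneg
  have hQc : Continuous Q := continuous_iff_continuousAt.2 fun t => (hQP.1 t).continuousAt
  have hPc : Continuous P := continuous_iff_continuousAt.2 fun t => (hQP.2 t).continuousAt
  have hgc : Continuous (gradient f) := (contDiff_gradient (n := 1) hf).continuous
  obtain ⟨C₁, hC₁⟩ := (isCompact_Icc (a := (0:ℝ)) (b := T)).exists_bound_of_continuousOn
    (hgc.comp hQc).continuousOn
  obtain ⟨C₂, hC₂⟩ := (isCompact_Icc (a := (0:ℝ)) (b := T)).exists_bound_of_continuousOn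
    hPc.continuousOn
  refine ⟨max C₁ (2 * L * C₂), fun h t h0 ht hT => ?_⟩
  have hC₁0 : 0 ≤ C₁ := (norm_nonneg _).trans (hC₁ t ⟨ht, by linarith⟩)
  have hC₂0 : 0 ≤ C₂ := (norm_nonneg _).trans (hC₂ t ⟨ht, by linarith⟩)
  have ht1 : t ∈ Set.Icc t (t + h) := ⟨le_rfl, by linarith⟩
  have ht2 : t + h ∈ Set.Icc t (t + h) := ⟨by linarith, le_rfl⟩
  have hsub : ∀ s ∈ Set.Icc t (t + h), s ∈ Set.Icc 0 T :=
    fun s hs => ⟨by linarith [hs.1], by linarith [hs.2]⟩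
  have hP1 : ∀ s ∈ Set.Icc t (t + h), ‖P s - P t‖ ≤ C₁ * h := fun s hs => by
    refine ((convex_Icc t (t + h)).norm_image_sub_le_of_norm_hasDerivWithin_le
      (C := C₁) (fun s _ => (hQP.2 s).hasDerivWithinAt) (fun s hs => ?_) ht1 hs).trans ?_
    · rw [norm_neg]; exact hC₁ s (hsub s hs)
    · rw [Real.norm_of_nonneg (by linarith [hs.1])]
      exact mul_le_mul_of_nonneg_left (by linarith [hs.2]) hC₁0
  have hQ1 : ∀ s ∈ Set.Icc t (t + h), ‖Q s - Q t‖ ≤ C₂ * h := fun s hs => by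
    refine ((convex_Icc t (t + h)).norm_image_sub_le_of_norm_hasDerivWithin_le
      (fun s _ => (hQP.1 s).hasDerivWithinAt) (fun s hs => hC₂ s (hsub s hs)) ht1 hs).trans ?_
    rw [Real.norm_of_nonneg (by linarith [hs.1])]
    exact mul_le_mul_of_nonneg_left (by linarith [hs.2]) hC₂0
  rw [Prod.norm_def]
  refine max_le ?_ ?_
  · have key := (convex_Icc t (t + h)).norm_image_sub_le_of_norm_hasDerivWithin_le
      (f := fun s => Q s - s • P t) (f' := fun s => P s - (1:ℝ) • P t)
      (fun s _ => ((hQP.1 s).sub ((hasDerivAt_id s).smul_const (P t))).hasDerivWithinAt)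
      (fun s hs => by rw [one_smul]; exact hP1 s hs) ht1 ht2
    have e : (Q (t + h) - (t + h) • P t) - (Q t - t • P t)
        = ((Q (t + h), P (t + h)) - symplecticEuler f h (Q t, P t)).1 := by
      simp only [symplecticEuler, Prod.fst_sub]; module
    rw [e, add_sub_cancel_left, Real.norm_of_nonneg h0] at key
    refine key.trans ?_
    rw [mul_assoc, ← sq]
    exact mul_le_mul_of_nonneg_right (le_max_left _ _) (sq_nonneg h)
  · set g := gradient f (Q t + h • P t) with hg
    have key := (convex_Icc t (t + h)).norm_image_sub_le_of_norm_hasDerivWithin_le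
      (f := fun s => P s + s • g) (f' := fun s => -gradient f (Q s) + (1:ℝ) • g)
      (fun s _ => ((hQP.2 s).add ((hasDerivAt_id s).smul_const g)).hasDerivWithinAt)
      (C := L * (2 * C₂ * h))
      (fun s hs => by
        have e1 := hL.norm_gradient_sub_le hf (Q t + h • P t) (Q s)
        have e2 : ‖Q t + h • P t - Q s‖ ≤ 2 * C₂ * h := by
          have : Q t + h • P t - Q s = h • P t - (Q s - Q t) := by abel
          rw [this]
          refine (norm_sub_le _ _).trans ?_
          rw [norm_smul, Real.norm_of_nonneg h0]
          nlinarith [hQ1 s hs, mul_le_mul_of_nonneg_left (hC₂ t (hsub t ht1)) h0]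
        rw [one_smul, neg_add_eq_sub]
        exact e1.trans (mul_le_mul_of_nonneg_left e2 hL0)) ht1 ht2
    have e : (P (t + h) + (t + h) • g) - (P t + t • g)
        = ((Q (t + h), P (t + h)) - symplecticEuler f h (Q t, P t)).2 := by
      simp only [symplecticEuler, Prod.snd_sub, ← hg]; module
    rw [e, add_sub_cancel_left, Real.norm_of_nonneg h0] at key
    refine key.trans ?_
    calc _ = 2 * L * C₂ * h ^ 2 := by ring
      _ ≤ _ := mul_le_mul_of_nonneg_right (le_max_right _ _) (sq_nonneg h)

theorem IsHamiltonianFlow.tendsto_iterate_symplecticEuler (hf : ContDiff ℝ 2 f)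
    (hL : LSmooth f L) {Φ : Euc d × Euc d → ℝ → Euc d × Euc d} (hΦ : IsHamiltonianFlow f Φ)
    {T : ℝ} (hT : 0 ≤ T) (z : Euc d × Euc d) :
    Filter.Tendsto (fun N : ℕ => (symplecticEuler f (T / N))^[N] z) Filter.atTop
      (nhds (Φ z T)) := by
  obtain ⟨C, hC⟩ := (hΦ z).2.exists_norm_sub_symplecticEuler_le hf hL T
  have hL0 := hL.nonneg
  have := tendsto_iterate_of_consistent (Ψ := symplecticEuler f) (u := Φ z) (C := C)
    (by linarith : 0 ≤ 1 + 2 * L) hT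
    (fun h h0 h1 z w => hL.norm_symplecticEuler_sub_le hf h0 h1 z w)
    (fun h t h0 _ ht htT => hC h t h0 ht htT)
  rwa [(hΦ z).1] at this

end

section

variable {d : ℕ} {f : Euc d → ℝ} {L : ℝ}

theorem measurePreserving_symplecticEuler (hf : ContDiff ℝ 2 f) (h : ℝ) :
    MeasurePreserving (symplecticEuler f h) volume volume := by
  have hg : Continuous (gradient f) := (contDiff_gradient (n := 1) hf).continuous
  have hkick : MeasurePreserving (fun z : Euc d × Euc d => (z.1, z.2 - h • gradient f z.1))
      volume volume := by
    refine (MeasurePreserving.id volume).skew_product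
      (g := fun q p => p - h • gradient f q) (by fun_prop) (.of_forall fun q => ?_)
    exact (measurePreserving_sub_right volume (h • gradient f q)).map_eq
  have hdrift : MeasurePreserving (fun z : Euc d × Euc d => (z.1, z.2 + h • z.1))
      volume volume := by
    refine (MeasurePreserving.id volume).skew_product
      (g := fun q p => p + h • q) (by fun_prop) (.of_forall fun q => ?_)
    exact (measurePreserving_add_right volume (h • q)).map_eq
  have hswap : MeasurePreserving (Prod.swap : Euc d × Euc d → Euc d × Euc d) volume volume :=
    Measure.measurePreserving_swap
  exact hkick.comp (hswap.comp (hdrift.comp hswap))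

theorem continuous_symplecticEuler_uncurry (hf : ContDiff ℝ 2 f) :
    Continuous fun x : ℝ × (Euc d × Euc d) => symplecticEuler f x.1 x.2 := by
  have hg : Continuous (gradient f) := (contDiff_gradient (n := 1) hf).continuous
  unfold symplecticEuler
  fun_prop

theorem IsHamiltonianFlow.lintegral_comp_le (hf : ContDiff ℝ 2 f) (hL : LSmooth f L)
    {Φ : Euc d × Euc d → ℝ → Euc d × Euc d} (hΦ : IsHamiltonianFlow f Φ) {T : ℝ} (hT : 0 ≤ T)
    {F : Euc d × Euc d → ℝ≥0∞} (hF : Continuous F) :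
    ∫⁻ z, F (Φ z T) ≤ ∫⁻ z, F z := by
  have hmp : ∀ N : ℕ, MeasurePreserving (symplecticEuler f (T / N))^[N]
      (volume : Measure (Euc d × Euc d)) volume :=
    fun N => (measurePreserving_symplecticEuler hf _).iterate N
  have h1 : ∀ z, F (Φ z T) = Filter.liminf
      (fun N : ℕ => F ((symplecticEuler f (T / N))^[N] z)) Filter.atTop := fun z =>
    (((hF.tendsto _).comp (hΦ.tendsto_iterate_symplecticEuler hf hL hT z)).liminf_eq).symm
  simp_rw [h1]
  refine (lintegral_liminf_le fun N => hF.measurable.comp (hmp N).measurable).trans ?_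
  simp only [Function.comp_def, fun N => (hmp N).lintegral_comp hF.measurable]
  exact (Filter.liminf_const _).le

theorem targetMeasure_prod_targetMeasure {g : Euc d → ℝ} (hf : Continuous f)
    (hg : Continuous g) :
    ∃ c : ℝ≥0∞, (targetMeasure f).prod (targetMeasure g) = c • (volume.withDensity
      fun z : Euc d × Euc d => ENNReal.ofReal (exp (-(f z.1 + g z.2)))) := by
  refine ⟨((volume.withDensity fun x => ENNReal.ofReal (exp (-f x))) Set.univ)⁻¹ *
    ((volume.withDensity fun x => ENNReal.ofReal (exp (-g x))) Set.univ)⁻¹, ?_⟩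
  rw [targetMeasure, targetMeasure, Measure.prod_smul_left, Measure.prod_smul_right, smul_smul,
    prod_withDensity (by fun_prop) (by fun_prop)]
  congr 2
  funext z
  rw [← ENNReal.ofReal_mul (exp_pos _).le, ← exp_add]
  ring_nf

theorem IsHamiltonianFlow.lintegral_targetMeasure_comp_le (hf : ContDiff ℝ 2 f)
    (hL : LSmooth f L) {Φ : Euc d × Euc d → ℝ → Euc d × Euc d} (hΦ : IsHamiltonianFlow f Φ)
    {T : ℝ} (hT : 0 ≤ T) {F : Euc d × Euc d → ℝ} (hF : Continuous F) :
    ∫⁻ z, ENNReal.ofReal (F (Φ z T)) ∂((targetMeasure f).prod (stdGaussian d))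
      ≤ ∫⁻ z, ENNReal.ofReal (F z) ∂((targetMeasure f).prod (stdGaussian d)) := by
  have hg : Continuous (gaussianPotential d) :=
    (contDiff_gaussianPotential (n := 0)).continuous
  obtain ⟨c, hc⟩ := targetMeasure_prod_targetMeasure hf.continuous hg
  have hfc := hf.continuous
  set ρ : Euc d × Euc d → ℝ≥0∞ :=
    fun z => ENNReal.ofReal (exp (-(f z.1 + gaussianPotential d z.2))) with hρ
  have hρc : Continuous ρ := by
    refine ENNReal.continuous_ofReal.comp ?_
    fun_prop
  have hρt : ∀ z, ρ z < ⊤ := fun z => ENNReal.ofReal_lt_top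
  have hρΦ : ∀ z, ρ (Φ z T) = ρ z := fun z => by
    have := (hΦ z).2.energy_eq hf T
    rw [(hΦ z).1] at this
    simp only [hρ, gaussianPotential]
    rw [this]
  rw [stdGaussian_eq_targetMeasure, hc, lintegral_smul_measure, lintegral_smul_measure,
    lintegral_withDensity_eq_lintegral_mul_non_measurable _ hρc.measurable (.of_forall hρt),
    lintegral_withDensity_eq_lintegral_mul_non_measurable _ hρc.measurable (.of_forall hρt)]
  refine smul_le_smul_of_nonneg_left ?_ zero_le
  have hG : Continuous fun z => ρ z * ENNReal.ofReal (F z) := by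
    simp only [hρ]
    simp_rw [← ENNReal.ofReal_mul (exp_pos _).le]
    refine ENNReal.continuous_ofReal.comp ?_
    fun_prop
  refine le_trans (le_of_eq ?_) (hΦ.lintegral_comp_le hf hL hT hG)
  exact lintegral_congr fun z => by
    simp only [Pi.mul_apply, hρΦ]

theorem IsHamiltonianFlow.measurable_uncurry_max (hf : ContDiff ℝ 2 f) (hL : LSmooth f L)
    {Φ : Euc d × Euc d → ℝ → Euc d × Euc d} (hΦ : IsHamiltonianFlow f Φ) :
    Measurable fun x : (Euc d × Euc d) × ℝ => Φ x.1 (max x.2 0) := by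
  have hiter : ∀ (N k : ℕ), Continuous fun x : (Euc d × Euc d) × ℝ =>
      (symplecticEuler f (max x.2 0 / N))^[k] x.1 := fun N k => by
    induction k with
    | zero => exact continuous_fst
    | succ k ih =>
      simp_rw [Function.iterate_succ_apply']
      exact (continuous_symplecticEuler_uncurry hf).comp
        (((continuous_snd.max continuous_const).div_const _).prodMk ih)
  refine measurable_of_tendsto_metrizable (fun N => (hiter N N).measurable) ?_
  rw [tendsto_pi_nhds]
  exact fun x => hΦ.tendsto_iterate_symplecticEuler hf hL (le_max_right _ _) x.1

theorem IsHamiltonianFlow.lintegral_lintegral_le (hf : ContDiff ℝ 2 f) (hL : LSmooth f L)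
    (hμ : IsProbabilityMeasure (targetMeasure f))
    {Φ : Euc d × Euc d → ℝ → Euc d × Euc d} (hΦ : IsHamiltonianFlow f Φ)
    {F : Euc d × Euc d → ℝ} (hF : Continuous F) (η : ℝ) :
    ∫⁻ z, (∫⁻ s in Set.Ioc 0 η, ENNReal.ofReal (F (Φ z s)))
        ∂((targetMeasure f).prod (stdGaussian d))
      ≤ ENNReal.ofReal η *
        ∫⁻ z, ENNReal.ofReal (F z) ∂((targetMeasure f).prod (stdGaussian d)) := by
  have h1 : ∀ z, ∫⁻ s in Set.Ioc 0 η, ENNReal.ofReal (F (Φ z s))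
      = ∫⁻ s in Set.Ioc 0 η, ENNReal.ofReal (F (Φ z (max s 0))) := fun z =>
    setLIntegral_congr_fun measurableSet_Ioc fun s hs => by simp only [max_eq_left hs.1.le]
  simp_rw [h1]
  rw [lintegral_lintegral_swap]
  · calc _ ≤ ∫⁻ _ in Set.Ioc 0 η, ∫⁻ z, ENNReal.ofReal (F z)
          ∂((targetMeasure f).prod (stdGaussian d)) :=
          lintegral_mono fun s =>
            hΦ.lintegral_targetMeasure_comp_le hf hL (le_max_right s 0) hF
      _ = _ := by
          rw [setLIntegral_const, Real.volume_Ioc, sub_zero, mul_comm]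
  · exact (ENNReal.measurable_ofReal.comp
      (hF.measurable.comp (hΦ.measurable_uncurry_max hf hL))).aemeasurable

end

section

variable {E : Type*} [NormedAddCommGroup E]

theorem norm_sub_le_integral_norm_deriv [NormedSpace ℝ E] [CompleteSpace E] {u u' : ℝ → E}
    (hu : ∀ t, HasDerivAt u (u' t) t) (hu' : Continuous u') {a b T : ℝ} (ha : 0 ≤ a)
    (hab : a ≤ b) (hb : b ≤ T) : ‖u b - u a‖ ≤ ∫ s in (0:ℝ)..T, ‖u' s‖ := by
  rw [← intervalIntegral.integral_eq_sub_of_hasDerivAt (fun t _ => hu t)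
    (hu'.intervalIntegrable a b)]
  refine (intervalIntegral.norm_integral_le_integral_norm hab).trans ?_
  exact intervalIntegral.integral_mono_interval ha hab hb (.of_forall fun _ => norm_nonneg _)
    (hu'.norm.intervalIntegrable 0 T)

variable [InnerProductSpace ℝ E]

/-- The data of Hamilton's equations along a trajectory: `G` is the force with its first two
time derivatives `A`, `B`, and `F` is the potential energy. -/
structure ForceCurve (F : ℝ → ℝ) (Q P G A B : ℝ → E) : Prop where
  potential : ∀ t, HasDerivAt F (inner ℝ (G t) (P t)) t
  position : ∀ t, HasDerivAt Q (P t) t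
  momentum : ∀ t, HasDerivAt P (-G t) t
  force : ∀ t, HasDerivAt G (A t) t
  force_deriv : ∀ t, HasDerivAt A (B t) t
  continuous : Continuous B

variable {F : ℝ → ℝ} {Q P G A B : ℝ → E}

theorem ForceCurve.continuous_position (h : ForceCurve F Q P G A B) : Continuous Q :=
  continuous_iff_continuousAt.2 fun t => (h.position t).continuousAt

theorem ForceCurve.continuous_momentum (h : ForceCurve F Q P G A B) : Continuous P :=
  continuous_iff_continuousAt.2 fun t => (h.momentum t).continuousAt

theorem ForceCurve.continuous_force (h : ForceCurve F Q P G A B) : Continuous G :=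
  continuous_iff_continuousAt.2 fun t => (h.force t).continuousAt

theorem ForceCurve.continuous_force_deriv (h : ForceCurve F Q P G A B) : Continuous A :=
  continuous_iff_continuousAt.2 fun t => (h.force_deriv t).continuousAt

theorem ForceCurve.trapezoid_eq (h : ForceCurve F Q P G A B) (η : ℝ) :
    F η - F 0 - inner ℝ (G 0 + G η) (Q η - Q 0) / 2 + η ^ 2 / 8 * (‖G η‖ ^ 2 - ‖G 0‖ ^ 2)
      = ∫ s in (0:ℝ)..η, (s * (η - s) / 2 * (3 * inner ℝ (A s) (G s)
          - (inner ℝ (B s) (P s) + inner ℝ (A s) (G s)))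
        + (s * ‖G η - G s‖ ^ 2 - (η - s) * ‖G 0 - G s‖ ^ 2) / 4) := by
  have hPc := h.continuous_momentum
  have hGc := h.continuous_force
  have hAc := h.continuous_force_deriv
  have hBc := h.continuous
  set W : ℝ → ℝ := fun s => F s - (s * (η - s) / 2 * inner ℝ (A s) (P s)
      + (s - η / 2) * inner ℝ (G s) (P s))
    + inner ℝ (G η) (s • P s - Q s) / 2 + inner ℝ (G 0) ((s - η) • P s - Q s) / 2
    + s ^ 2 / 8 * ‖G η‖ ^ 2 + (η - s) ^ 2 / 8 * ‖G 0‖ ^ 2 + s * (η - s) / 4 * ‖G s‖ ^ 2 with hW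
  have hd : ∀ s, HasDerivAt W (s * (η - s) / 2 * (3 * inner ℝ (A s) (G s)
          - (inner ℝ (B s) (P s) + inner ℝ (A s) (G s)))
        + (s * ‖G η - G s‖ ^ 2 - (η - s) * ‖G 0 - G s‖ ^ 2) / 4) s := fun s => by
    have hid := hasDerivAt_id s
    have e1 := (((hid.mul (hid.const_sub η)).div_const 2).mul
      ((h.force_deriv s).inner ℝ (h.momentum s))).add
      ((hid.sub_const (η / 2)).mul ((h.force s).inner ℝ (h.momentum s)))
    have e2 := ((hasDerivAt_const s (G η)).inner ℝ
      ((hid.smul (h.momentum s)).sub (h.position s))).div_const 2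
    have e3 := ((hasDerivAt_const s (G 0)).inner ℝ
      (((hid.sub_const η).smul (h.momentum s)).sub (h.position s))).div_const 2
    have e4 := ((hid.pow 2).div_const 8).mul_const (‖G η‖ ^ 2)
    have e5 := (((hid.const_sub η).pow 2).div_const 8).mul_const (‖G 0‖ ^ 2)
    have e6 := ((hid.mul (hid.const_sub η)).div_const 4).mul (h.force s).norm_sq
    refine (((((((h.potential s).sub e1).add e2).add e3).add e4).add e5).add e6).congr_deriv ?_
    simp only [id, inner_add_right, inner_sub_right, inner_neg_right, inner_smul_right,
      inner_zero_left, real_inner_self_eq_norm_sq, one_smul, Pi.sub_apply, norm_sub_sq_real,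
      Nat.cast_ofNat, real_inner_comm (A s) (G s), Pi.mul_apply]
    ring
  rw [intervalIntegral.integral_eq_sub_of_hasDerivAt (fun s _ => hd s)
    (by refine Continuous.intervalIntegrable ?_ _ _; fun_prop)]
  simp only [hW, inner_sub_right, inner_smul_right, inner_add_left]
  ring

theorem ForceCurve.norm_second_difference_le [CompleteSpace E] (h : ForceCurve F Q P G A B)
    {η s : ℝ} (hs : s ∈ Set.Icc 0 η) :
    ‖(G η - G s) - (G (η - s) - G 0)‖ ≤ (∫ t in (0:ℝ)..η, ‖B t‖) * η := by
  have h0 : (0:ℝ) ∈ Set.Icc 0 (η - s) := ⟨le_rfl, by linarith [hs.2]⟩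
  have h1 : η - s ∈ Set.Icc 0 (η - s) := ⟨by linarith [hs.2], le_rfl⟩
  have key := (convex_Icc 0 (η - s)).norm_image_sub_le_of_norm_hasDerivWithin_le
    (f := fun r => G (s + r) - G r) (f' := fun r => A (s + r) - A r)
    (C := ∫ t in (0:ℝ)..η, ‖B t‖)
    (fun r _ => (((h.force (s + r)).comp_const_add s r).sub (h.force r)).hasDerivWithinAt)
    (fun r hr => norm_sub_le_integral_norm_deriv h.force_deriv h.continuous hr.1
      (by linarith [hs.1]) (by linarith [hr.2])) h0 h1
  rw [sub_zero, Real.norm_of_nonneg h1.1] at key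
  have e : (G (s + (η - s)) - G (η - s)) - (G (s + 0) - G 0)
      = (G η - G s) - (G (η - s) - G 0) := by
    rw [add_sub_cancel, add_zero]; abel
  rw [e] at key
  refine key.trans (mul_le_mul_of_nonneg_left (by linarith [hs.1]) ?_)
  exact intervalIntegral.integral_nonneg (hs.1.trans hs.2) fun _ _ => norm_nonneg _

theorem ForceCurve.abs_integral_force_gap_le [CompleteSpace E] (h : ForceCurve F Q P G A B)
    {η : ℝ} (hη : 0 ≤ η) :
    |∫ s in (0:ℝ)..η, (s * ‖G η - G s‖ ^ 2 - (η - s) * ‖G 0 - G s‖ ^ 2)|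
      ≤ 2 * η ^ 3 * (∫ t in (0:ℝ)..η, ‖A t‖) * ∫ t in (0:ℝ)..η, ‖B t‖ := by
  have hGc := h.continuous_force
  set JA := ∫ t in (0:ℝ)..η, ‖A t‖ with hJA
  set JB := ∫ t in (0:ℝ)..η, ‖B t‖ with hJB
  have hJA0 : 0 ≤ JA := intervalIntegral.integral_nonneg hη fun _ _ => norm_nonneg _
  have hJB0 : 0 ≤ JB := intervalIntegral.integral_nonneg hη fun _ _ => norm_nonneg _
  have e1 : ∫ s in (0:ℝ)..η, (η - s) * ‖G 0 - G s‖ ^ 2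
      = ∫ s in (0:ℝ)..η, s * ‖G 0 - G (η - s)‖ ^ 2 := by
    have := intervalIntegral.integral_comp_sub_left (a := 0) (b := η)
      (fun s => (η - s) * ‖G 0 - G s‖ ^ 2) η
    simp only [sub_sub_cancel, sub_zero, sub_self] at this
    exact this.symm
  rw [intervalIntegral.integral_sub (by refine Continuous.intervalIntegrable ?_ _ _; fun_prop)
    (by refine Continuous.intervalIntegrable ?_ _ _; fun_prop), e1,
    ← intervalIntegral.integral_sub (by refine Continuous.intervalIntegrable ?_ _ _; fun_prop)
    (by refine Continuous.intervalIntegrable ?_ _ _; fun_prop), ← Real.norm_eq_abs]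
  have key := intervalIntegral.norm_integral_le_of_norm_le_const (a := 0) (b := η)
    (f := fun s => s * ‖G η - G s‖ ^ 2 - s * ‖G 0 - G (η - s)‖ ^ 2)
    (C := 2 * η ^ 2 * JA * JB) fun s hs => by
      rw [Set.uIoc_of_le hη] at hs
      have b1 := h.norm_second_difference_le ⟨hs.1.le, hs.2⟩
      have b2 := norm_sub_le_integral_norm_deriv h.force h.continuous_force_deriv hs.1.le hs.2
        le_rfl
      have b3 := norm_sub_le_integral_norm_deriv h.force h.continuous_force_deriv le_rfl
        (by linarith [hs.2] : 0 ≤ η - s) (by linarith [hs.1] : η - s ≤ η)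
      rw [← hJA] at b2 b3
      rw [← hJB] at b1
      have e2 : s * ‖G η - G s‖ ^ 2 - s * ‖G 0 - G (η - s)‖ ^ 2
          = s * inner ℝ ((G η - G s) - (G (η - s) - G 0)) ((G η - G s) + (G (η - s) - G 0)) := by
        rw [norm_sub_rev (G 0)]
        generalize G η - G s = x
        generalize G (η - s) - G 0 = y
        rw [inner_sub_left, inner_add_right, inner_add_right, real_inner_self_eq_norm_sq,
          real_inner_self_eq_norm_sq, real_inner_comm x y]
        ring
      rw [e2, norm_mul, Real.norm_of_nonneg hs.1.le]
      have b4 := norm_inner_le_norm (𝕜 := ℝ) ((G η - G s) - (G (η - s) - G 0))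
        ((G η - G s) + (G (η - s) - G 0))
      have b5 := norm_add_le (G η - G s) (G (η - s) - G 0)
      calc _ ≤ η * ((JB * η) * (JA + JA)) := by
            refine mul_le_mul hs.2 (b4.trans ?_) (norm_nonneg _) hη
            exact mul_le_mul b1 (b5.trans (add_le_add b2 b3)) (norm_nonneg _) (by positivity)
        _ = _ := by ring
  refine key.trans (le_of_eq ?_)
  rw [sub_zero, abs_of_nonneg hη]
  ring

theorem ForceCurve.abs_trapezoid_le [CompleteSpace E] (h : ForceCurve F Q P G A B) {η : ℝ}
    (hη : 0 ≤ η) :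
    |F η - F 0 - inner ℝ (G 0 + G η) (Q η - Q 0) / 2 + η ^ 2 / 8 * (‖G η‖ ^ 2 - ‖G 0‖ ^ 2)|
      ≤ η ^ 2 / 2 * (∫ s in (0:ℝ)..η, (|inner ℝ (A s) (G s)|
          + |inner ℝ (B s) (P s) + inner ℝ (A s) (G s)|))
        + η ^ 3 / 2 * (∫ t in (0:ℝ)..η, ‖A t‖) * ∫ t in (0:ℝ)..η, ‖B t‖ := by
  have hPc := h.continuous_momentum
  have hGc := h.continuous_force
  have hAc := h.continuous_force_deriv
  have hBc := h.continuous
  rw [h.trapezoid_eq, intervalIntegral.integral_add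
    (by refine Continuous.intervalIntegrable ?_ _ _; fun_prop)
    (by refine Continuous.intervalIntegrable ?_ _ _; fun_prop),
    intervalIntegral.integral_div]
  refine (abs_add_le _ _).trans (add_le_add ?_ ?_)
  · rw [← intervalIntegral.integral_const_mul]
    refine (intervalIntegral.abs_integral_le_integral_abs hη).trans ?_
    refine intervalIntegral.integral_mono_on hη
      (by refine Continuous.intervalIntegrable ?_ _ _; fun_prop)
      (by refine Continuous.intervalIntegrable ?_ _ _; fun_prop) fun s hs => ?_
    have b1 : 0 ≤ s * (η - s) / 2 := by
      have := mul_nonneg hs.1 (sub_nonneg.2 hs.2); linarith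
    have b2 : s * (η - s) / 2 ≤ η ^ 2 / 8 := by nlinarith [sq_nonneg (η - 2 * s)]
    rw [abs_mul, abs_of_nonneg b1]
    have b3 := abs_sub (3 * inner ℝ (A s) (G s)) (inner ℝ (B s) (P s) + inner ℝ (A s) (G s))
    rw [abs_mul, abs_of_pos (by norm_num : (0:ℝ) < 3)] at b3
    have b4 := abs_nonneg (inner ℝ (A s) (G s))
    have b5 := abs_nonneg (inner ℝ (B s) (P s) + inner ℝ (A s) (G s))
    calc _ ≤ η ^ 2 / 8 * (4 * (|inner ℝ (A s) (G s)|
          + |inner ℝ (B s) (P s) + inner ℝ (A s) (G s)|)) :=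
          mul_le_mul b2 (by linarith) (abs_nonneg _) (by positivity)
      _ = _ := by ring
  · have := h.abs_integral_force_gap_le hη
    rw [abs_div, abs_of_pos (by norm_num : (0:ℝ) < 4)]
    linarith

end

section

variable {E : Type*} [NormedAddCommGroup E]

theorem norm_sub_le_mul_integral [NormedSpace ℝ E] [CompleteSpace E] {u u' w : ℝ → E} {C η : ℝ}
    (hu : ∀ t, HasDerivAt u (u' t) t) (hu' : Continuous u') (hw : Continuous w) (hη : 0 ≤ η)
    (hb : ∀ t ∈ Set.Icc 0 η, ‖u' t‖ ≤ C * ‖w t‖) :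
    ‖u η - u 0‖ ≤ C * ∫ s in (0:ℝ)..η, ‖w s‖ := by
  refine (norm_sub_le_integral_norm_deriv hu hu' le_rfl hη le_rfl).trans ?_
  rw [← intervalIntegral.integral_const_mul]
  exact intervalIntegral.integral_mono_on hη (hu'.norm.intervalIntegrable _ _)
    ((hw.norm.const_mul C).intervalIntegrable _ _) hb

variable [InnerProductSpace ℝ E] [CompleteSpace E]
variable {F : ℝ → ℝ} {Q P G A B : ℝ → E} {η : ℝ}

theorem ForceCurve.norm_parabola_sub_le (h : ForceCurve F Q P G A B) (hη : 0 ≤ η) :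
    ‖(Q 0 + η • P 0 - (η ^ 2 / 2) • G 0) - Q η‖ ≤ η ^ 2 * ∫ s in (0:ℝ)..η, ‖A s‖ := by
  have h0 : (0:ℝ) ∈ Set.Icc 0 η := ⟨le_rfl, hη⟩
  have h1 : η ∈ Set.Icc 0 η := ⟨hη, le_rfl⟩
  have hJ : 0 ≤ ∫ s in (0:ℝ)..η, ‖A s‖ :=
    intervalIntegral.integral_nonneg hη fun _ _ => norm_nonneg _
  have key := (convex_Icc 0 η).norm_image_sub_le_of_norm_hasDerivWithin_le
    (f := fun s => (s - η) • P s - Q s + ((η - s) ^ 2 / 2) • G 0)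
    (f' := fun s => (η - s) • (G s - G 0)) (C := η * ∫ s in (0:ℝ)..η, ‖A s‖)
    (fun s _ => by
      have hid := hasDerivAt_id s
      refine (((((hid.sub_const η).smul (h.momentum s)).sub (h.position s)).add
        ((((hid.const_sub η).pow 2).div_const 2).smul_const (G 0))).congr_deriv ?_).hasDerivWithinAt
      simp only [id]
      module)
    (fun s hs => by
      rw [norm_smul, Real.norm_of_nonneg (by linarith [hs.2])]
      exact mul_le_mul (by linarith [hs.1]) (norm_sub_le_integral_norm_deriv h.force
        h.continuous_force_deriv le_rfl hs.1 hs.2) (norm_nonneg _) hη) h0 h1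
  have e : ((η - η) • P η - Q η + ((η - η) ^ 2 / 2) • G 0)
      - ((0 - η) • P 0 - Q 0 + ((η - 0) ^ 2 / 2) • G 0)
      = (Q 0 + η • P 0 - (η ^ 2 / 2) • G 0) - Q η := by module
  rw [e, sub_zero, Real.norm_of_nonneg hη] at key
  exact key.trans (le_of_eq (by ring))

theorem ForceCurve.norm_force_taylor_le (h : ForceCurve F Q P G A B) (hη : 0 ≤ η) :
    ‖η • A η - (G η - G 0)‖ ≤ η * ∫ s in (0:ℝ)..η, ‖B s‖ := by
  have hBc := h.continuous
  have key := norm_sub_le_mul_integral (u := fun s => s • A s - G s) (u' := fun s => s • B s)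
    (fun s => by
      refine (((hasDerivAt_id s).smul (h.force_deriv s)).sub (h.force s)).congr_deriv ?_
      simp) (by fun_prop) hBc hη (C := η) fun s hs => by
        rw [norm_smul, Real.norm_of_nonneg hs.1]
        exact mul_le_mul_of_nonneg_right hs.2 (norm_nonneg _)
  simp only [zero_smul, zero_sub, sub_neg_eq_add] at key
  rwa [← sub_add]

theorem ForceCurve.norm_position_taylor_le (h : ForceCurve F Q P G A B) (hη : 0 ≤ η) :
    ‖η • P η - (Q η - Q 0)‖ ≤ η * ∫ s in (0:ℝ)..η, ‖G s‖ := by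
  have hGc := h.continuous_force
  have key := norm_sub_le_mul_integral (u := fun s => s • P s - Q s) (u' := fun s => s • -G s)
    (fun s => by
      refine (((hasDerivAt_id s).smul (h.momentum s)).sub (h.position s)).congr_deriv ?_
      simp) (by fun_prop) hGc hη (C := η) fun s hs => by
        rw [norm_smul, norm_neg, Real.norm_of_nonneg hs.1]
        exact mul_le_mul_of_nonneg_right hs.2 (norm_nonneg _)
  simp only [zero_smul, zero_sub, sub_neg_eq_add] at key
  rwa [← sub_add]

theorem ForceCurve.mul_norm_force_le (h : ForceCurve F Q P G A B) (hη : 0 ≤ η) :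
    η * ‖G η‖ ≤ (∫ s in (0:ℝ)..η, ‖G s‖) + η * ∫ s in (0:ℝ)..η, ‖A s‖ := by
  have hGc := h.continuous_force
  have key := norm_sub_le_integral_norm_deriv (T := η) (a := 0) (b := η)
    (u := fun s => s • G η - ∫ t in (0:ℝ)..s, (G η - G t)) (u' := G)
    (fun s => by
      have := (show Continuous fun t => G η - G t by fun_prop).integral_hasStrictDerivAt 0 s
      refine (((hasDerivAt_id s).smul_const (G η)).sub this.hasDerivAt).congr_deriv ?_
      simp) hGc le_rfl hη le_rfl
  simp only [zero_smul, intervalIntegral.integral_same, sub_zero] at key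
  have e1 := intervalIntegral.norm_integral_le_of_norm_le_const (a := 0) (b := η)
    (f := fun t => G η - G t) (C := ∫ s in (0:ℝ)..η, ‖A s‖) fun s hs => by
      rw [Set.uIoc_of_le hη] at hs
      exact norm_sub_le_integral_norm_deriv h.force h.continuous_force_deriv hs.1.le hs.2 le_rfl
  rw [sub_zero, abs_of_nonneg hη] at e1
  have e2 := norm_sub_norm_le (η • G η) (∫ t in (0:ℝ)..η, (G η - G t))
  rw [norm_smul, Real.norm_of_nonneg hη] at e2
  linarith

end

section

variable {d : ℕ} {f : Euc d → ℝ} {L τ : ℝ}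

theorem IsHamiltonianTrajectory.forceCurve (hf : ContDiff ℝ 3 f) {Q P : ℝ → Euc d}
    (h : IsHamiltonianTrajectory f Q P) :
    ForceCurve (fun t => f (Q t)) Q P (fun t => gradient f (Q t))
      (fun t => fderiv ℝ (gradient f) (Q t) (P t))
      (fun t => thirdDeriv f (Q t) (P t) (P t)
        - fderiv ℝ (gradient f) (Q t) (gradient f (Q t))) := by
  have hg : ContDiff ℝ 2 (gradient f) := contDiff_gradient (n := 2) hf
  have hQc : Continuous Q := continuous_iff_continuousAt.2 fun t => (h.1 t).continuousAt
  have hPc : Continuous P := continuous_iff_continuousAt.2 fun t => (h.2 t).continuousAt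
  refine ⟨fun t => ?_, h.1, h.2, fun t => ?_, fun t => ?_, ?_⟩
  · have h1 := ((hf.differentiable (by norm_num) (Q t)).hasFDerivAt).comp_hasDerivAt t
      (h.hasDerivAt_fst t)
    rw [fderiv_eq_innerSL_gradient] at h1
    exact h1
  · exact ((hg.differentiable (by norm_num) (Q t)).hasFDerivAt).comp_hasDerivAt t (h.1 t)
  · have h1 := (hasFDerivAt_hessian hf (Q t)).comp_hasDerivAt t (h.1 t)
    refine (h1.clm_apply (h.2 t)).congr_deriv ?_
    simp [sub_eq_add_neg]
  · have hM := (continuous_thirdDeriv hf).comp hQc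
    have hH := (hg.continuous_fderiv (by norm_num)).comp hQc
    exact ((hM.clm_apply hPc).clm_apply hPc).sub (hH.clm_apply (hg.continuous.comp hQc))

theorem norm_hessian_sub_le (hf : ContDiff ℝ 3 f) (hM : ∀ x, CubicBound (thirdDeriv f x) τ)
    (x y : Euc d) :
    ‖fderiv ℝ (gradient f) x - fderiv ℝ (gradient f) y‖ ≤ τ * ‖x - y‖ :=
  convex_univ.norm_image_sub_le_of_norm_hasFDerivWithin_le
    (fun z _ => (hasFDerivAt_hessian hf z).hasFDerivWithinAt)
    (fun z _ => ContinuousLinearMap.opNorm_le_bound₂ _ (hM z).nonneg (hM z).norm_le)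
    (Set.mem_univ y) (Set.mem_univ x)

/-- The error of the trapezoid rule for `f` between `q` and `y`, with the gradient correction
that turns it into the energy error of a leapfrog step. -/
noncomputable def trapezoidError (f : Euc d → ℝ) (η : ℝ) (q y : Euc d) : ℝ :=
  f y - f q - inner ℝ (gradient f q + gradient f y) (y - q) / 2
    + η ^ 2 / 8 * (‖gradient f y‖ ^ 2 - ‖gradient f q‖ ^ 2)

theorem leapfrog_energy_eq (f : Euc d → ℝ) (η : ℝ) (z : Euc d × Euc d) :
    -(f (leapfrog f η 1 z).1) - ‖(leapfrog f η 1 z).2‖ ^ 2 / 2 + f z.1 + ‖z.2‖ ^ 2 / 2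
      = -trapezoidError f η z.1 (leapfrog f η 1 z).1 := by
  have h1 : (leapfrog f η 1 z).2 = z.2 - (η / 2) • gradient f z.1
      - (η / 2) • gradient f (leapfrog f η 1 z).1 := rfl
  have h2 : (leapfrog f η 1 z).1 - z.1 = η • z.2 - (η ^ 2 / 2) • gradient f z.1 := by
    simp only [leapfrog]; module
  rw [trapezoidError, h2, h1]
  generalize gradient f (leapfrog f η 1 z).1 = g'
  generalize gradient f z.1 = g
  generalize z.2 = p
  simp only [← real_inner_self_eq_norm_sq, inner_sub_left, inner_sub_right, inner_add_left,
    inner_smul_left, inner_smul_right, real_inner_comm p g, real_inner_comm p g',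
    real_inner_comm g g']
  simp
  ring

theorem hasDerivAt_trapezoidError_line (hf : ContDiff ℝ 3 f) (η : ℝ) (q x e : Euc d) (t : ℝ) :
    HasDerivAt (fun t : ℝ => trapezoidError f η q (x + t • e))
      (inner ℝ ((1 / 2 : ℝ) • (gradient f (x + t • e) - gradient f q
          - fderiv ℝ (gradient f) (x + t • e) (x + t • e - q))
        + (η ^ 2 / 4) • fderiv ℝ (gradient f) (x + t • e) (gradient f (x + t • e))) e) t := by
  have hg : ContDiff ℝ 2 (gradient f) := contDiff_gradient (n := 2) hf
  have hf2 : ContDiff ℝ 2 f := hf.of_le (by norm_num)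
  have hy : HasDerivAt (fun t : ℝ => x + t • e) e t := by
    simpa using ((hasDerivAt_id t).smul_const e).const_add x
  have h1 := ((hf.differentiable (by norm_num) (x + t • e)).hasFDerivAt).comp_hasDerivAt t hy
  rw [fderiv_eq_innerSL_gradient] at h1
  have h2 := ((hg.differentiable (by norm_num) (x + t • e)).hasFDerivAt).comp_hasDerivAt t hy
  have h3 := (((h2.const_add (gradient f q)).inner ℝ (hy.sub_const q)).div_const 2)
  have h4 := (h2.norm_sq.sub_const (‖gradient f q‖ ^ 2)).const_mul (η ^ 2 / 8)
  refine (((h1.sub_const (f q)).sub h3).add h4).congr_deriv ?_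
  simp only [innerSL_apply_apply, Function.comp_apply, inner_add_left, inner_sub_left,
    inner_smul_left, inner_hessian_comm hf2 _ _ e, conj_trivial,
    real_inner_comm (gradient f (x + t • e)) (fderiv ℝ (gradient f) (x + t • e) e)]
  ring

end

section

variable {d : ℕ} {f : Euc d → ℝ} {L τ : ℝ}

theorem LSmooth.norm_trapezoidError_gradient_le (hf : ContDiff ℝ 3 f) (hL : LSmooth f L)
    (hM : ∀ x, CubicBound (thirdDeriv f x) τ) {η : ℝ} (hη : 0 ≤ η) (hηL : η ^ 2 * L ≤ 1)
    {q x e : Euc d} {JP JG JA JB : ℝ} (he : ‖e‖ ≤ η ^ 2 * JA) (hx : ‖x - q‖ ≤ JP)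
    (hgx : η * ‖gradient f x‖ ≤ JG + η * JA)
    (hgq : ‖gradient f x - gradient f q - fderiv ℝ (gradient f) x (x - q)‖
      ≤ η * JB + L * (η * JG)) {t : ℝ} (ht : t ∈ Set.Icc (0:ℝ) 1) :
    ‖(1 / 2 : ℝ) • (gradient f (x + t • e) - gradient f q
          - fderiv ℝ (gradient f) (x + t • e) (x + t • e - q))
        + (η ^ 2 / 4) • fderiv ℝ (gradient f) (x + t • e) (gradient f (x + t • e))‖
      ≤ η * JB / 2 + 3 / 4 * (L * (η * JG)) + 3 / 2 * (L * (η ^ 2 * JA))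
        + τ * (η ^ 2 * JA) * JP / 2 := by
  have hf2 : ContDiff ℝ 2 f := hf.of_le (by norm_num)
  have hL0 := hL.nonneg
  have hτ : 0 ≤ τ := (hM 0).nonneg
  set y := x + t • e with hy
  set H := fderiv ℝ (gradient f) y with hH
  have hyx : ‖y - x‖ ≤ η ^ 2 * JA := by
    rw [hy, add_sub_cancel_left, norm_smul, Real.norm_of_nonneg ht.1]
    exact (mul_le_of_le_one_left (norm_nonneg e) ht.2).trans he
  have hyx' : ‖t • e‖ ≤ η ^ 2 * JA := by rwa [hy, add_sub_cancel_left] at hyx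
  have hHle : ∀ v, ‖H v‖ ≤ L * ‖v‖ := fun v => H.le_of_opNorm_le (hL y) v
  have b1 : ‖gradient f y - gradient f x‖ ≤ L * (η ^ 2 * JA) :=
    (hL.norm_gradient_sub_le hf2 y x).trans (mul_le_mul_of_nonneg_left hyx hL0)
  have b2 : ‖(H - fderiv ℝ (gradient f) x) (x - q)‖ ≤ τ * (η ^ 2 * JA) * JP := by
    refine (ContinuousLinearMap.le_opNorm _ _).trans ?_
    refine mul_le_mul ((norm_hessian_sub_le hf hM y x).trans
      (mul_le_mul_of_nonneg_left hyx hτ)) hx (norm_nonneg _) ?_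
    exact mul_nonneg hτ ((norm_nonneg _).trans he)
  have b3 : ‖H (t • e)‖ ≤ L * (η ^ 2 * JA) :=
    (hHle _).trans (mul_le_mul_of_nonneg_left hyx' hL0)
  have e1 : gradient f y - gradient f q - H (y - q)
      = (gradient f y - gradient f x)
        + (gradient f x - gradient f q - fderiv ℝ (gradient f) x (x - q))
        - (H - fderiv ℝ (gradient f) x) (x - q) - H (t • e) := by
    have : y - q = (x - q) + t • e := by rw [hy]; abel
    rw [this, map_add, sub_apply]
    abel
  have b4 : ‖gradient f y - gradient f q - H (y - q)‖ ≤ L * (η ^ 2 * JA)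
      + (η * JB + L * (η * JG)) + τ * (η ^ 2 * JA) * JP + L * (η ^ 2 * JA) := by
    rw [e1]
    exact (norm_sub_le _ _).trans (add_le_add ((norm_sub_le _ _).trans
      (add_le_add ((norm_add_le _ _).trans (add_le_add b1 hgq)) b2)) b3)
  have b5 : η ^ 2 * ‖H (gradient f y)‖ ≤ L * (η * JG) + 2 * (L * (η ^ 2 * JA)) := by
    have c1 : ‖gradient f y‖ ≤ L * (η ^ 2 * JA) + ‖gradient f x‖ := by
      have := norm_add_le (gradient f y - gradient f x) (gradient f x)
      rw [sub_add_cancel] at this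
      linarith
    have c2 : 0 ≤ η ^ 2 * JA := (norm_nonneg _).trans he
    calc η ^ 2 * ‖H (gradient f y)‖ ≤ η ^ 2 * (L * (L * (η ^ 2 * JA) + ‖gradient f x‖)) := by
          refine mul_le_mul_of_nonneg_left ((hHle _).trans ?_) (sq_nonneg η)
          exact mul_le_mul_of_nonneg_left c1 hL0
      _ = (η ^ 2 * L) * (L * (η ^ 2 * JA)) + L * η * (η * ‖gradient f x‖) := by ring
      _ ≤ 1 * (L * (η ^ 2 * JA)) + L * η * (JG + η * JA) := by gcongr
      _ = _ := by ring
  refine (norm_add_le _ _).trans ?_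
  rw [norm_smul, norm_smul, Real.norm_of_nonneg (by positivity : 0 ≤ η ^ 2 / 4),
    Real.norm_of_nonneg (by norm_num : (0:ℝ) ≤ 1 / 2)]
  linarith

theorem LSmooth.abs_trapezoidError_sub_le (hf : ContDiff ℝ 3 f) (hL : LSmooth f L)
    (hM : ∀ x, CubicBound (thirdDeriv f x) τ) {η : ℝ} (hη : 0 ≤ η) (hηL : η ^ 2 * L ≤ 1)
    {q x y : Euc d} {JP JG JA JB : ℝ} (he : ‖y - x‖ ≤ η ^ 2 * JA) (hx : ‖x - q‖ ≤ JP)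
    (hgx : η * ‖gradient f x‖ ≤ JG + η * JA)
    (hgq : ‖gradient f x - gradient f q - fderiv ℝ (gradient f) x (x - q)‖
      ≤ η * JB + L * (η * JG)) :
    |trapezoidError f η q y - trapezoidError f η q x|
      ≤ (η * JB / 2 + 3 / 4 * (L * (η * JG)) + 3 / 2 * (L * (η ^ 2 * JA))
        + τ * (η ^ 2 * JA) * JP / 2) * (η ^ 2 * JA) := by
  have hK := fun t ht => hL.norm_trapezoidError_gradient_le hf hM hη hηL he hx hgx hgq
    (t := t) ht
  have h0 : (0:ℝ) ∈ Set.Icc (0:ℝ) 1 := by simp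
  have h1 : (1:ℝ) ∈ Set.Icc (0:ℝ) 1 := by simp
  have hK0 := (norm_nonneg _).trans (hK 0 h0)
  have key := (convex_Icc (0:ℝ) 1).norm_image_sub_le_of_norm_hasDerivWithin_le
    (fun t _ => (hasDerivAt_trapezoidError_line hf η q x (y - x) t).hasDerivWithinAt)
    (fun t ht => (norm_inner_le_norm _ _).trans
      (mul_le_mul (hK t ht) he (norm_nonneg _) hK0)) h0 h1
  simpa using key

theorem LSmooth.abs_leapfrog_energy_le (hf : ContDiff ℝ 3 f) (hL : LSmooth f L)
    (hM : ∀ x, CubicBound (thirdDeriv f x) τ) {Q P : ℝ → Euc d}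
    (h : IsHamiltonianTrajectory f Q P) {η : ℝ} (hη : 0 ≤ η) (hηL : η ^ 2 * L ≤ 1)
    {JP JG JV : ℝ} (hJP : ∫ s in (0:ℝ)..η, ‖P s‖ = JP)
    (hJG : ∫ s in (0:ℝ)..η, ‖gradient f (Q s)‖ = JG)
    (hJV : ∫ s in (0:ℝ)..η, ‖thirdDeriv f (Q s) (P s) (P s)‖ = JV) :
    |trapezoidError f η (Q 0) (leapfrog f η 1 (Q 0, P 0)).1|
      ≤ η ^ 2 / 2 * (∫ s in (0:ℝ)..η,
          (|inner ℝ (fderiv ℝ (gradient f) (Q s) (P s)) (gradient f (Q s))|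
            + |inner ℝ (thirdDeriv f (Q s) (P s) (P s)) (P s)|))
        + η ^ 3 * L * JP * JV + 2 * (η ^ 3 * L ^ 2 * JP * JG) + 2 * (η ^ 4 * L ^ 3 * JP ^ 2)
        + τ * η ^ 4 * L ^ 2 * JP ^ 3 := by
  have hf2 : ContDiff ℝ 2 f := hf.of_le (by norm_num)
  have hL0 := hL.nonneg
  have hτ : 0 ≤ τ := (hM 0).nonneg
  have hg : ContDiff ℝ 2 (gradient f) := contDiff_gradient (n := 2) hf
  have hc := h.forceCurve hf
  have hQc := hc.continuous_position
  have hPc := hc.continuous_momentum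
  have hGc := hc.continuous_force
  have hAc := hc.continuous_force_deriv
  have hBc := hc.continuous
  have hVc : Continuous fun s => thirdDeriv f (Q s) (P s) (P s) :=
    (((continuous_thirdDeriv hf).comp hQc).clm_apply hPc).clm_apply hPc
  have hJ0 : ∀ u : ℝ → Euc d, 0 ≤ ∫ s in (0:ℝ)..η, ‖u s‖ := fun u =>
    intervalIntegral.integral_nonneg hη fun _ _ => norm_nonneg _
  have hJA : ∫ s in (0:ℝ)..η, ‖fderiv ℝ (gradient f) (Q s) (P s)‖ ≤ L * JP := by
    rw [← hJP, ← intervalIntegral.integral_const_mul]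
    exact intervalIntegral.integral_mono_on hη (hAc.norm.intervalIntegrable _ _)
      ((hPc.norm.const_mul L).intervalIntegrable _ _) fun s _ =>
        ContinuousLinearMap.le_of_opNorm_le _ (hL _) _
  have hJB : ∫ s in (0:ℝ)..η, ‖thirdDeriv f (Q s) (P s) (P s)
      - fderiv ℝ (gradient f) (Q s) (gradient f (Q s))‖ ≤ JV + L * JG := by
    rw [← hJG, ← hJV, ← intervalIntegral.integral_const_mul, ← intervalIntegral.integral_add
      (hVc.norm.intervalIntegrable _ _) ((hGc.norm.const_mul L).intervalIntegrable _ _)]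
    refine intervalIntegral.integral_mono_on hη (hBc.norm.intervalIntegrable _ _)
      ((hVc.norm.add (hGc.norm.const_mul L)).intervalIntegrable _ _) fun s _ => ?_
    exact (norm_sub_le _ _).trans (add_le_add le_rfl
      (ContinuousLinearMap.le_of_opNorm_le _ (hL _) _))
  have hinner : ∀ s, inner ℝ (thirdDeriv f (Q s) (P s) (P s)
        - fderiv ℝ (gradient f) (Q s) (gradient f (Q s))) (P s)
      + inner ℝ (fderiv ℝ (gradient f) (Q s) (P s)) (gradient f (Q s))
      = inner ℝ (thirdDeriv f (Q s) (P s) (P s)) (P s) := fun s => by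
    rw [inner_sub_left, inner_hessian_comm hf2 _ (gradient f (Q s)), sub_add_cancel]
  have hpar := hc.norm_parabola_sub_le hη
  have hft := hc.norm_force_taylor_le hη
  have hpt := hc.norm_position_taylor_le hη
  have hmf := hc.mul_norm_force_le hη
  have htrap := hc.abs_trapezoid_le hη
  simp only [hinner] at htrap
  have hdisp : ‖Q η - Q 0‖ ≤ JP := by
    rw [← hJP]; exact norm_sub_le_integral_norm_deriv h.1 hPc le_rfl hη le_rfl
  rw [hJG] at hpt hmf
  have hA0 := hJ0 fun s => fderiv ℝ (gradient f) (Q s) (P s)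
  have hB0 := hJ0 fun s => thirdDeriv f (Q s) (P s) (P s)
    - fderiv ℝ (gradient f) (Q s) (gradient f (Q s))
  have hP0 := hJ0 P
  have hG0 := hJ0 fun s => gradient f (Q s)
  have hV0 := hJ0 fun s => thirdDeriv f (Q s) (P s) (P s)
  rw [hJP] at hP0
  rw [hJG] at hG0
  rw [hJV] at hV0
  generalize (∫ s in (0:ℝ)..η, ‖fderiv ℝ (gradient f) (Q s) (P s)‖) = JA at *
  generalize (∫ s in (0:ℝ)..η, ‖thirdDeriv f (Q s) (P s) (P s)
      - fderiv ℝ (gradient f) (Q s) (gradient f (Q s))‖) = JB at *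
  have hgq : ‖gradient f (Q η) - gradient f (Q 0)
      - fderiv ℝ (gradient f) (Q η) (Q η - Q 0)‖ ≤ η * JB + L * (η * JG) := by
    have e1 : gradient f (Q η) - gradient f (Q 0) - fderiv ℝ (gradient f) (Q η) (Q η - Q 0)
        = fderiv ℝ (gradient f) (Q η) (η • P η - (Q η - Q 0))
          - (η • fderiv ℝ (gradient f) (Q η) (P η)
            - (gradient f (Q η) - gradient f (Q 0))) := by
      rw [map_sub _ (η • P η), map_smul]; abel
    rw [e1]
    refine (norm_sub_le _ _).trans ?_
    rw [add_comm]
    refine add_le_add hft ((ContinuousLinearMap.le_of_opNorm_le _ (hL _) _).trans ?_)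
    exact mul_le_mul_of_nonneg_left hpt hL0
  have hq' : (leapfrog f η 1 (Q 0, P 0)).1
      = Q 0 + η • P 0 - (η ^ 2 / 2) • gradient f (Q 0) := rfl
  rw [hq']
  have hdiff := hL.abs_trapezoidError_sub_le hf hM hη hηL hpar hdisp hmf hgq
  rw [← trapezoidError] at htrap
  have htri := abs_sub_abs_le_abs_sub
    (trapezoidError f η (Q 0) (Q 0 + η • P 0 - (η ^ 2 / 2) • gradient f (Q 0)))
    (trapezoidError f η (Q 0) (Q η))
  have k1 : η ^ 3 / 2 * JA * JB ≤ η ^ 3 / 2 * (L * JP) * (JV + L * JG) := by gcongr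
  have k2 : (η * JB / 2 + 3 / 4 * (L * (η * JG)) + 3 / 2 * (L * (η ^ 2 * JA))
        + τ * (η ^ 2 * JA) * JP / 2) * (η ^ 2 * JA)
      ≤ (η * (JV + L * JG) / 2 + 3 / 4 * (L * (η * JG)) + 3 / 2 * (L * (η ^ 2 * (L * JP)))
        + τ * (η ^ 2 * (L * JP)) * JP / 2) * (η ^ 2 * (L * JP)) := by gcongr
  have k3 : 0 ≤ η ^ 3 * L ^ 2 * JP * JG := by positivity
  have k4 : 0 ≤ η ^ 4 * L ^ 3 * JP ^ 2 := by positivity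
  have k5 : 0 ≤ τ * η ^ 4 * L ^ 2 * JP ^ 3 := by positivity
  nlinarith

end

lemma pow_interval_average_le {η : ℝ} (hη : 0 < η) {u : ℝ → ℝ} (hu : Continuous u)
    (hu0 : ∀ s, 0 ≤ u s) (n : ℕ) :
    (η⁻¹ * ∫ s in (0:ℝ)..η, u s) ^ n ≤ η⁻¹ * ∫ s in (0:ℝ)..η, u s ^ n := by
  have h := (convexOn_pow n).map_set_average_le (μ := volume) (t := Set.Ioc 0 η) (f := u)
    (continuous_pow n).continuousOn isClosed_Ici (by simp [hη]) (by simp)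
    (Filter.Eventually.of_forall hu0) (hu.integrableOn_Ioc) ((hu.pow n).integrableOn_Ioc)
  simpa [setAverage_eq, intervalIntegral.integral_of_le hη.le, hη.le] using h

lemma mul_interval_integrals_le {η a : ℝ} (hη : 0 < η) (ha : 0 < a) {u v : ℝ → ℝ}
    (hu : Continuous u) (hv : Continuous v) (hu0 : ∀ s, 0 ≤ u s) (hv0 : ∀ s, 0 ≤ v s) :
    (∫ s in (0:ℝ)..η, u s) * (∫ s in (0:ℝ)..η, v s)
      ≤ η / 2 * (a * (∫ s in (0:ℝ)..η, u s ^ 2) + (∫ s in (0:ℝ)..η, v s ^ 2) / a) := by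
  have h1 := pow_interval_average_le hη hu hu0 2
  have h2 := pow_interval_average_le hη hv hv0 2
  generalize (∫ s in (0:ℝ)..η, u s) = U at *
  generalize (∫ s in (0:ℝ)..η, v s) = W at *
  generalize (∫ s in (0:ℝ)..η, u s ^ 2) = U2 at *
  generalize (∫ s in (0:ℝ)..η, v s ^ 2) = W2 at *
  have h1' : U ^ 2 ≤ η * U2 := by
    rw [mul_pow, inv_mul_eq_div, inv_pow, inv_mul_eq_div, div_le_div_iff₀ (by positivity) hη] at h1
    nlinarith
  have h2' : W ^ 2 ≤ η * W2 := by
    rw [mul_pow, inv_mul_eq_div, inv_pow, inv_mul_eq_div, div_le_div_iff₀ (by positivity) hη] at h2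
    nlinarith
  have h3 : U * W ≤ (a * U ^ 2 + W ^ 2 / a) / 2 := by
    have : a * U ^ 2 + W ^ 2 / a - 2 * (U * W) = (a * U - W) ^ 2 / a := by field_simp; ring
    have : 0 ≤ (a * U - W) ^ 2 / a := by positivity
    linarith
  calc U * W ≤ _ := h3
    _ ≤ (a * (η * U2) + (η * W2) / a) / 2 := by gcongr
    _ = _ := by ring

section MomentBounds

variable {α β : Type*} [MeasurableSpace α] [MeasurableSpace β]

lemma eLpNorm_natCast_eq_lintegral {μ : Measure α} {X : α → ℝ} (hX : ∀ z, 0 ≤ X z) {n : ℕ}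
    (hn : n ≠ 0) :
    eLpNorm X n μ = (∫⁻ z, ENNReal.ofReal (X z ^ n) ∂μ) ^ ((n:ℝ)⁻¹) := by
  rw [eLpNorm_eq_lintegral_rpow_enorm_toReal (by exact_mod_cast hn) (by simp)]
  simp only [ENNReal.toReal_natCast, one_div, ENNReal.rpow_natCast]
  congr 2 with z
  rw [Real.enorm_of_nonneg (hX z), ENNReal.ofReal_pow (hX z)]

lemma eLpNorm_prod_natCast_le {μ : Measure α} {ν : Measure β} [SFinite μ] [SFinite ν]
    {X : α × β → ℝ} (hX : Measurable X) (hX0 : ∀ z, 0 ≤ X z) {n : ℕ} (hn : n ≠ 0) {Y : α → ℝ}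
    (hXi : ∀ q, Integrable (fun p => X (q, p) ^ n) ν)
    (hXY : ∀ q, ∫ p, X (q, p) ^ n ∂ν ≤ Y q) (hY : Integrable Y μ) {a : ℝ} (ha : 0 ≤ a)
    (hYa : ∫ q, Y q ∂μ ≤ a ^ n) :
    eLpNorm X n (μ.prod ν) ≤ ENNReal.ofReal a := by
  have hY0 : ∀ q, 0 ≤ Y q := fun q =>
    (integral_nonneg fun p => pow_nonneg (hX0 _) n).trans (hXY q)
  rw [eLpNorm_natCast_eq_lintegral hX0 hn, ENNReal.rpow_inv_le_iff (by positivity),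
    ENNReal.rpow_natCast, ← ENNReal.ofReal_pow ha,
    lintegral_prod _ (by fun_prop)]
  calc ∫⁻ q, ∫⁻ p, ENNReal.ofReal (X (q, p) ^ n) ∂ν ∂μ
      ≤ ∫⁻ q, ENNReal.ofReal (Y q) ∂μ := by
        refine lintegral_mono fun q => ?_
        rw [← ofReal_integral_eq_lintegral_ofReal (hXi q)
          (Filter.Eventually.of_forall fun p => pow_nonneg (hX0 _) n)]
        exact ENNReal.ofReal_le_ofReal (hXY q)
    _ = ENNReal.ofReal (∫ q, Y q ∂μ) :=
        (ofReal_integral_eq_lintegral_ofReal hY (Filter.Eventually.of_forall hY0)).symm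
    _ ≤ _ := ENNReal.ofReal_le_ofReal hYa

lemma eLpNorm_add_le_ofReal {μ : Measure α} {X Y : α → ℝ} (hX : AEStronglyMeasurable X μ)
    (hY : AEStronglyMeasurable Y μ) {p : ℝ≥0∞} (hp : 1 ≤ p) {a b : ℝ} (ha : 0 ≤ a) (hb : 0 ≤ b)
    (hXa : eLpNorm X p μ ≤ ENNReal.ofReal a) (hYb : eLpNorm Y p μ ≤ ENNReal.ofReal b) :
    eLpNorm (fun z => X z + Y z) p μ ≤ ENNReal.ofReal (a + b) := by
  rw [ENNReal.ofReal_add ha hb]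
  exact (eLpNorm_add_le hX hY hp).trans (add_le_add hXa hYb)

lemma eLpNorm_const_mul_le_ofReal {μ : Measure α} {X : α → ℝ} {p : ℝ≥0∞} {c a : ℝ} (hc : 0 ≤ c)
    (hXa : eLpNorm X p μ ≤ ENNReal.ofReal a) :
    eLpNorm (fun z => c * X z) p μ ≤ ENNReal.ofReal (c * a) := by
  rw [ENNReal.ofReal_mul hc, ← Real.enorm_of_nonneg hc]
  exact (eLpNorm_const_smul_le (c := c) (f := X)).trans (mul_le_mul_right hXa _)

lemma eLpNorm_const_le_ofReal {μ : Measure α} [IsProbabilityMeasure μ] {p : ℝ≥0∞} (hp : p ≠ 0)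
    {c : ℝ} (hc : 0 ≤ c) : eLpNorm (fun _ : α => c) p μ ≤ ENNReal.ofReal c := by
  rw [eLpNorm_const _ hp (IsProbabilityMeasure.ne_zero μ)]
  simp [Real.enorm_of_nonneg hc]

end MomentBounds

section EnergyMajorant

variable {d : ℕ} {f : Euc d → ℝ} {L τ : ℝ}

/-- A nonnegative combination of the squared local quantities that control the energy error of a
leapfrog step. -/
noncomputable def energyMajorant (f : Euc d → ℝ) (c₀ c₁ c₂ c₃ c₄ c₅ c₆ : ℝ)
    (z : Euc d × Euc d) : ℝ :=
  c₀ + c₁ * inner ℝ (fderiv ℝ (gradient f) z.1 z.2) (gradient f z.1) ^ 2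
    + c₂ * inner ℝ (thirdDeriv f z.1 z.2 z.2) z.2 ^ 2 + c₃ * ‖z.2‖ ^ 2
    + c₄ * ‖thirdDeriv f z.1 z.2 z.2‖ ^ 2 + c₅ * ‖gradient f z.1‖ ^ 2 + c₆ * (‖z.2‖ ^ 2) ^ 2

lemma continuous_energyMajorant (hf : ContDiff ℝ 3 f) (c₀ c₁ c₂ c₃ c₄ c₅ c₆ : ℝ) :
    Continuous (energyMajorant f c₀ c₁ c₂ c₃ c₄ c₅ c₆) := by
  have hg : ContDiff ℝ 2 (gradient f) := contDiff_gradient (n := 2) hf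
  have h1 : Continuous (gradient f) := hg.continuous
  have h2 : Continuous (fderiv ℝ (gradient f)) := hg.continuous_fderiv (by simp)
  have h3 := continuous_thirdDeriv hf
  unfold energyMajorant
  fun_prop

lemma energyMajorant_nonneg {c₀ c₁ c₂ c₃ c₄ c₅ c₆ : ℝ} (h₀ : 0 ≤ c₀) (h₁ : 0 ≤ c₁) (h₂ : 0 ≤ c₂)
    (h₃ : 0 ≤ c₃) (h₄ : 0 ≤ c₄) (h₅ : 0 ≤ c₅) (h₆ : 0 ≤ c₆) (z : Euc d × Euc d) :
    0 ≤ energyMajorant f c₀ c₁ c₂ c₃ c₄ c₅ c₆ z := by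
  unfold energyMajorant
  positivity

lemma abs_le_half_sq_div_add {κ : ℝ} (hκ : 0 < κ) (x : ℝ) : |x| ≤ (κ + x ^ 2 / κ) / 2 := by
  have h : κ + x ^ 2 / κ - 2 * |x| = (κ - |x|) ^ 2 / κ := by
    field_simp
    rw [← sq_abs x]
    ring
  have : 0 ≤ (κ - |x|) ^ 2 / κ := by positivity
  linarith

theorem LSmooth.abs_leapfrog_energy_le_average (hf : ContDiff ℝ 3 f) {r η κ σ lam D : ℝ}
    (hL : LSmooth f (r ^ 2)) (hM : ∀ x, CubicBound (thirdDeriv f x) τ) {Q P : ℝ → Euc d}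
    (h : IsHamiltonianTrajectory f Q P) (hη : 0 < η) (hr : 0 < r) (hηr : η * r ≤ 1)
    (hκ : 0 < κ) (hσ : 0 < σ) (hlam : 0 < lam) (hD : 0 < D) :
    |trapezoidError f η (Q 0) (leapfrog f η 1 (Q 0, P 0)).1|
      ≤ η⁻¹ * ∫ s in (0:ℝ)..η, energyMajorant f (η ^ 3 * (κ + σ) / 4) (η ^ 3 / (4 * κ))
        (η ^ 3 / (4 * σ)) (η ^ 5 * r ^ 2 * lam / 2 + 3 * η ^ 5 * r ^ 5 + τ * η ^ 7 * r ^ 4 * D / 2)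
        (η ^ 5 * r ^ 2 / (2 * lam)) (η ^ 5 * r ^ 3) (τ * η ^ 7 * r ^ 4 / (2 * D))
        (Q s, P s) := by
  have hτ : 0 ≤ τ := (hM 0).nonneg
  have hc := h.forceCurve hf
  have hPc := hc.continuous_momentum
  have hGc := hc.continuous_force
  have hAc := hc.continuous_force_deriv
  have hVc : Continuous fun s => thirdDeriv f (Q s) (P s) (P s) :=
    (((continuous_thirdDeriv hf).comp hc.continuous_position).clm_apply hPc).clm_apply hPc
  have hAGc := hAc.inner (𝕜 := ℝ) hGc
  have hSc := hVc.inner (𝕜 := ℝ) hPc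
  have hmain := hL.abs_leapfrog_energy_le hf hM h hη.le
    (by rw [← mul_pow]; exact pow_le_one₀ (by positivity) hηr) rfl rfl rfl
  have hPV := mul_interval_integrals_le hη hlam hPc.norm hVc.norm (fun _ => norm_nonneg _)
    fun _ => norm_nonneg _
  have hPG := mul_interval_integrals_le hη hr hPc.norm hGc.norm (fun _ => norm_nonneg _)
    fun _ => norm_nonneg _
  have hP2 := mul_interval_integrals_le hη one_pos hPc.norm hPc.norm (fun _ => norm_nonneg _)
    fun _ => norm_nonneg _
  have hP3 := pow_interval_average_le hη hPc.norm (fun _ => norm_nonneg _) 3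
  have hcube : ∫ s in (0:ℝ)..η, ‖P s‖ ^ 3
      ≤ ∫ s in (0:ℝ)..η, (D * ‖P s‖ ^ 2 + (‖P s‖ ^ 2) ^ 2 / D) / 2 := by
    refine intervalIntegral.integral_mono_on hη.le (by apply Continuous.intervalIntegrable; fun_prop)
      (by apply Continuous.intervalIntegrable; fun_prop) fun s _ => ?_
    have h0 := mul_le_mul_of_nonneg_left (abs_le_half_sq_div_add hD ‖P s‖) (sq_nonneg ‖P s‖)
    rw [abs_norm] at h0
    calc ‖P s‖ ^ 3 = ‖P s‖ ^ 2 * ‖P s‖ := by ring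
      _ ≤ _ := h0
      _ = _ := by ring
  have hinner : ∫ s in (0:ℝ)..η, (|inner ℝ (fderiv ℝ (gradient f) (Q s) (P s)) (gradient f (Q s))|
        + |inner ℝ (thirdDeriv f (Q s) (P s) (P s)) (P s)|)
      ≤ ∫ s in (0:ℝ)..η,
        ((κ + inner ℝ (fderiv ℝ (gradient f) (Q s) (P s)) (gradient f (Q s)) ^ 2 / κ) / 2
          + (σ + inner ℝ (thirdDeriv f (Q s) (P s) (P s)) (P s) ^ 2 / σ) / 2) := by
    refine intervalIntegral.integral_mono_on hη.le (by apply Continuous.intervalIntegrable; fun_prop)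
      (by apply Continuous.intervalIntegrable; fun_prop) fun s _ => ?_
    exact add_le_add (abs_le_half_sq_div_add hκ _) (abs_le_half_sq_div_add hσ _)
  have i1 : IntervalIntegrable
      (fun s => inner ℝ (fderiv ℝ (gradient f) (Q s) (P s)) (gradient f (Q s)) ^ 2)
      volume 0 η := (hAGc.pow 2).intervalIntegrable _ _
  have i2 : IntervalIntegrable (fun s => inner ℝ (thirdDeriv f (Q s) (P s) (P s)) (P s) ^ 2)
      volume 0 η := (hSc.pow 2).intervalIntegrable _ _
  have i3 : IntervalIntegrable (fun s => ‖P s‖ ^ 2)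
      volume 0 η := (hPc.norm.pow 2).intervalIntegrable _ _
  have i4 : IntervalIntegrable (fun s => ‖thirdDeriv f (Q s) (P s) (P s)‖ ^ 2)
      volume 0 η := (hVc.norm.pow 2).intervalIntegrable _ _
  have i5 : IntervalIntegrable (fun s => ‖gradient f (Q s)‖ ^ 2)
      volume 0 η := (hGc.norm.pow 2).intervalIntegrable _ _
  have i6 : IntervalIntegrable (fun s => (‖P s‖ ^ 2) ^ 2)
      volume 0 η := ((hPc.norm.pow 2).pow 2).intervalIntegrable _ _
  have i0 : ∀ c : ℝ, IntervalIntegrable (fun _ : ℝ => c) volume 0 η := fun c =>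
    continuous_const.intervalIntegrable _ _
  have e1 : ∀ c₀ c₁ c₂ c₃ c₄ c₅ c₆ : ℝ, ∫ s in (0:ℝ)..η,
      energyMajorant f c₀ c₁ c₂ c₃ c₄ c₅ c₆ (Q s, P s) = η * c₀
        + c₁ * (∫ s in (0:ℝ)..η,
          inner ℝ (fderiv ℝ (gradient f) (Q s) (P s)) (gradient f (Q s)) ^ 2)
        + c₂ * (∫ s in (0:ℝ)..η, inner ℝ (thirdDeriv f (Q s) (P s) (P s)) (P s) ^ 2)
        + c₃ * (∫ s in (0:ℝ)..η, ‖P s‖ ^ 2)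
        + c₄ * (∫ s in (0:ℝ)..η, ‖thirdDeriv f (Q s) (P s) (P s)‖ ^ 2)
        + c₅ * (∫ s in (0:ℝ)..η, ‖gradient f (Q s)‖ ^ 2)
        + c₆ * (∫ s in (0:ℝ)..η, (‖P s‖ ^ 2) ^ 2) := by
    intro c₀ c₁ c₂ c₃ c₄ c₅ c₆
    have j1 := (i0 c₀).add (i1.const_mul c₁)
    have j2 := j1.add (i2.const_mul c₂)
    have j3 := j2.add (i3.const_mul c₃)
    have j4 := j3.add (i4.const_mul c₄)
    have j5 := j4.add (i5.const_mul c₅)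
    simp only [energyMajorant]
    rw [intervalIntegral.integral_add j5 (i6.const_mul c₆),
      intervalIntegral.integral_add j4 (i5.const_mul c₅),
      intervalIntegral.integral_add j3 (i4.const_mul c₄),
      intervalIntegral.integral_add j2 (i3.const_mul c₃),
      intervalIntegral.integral_add j1 (i2.const_mul c₂),
      intervalIntegral.integral_add (i0 c₀) (i1.const_mul c₁)]
    simp only [intervalIntegral.integral_const_mul, intervalIntegral.integral_const, sub_zero,
      smul_eq_mul]
  rw [e1]
  rw [intervalIntegral.integral_div, intervalIntegral.integral_add (i3.const_mul D)
    (i6.div_const D), intervalIntegral.integral_const_mul, intervalIntegral.integral_div] at hcube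
  rw [intervalIntegral.integral_add (((i0 κ).add (i1.div_const κ)).div_const 2)
    (((i0 σ).add (i2.div_const σ)).div_const 2), intervalIntegral.integral_div,
    intervalIntegral.integral_div,
    intervalIntegral.integral_add (i0 κ) (i1.div_const κ),
    intervalIntegral.integral_add (i0 σ) (i2.div_const σ), intervalIntegral.integral_div,
    intervalIntegral.integral_div] at hinner
  simp only [intervalIntegral.integral_const, sub_zero, smul_eq_mul] at hinner
  have hI3 : 0 ≤ ∫ s in (0:ℝ)..η, ‖P s‖ ^ 2 :=
    intervalIntegral.integral_nonneg hη.le fun _ _ => by positivity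
  refine hmain.trans ?_
  generalize (∫ s in (0:ℝ)..η, (|inner ℝ (fderiv ℝ (gradient f) (Q s) (P s)) (gradient f (Q s))|
        + |inner ℝ (thirdDeriv f (Q s) (P s) (P s)) (P s)|)) = K at *
  generalize (∫ s in (0:ℝ)..η,
          inner ℝ (fderiv ℝ (gradient f) (Q s) (P s)) (gradient f (Q s)) ^ 2) = I1 at *
  generalize (∫ s in (0:ℝ)..η, inner ℝ (thirdDeriv f (Q s) (P s) (P s)) (P s) ^ 2) = I2 at *
  generalize (∫ s in (0:ℝ)..η, ‖thirdDeriv f (Q s) (P s) (P s)‖ ^ 2) = I4 at *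
  generalize (∫ s in (0:ℝ)..η, ‖gradient f (Q s)‖ ^ 2) = I5 at *
  generalize (∫ s in (0:ℝ)..η, (‖P s‖ ^ 2) ^ 2) = I6 at *
  generalize (∫ s in (0:ℝ)..η, ‖P s‖ ^ 2) = I3 at *
  generalize (∫ s in (0:ℝ)..η, ‖P s‖ ^ 3) = C at *
  generalize (∫ s in (0:ℝ)..η, ‖P s‖) = JP at *
  generalize (∫ s in (0:ℝ)..η, ‖gradient f (Q s)‖) = JG at *
  generalize (∫ s in (0:ℝ)..η, ‖thirdDeriv f (Q s) (P s) (P s)‖) = JV at *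
  have hP3' : JP ^ 3 ≤ η ^ 2 * ((D * I3 + I6 / D) / 2) := by
    have h1 : JP ^ 3 = η ^ 3 * (η⁻¹ * JP) ^ 3 := by field_simp
    rw [h1]
    calc η ^ 3 * (η⁻¹ * JP) ^ 3 ≤ η ^ 3 * (η⁻¹ * C) := by gcongr
      _ = η ^ 2 * C := by field_simp
      _ ≤ _ := by gcongr
  have k1 := mul_le_mul_of_nonneg_left hinner (show 0 ≤ η ^ 2 / 2 by positivity)
  have k2 := mul_le_mul_of_nonneg_left hPV (show 0 ≤ η ^ 3 * r ^ 2 by positivity)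
  have k3 := mul_le_mul_of_nonneg_left hPG (show 0 ≤ 2 * (η ^ 3 * (r ^ 2) ^ 2) by positivity)
  have k4 : 2 * (η ^ 4 * (r ^ 2) ^ 3 * JP ^ 2) ≤ 2 * (η ^ 4 * r ^ 5 * I3) := by
    have h1 : JP ^ 2 ≤ η * I3 := by nlinarith
    calc 2 * (η ^ 4 * (r ^ 2) ^ 3 * JP ^ 2) ≤ 2 * (η ^ 4 * (r ^ 2) ^ 3 * (η * I3)) := by gcongr
      _ = 2 * (η ^ 4 * r ^ 5 * I3) * (η * r) := by ring
      _ ≤ 2 * (η ^ 4 * r ^ 5 * I3) * 1 := by gcongr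
      _ = _ := mul_one _
  have k5 := mul_le_mul_of_nonneg_left hP3' (show 0 ≤ τ * η ^ 4 * (r ^ 2) ^ 2 by positivity)
  have hRHS : η⁻¹ * (η * (η ^ 3 * (κ + σ) / 4) + η ^ 3 / (4 * κ) * I1 + η ^ 3 / (4 * σ) * I2
        + (η ^ 5 * r ^ 2 * lam / 2 + 3 * η ^ 5 * r ^ 5 + τ * η ^ 7 * r ^ 4 * D / 2) * I3
        + η ^ 5 * r ^ 2 / (2 * lam) * I4 + η ^ 5 * r ^ 3 * I5 + τ * η ^ 7 * r ^ 4 / (2 * D) * I6)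
      = η ^ 2 / 2 * ((η * κ + I1 / κ) / 2 + (η * σ + I2 / σ) / 2)
        + η ^ 3 * r ^ 2 * (η / 2 * (lam * I3 + I4 / lam))
        + 2 * (η ^ 3 * (r ^ 2) ^ 2) * (η / 2 * (r * I3 + I5 / r))
        + 2 * (η ^ 4 * r ^ 5 * I3)
        + τ * η ^ 4 * (r ^ 2) ^ 2 * (η ^ 2 * ((D * I3 + I6 / D) / 2)) := by
    field_simp
    ring
  rw [hRHS]
  nlinarith

end EnergyMajorant

section StationaryMoments

variable {d : ℕ} {f : Euc d → ℝ} {L τ : ℝ}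

lemma eLpNorm_inner_hessian_gradient_sq_le (hf : ContDiff ℝ 2 f) (hL : LSmooth f L)
    (hs : SubexpTail f) {ℓ : ℕ} (hℓ : 1 ≤ ℓ) {D : ℝ} (hD0 : 0 ≤ D)
    (hD : (d : ℝ) + 2 * ((ℓ : ℝ) - 1) ≤ D) :
    eLpNorm (fun z : Euc d × Euc d =>
        inner ℝ (fderiv ℝ (gradient f) z.1 z.2) (gradient f z.1) ^ 2) ℓ
      ((targetMeasure f).prod (targetMeasure (gaussianPotential d)))
      ≤ ENNReal.ofReal (2 * ℓ * L ^ 3 * D) := by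
  have hL0 := hL.nonneg
  have hμ := hs.isProbabilityMeasure hf.continuous
  have hg : ContDiff ℝ 1 (gradient f) := contDiff_gradient (n := 1) hf
  have hgc : Continuous (gradient f) := hg.continuous
  have hHc : Continuous (fderiv ℝ (gradient f)) := hg.continuous_fderiv (by simp)
  have hGi : Integrable (fun q => (‖gradient f q‖ ^ 2) ^ ℓ) (targetMeasure f) :=
    PolyGrowth.integrable_targetMeasure hf.continuous hs
      (((hL.polyGrowth_gradient hf).norm.pow 2).pow ℓ) (by fun_prop)
  have hd : (0:ℝ) ≤ d := Nat.cast_nonneg d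
  have hℓ0 : ℓ ≠ 0 := by omega
  have hℓ1 : (1:ℝ) ≤ ℓ := by exact_mod_cast hℓ
  have hGm : ∫ q, (‖gradient f q‖ ^ 2) ^ ℓ ∂(targetMeasure f) ≤ (L * D) ^ ℓ :=
    (hL.integral_norm_sq_gradient_pow_le hf hs hℓ).trans
      (pow_le_pow_left₀ (mul_nonneg hL0 (by linarith)) (by gcongr) ℓ)
  simp only [inner_hessian_comm hf _ _ (gradient f _)]
  refine eLpNorm_prod_natCast_le (Y := fun q => (2 * ℓ * L ^ 2) ^ ℓ * (‖gradient f q‖ ^ 2) ^ ℓ)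
    (Continuous.measurable (by fun_prop)) (fun z => sq_nonneg _) hℓ0 (fun q => ?_)
    (fun q => ?_) (hGi.const_mul _) (by positivity) ?_
  · exact PolyGrowth.integrable_gaussian
      (φ := fun p => (inner ℝ (fderiv ℝ (gradient f) q (gradient f q)) p ^ 2) ^ ℓ)
      (((polyGrowth_inner_left _).pow 2).pow ℓ) (by fun_prop)
  · refine (integral_inner_sq_pow_gaussian_le (fderiv ℝ (gradient f) q (gradient f q)) ℓ).trans ?_
    rw [← mul_pow]
    have h1 := ContinuousLinearMap.le_of_opNorm_le _ (hL q) (gradient f q)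
    have h2 : ‖fderiv ℝ (gradient f) q (gradient f q)‖ ^ 2 ≤ (L * ‖gradient f q‖) ^ 2 := by
      gcongr
    refine pow_le_pow_left₀ (by positivity) ?_ ℓ
    calc 2 * (ℓ:ℝ) * ‖fderiv ℝ (gradient f) q (gradient f q)‖ ^ 2
        ≤ 2 * ℓ * (L * ‖gradient f q‖) ^ 2 := by gcongr
      _ = _ := by ring
  · rw [integral_const_mul]
    calc (2 * (ℓ:ℝ) * L ^ 2) ^ ℓ * ∫ q, (‖gradient f q‖ ^ 2) ^ ℓ ∂(targetMeasure f)
        ≤ (2 * (ℓ:ℝ) * L ^ 2) ^ ℓ * (L * D) ^ ℓ := by gcongr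
      _ = _ := by rw [← mul_pow]; ring

lemma eLpNorm_energyMajorant_le (hf : ContDiff ℝ 3 f) (hL : LSmooth f L)
    (hM : ∀ x, CubicBound (thirdDeriv f x) τ) (hs : SubexpTail f) (hd : 1 ≤ d) {ℓ : ℕ}
    (hℓ : 1 ≤ ℓ) {c₀ c₁ c₂ c₃ c₄ c₅ c₆ D : ℝ} (h₀ : 0 ≤ c₀) (h₁ : 0 ≤ c₁) (h₂ : 0 ≤ c₂)
    (h₃ : 0 ≤ c₃) (h₄ : 0 ≤ c₄) (h₅ : 0 ≤ c₅) (h₆ : 0 ≤ c₆)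
    (hD : D = (d : ℝ) + 2 * ((ℓ : ℝ) - 1)) :
    eLpNorm (energyMajorant f c₀ c₁ c₂ c₃ c₄ c₅ c₆) ℓ ((targetMeasure f).prod (stdGaussian d))
      ≤ ENNReal.ofReal (c₀ + c₁ * (2 * ℓ * L ^ 3 * D) + c₂ * (1536 * ℓ ^ 2 * D * τ ^ 2) + c₃ * D
        + c₄ * (32 * ℓ * D * τ ^ 2) + c₅ * (L * D) + c₆ * (3 * D) ^ 2) := by
  have hf2 : ContDiff ℝ 2 f := hf.of_le (by norm_num)
  have hL0 := hL.nonneg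
  have hμ := hs.isProbabilityMeasure hf.continuous
  have hd' : (1:ℝ) ≤ d := by exact_mod_cast hd
  have hℓ' : (1:ℝ) ≤ ℓ := by exact_mod_cast hℓ
  have hℓ0 : ℓ ≠ 0 := by omega
  have hD0 : 0 ≤ D := by rw [hD]; linarith
  have hg : ContDiff ℝ 2 (gradient f) := contDiff_gradient (n := 2) hf
  have hgc : Continuous (gradient f) := hg.continuous
  have hHc : Continuous (fderiv ℝ (gradient f)) := hg.continuous_fderiv (by simp)
  have hTc := continuous_thirdDeriv hf
  have hGi : Integrable (fun q => (‖gradient f q‖ ^ 2) ^ ℓ) (targetMeasure f) :=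
    PolyGrowth.integrable_targetMeasure hf.continuous hs
      (((hL.polyGrowth_gradient hf2).norm.pow 2).pow ℓ) (by fun_prop)
  have hGm : ∫ q, (‖gradient f q‖ ^ 2) ^ ℓ ∂(targetMeasure f) ≤ (L * D) ^ ℓ := by
    rw [hD]; exact hL.integral_norm_sq_gradient_pow_le hf2 hs hℓ
  have hnorm : PolyGrowth fun p : Euc d => ‖p‖ ^ 2 := PolyGrowth.id'.norm.pow 2
  rw [stdGaussian_eq_targetMeasure]
  have m1 := eLpNorm_inner_hessian_gradient_sq_le hf2 hL hs hℓ hD0 hD.ge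
  have m2 : eLpNorm (fun z : Euc d × Euc d => inner ℝ (thirdDeriv f z.1 z.2 z.2) z.2 ^ 2) ℓ
      ((targetMeasure f).prod (targetMeasure (gaussianPotential d)))
      ≤ ENNReal.ofReal (1536 * ℓ ^ 2 * D * τ ^ 2) := by
    refine eLpNorm_prod_natCast_le (Y := fun _ => (1536 * ℓ ^ 2 * D * τ ^ 2) ^ ℓ)
      (Continuous.measurable (by fun_prop)) (fun z => sq_nonneg _) hℓ0 (fun q => ?_)
      (fun q => ?_) (integrable_const _) (by positivity) (by simp)
    · exact PolyGrowth.integrable_gaussian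
        (φ := fun p => (inner ℝ (thirdDeriv f q p p) p ^ 2) ^ ℓ)
        ((((CubicBound.polyGrowth_diag _).inner PolyGrowth.id').pow 2).pow ℓ) (by fun_prop)
    · rw [hD]; exact (hM q).integral_inner_diag_sq_pow_le hℓ
  have m3 : eLpNorm (fun z : Euc d × Euc d => ‖z.2‖ ^ 2) ℓ
      ((targetMeasure f).prod (targetMeasure (gaussianPotential d))) ≤ ENNReal.ofReal D := by
    refine eLpNorm_prod_natCast_le (Y := fun _ => D ^ ℓ)
      (Continuous.measurable (by fun_prop)) (fun z => sq_nonneg _) hℓ0 (fun q => ?_)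
      (fun q => ?_) (integrable_const _) hD0 (by simp)
    · exact (hnorm.pow ℓ).integrable_gaussian (by fun_prop)
    · rw [hD]; exact integral_norm_sq_pow_gaussian_le hℓ
  have m4 : eLpNorm (fun z : Euc d × Euc d => ‖thirdDeriv f z.1 z.2 z.2‖ ^ 2) ℓ
      ((targetMeasure f).prod (targetMeasure (gaussianPotential d)))
      ≤ ENNReal.ofReal (32 * ℓ * D * τ ^ 2) := by
    refine eLpNorm_prod_natCast_le (Y := fun _ => (32 * ℓ * D * τ ^ 2) ^ ℓ)
      (Continuous.measurable (by fun_prop)) (fun z => sq_nonneg _) hℓ0 (fun q => ?_)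
      (fun q => ?_) (integrable_const _) (by positivity) (by simp)
    · exact PolyGrowth.integrable_gaussian (φ := fun p => (‖thirdDeriv f q p p‖ ^ 2) ^ ℓ)
        (((CubicBound.polyGrowth_diag _).norm.pow 2).pow ℓ) (by fun_prop)
    · rw [hD]; exact (hM q).integral_norm_sq_diag_pow_le hℓ
  have m5 : eLpNorm (fun z : Euc d × Euc d => ‖gradient f z.1‖ ^ 2) ℓ
      ((targetMeasure f).prod (targetMeasure (gaussianPotential d)))
      ≤ ENNReal.ofReal (L * D) :=
    eLpNorm_prod_natCast_le (Y := fun q => (‖gradient f q‖ ^ 2) ^ ℓ)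
      (Continuous.measurable (by fun_prop)) (fun z => sq_nonneg _) hℓ0
      (fun q => integrable_const ((‖gradient f q‖ ^ 2) ^ ℓ)) (fun q => by simp) hGi (by positivity) hGm
  have m6 : eLpNorm (fun z : Euc d × Euc d => (‖z.2‖ ^ 2) ^ 2) ℓ
      ((targetMeasure f).prod (targetMeasure (gaussianPotential d)))
      ≤ ENNReal.ofReal ((3 * D) ^ 2) := by
    refine eLpNorm_prod_natCast_le (Y := fun _ => ((3 * D) ^ 2) ^ ℓ)
      (Continuous.measurable (by fun_prop)) (fun z => sq_nonneg _) hℓ0 (fun q => ?_)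
      (fun q => ?_) (integrable_const _) (by positivity) (by simp)
    · exact ((hnorm.pow 2).pow ℓ).integrable_gaussian (by fun_prop)
    · simp only [← pow_mul _ 2 ℓ]
      refine (integral_norm_sq_pow_gaussian_le (by omega)).trans ?_
      push_cast
      exact pow_le_pow_left₀ (by linarith) (by rw [hD]; linarith) _
  have hp : (1:ℝ≥0∞) ≤ (ℓ:ℝ≥0∞) := by exact_mod_cast hℓ
  have m0 := eLpNorm_const_le_ofReal (p := (ℓ:ℝ≥0∞))
    (μ := (targetMeasure f).prod (targetMeasure (gaussianPotential d))) (by simpa using hℓ0) h₀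
  have s1 := eLpNorm_add_le_ofReal (Continuous.aestronglyMeasurable (by fun_prop))
    (Continuous.aestronglyMeasurable (by fun_prop)) hp h₀ (by positivity) m0
    (eLpNorm_const_mul_le_ofReal h₁ m1)
  have s2 := eLpNorm_add_le_ofReal (Continuous.aestronglyMeasurable (by fun_prop))
    (Continuous.aestronglyMeasurable (by fun_prop)) hp (by positivity) (by positivity) s1
    (eLpNorm_const_mul_le_ofReal h₂ m2)
  have s3 := eLpNorm_add_le_ofReal (Continuous.aestronglyMeasurable (by fun_prop))
    (Continuous.aestronglyMeasurable (by fun_prop)) hp (by positivity) (by positivity) s2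
    (eLpNorm_const_mul_le_ofReal h₃ m3)
  have s4 := eLpNorm_add_le_ofReal (Continuous.aestronglyMeasurable (by fun_prop))
    (Continuous.aestronglyMeasurable (by fun_prop)) hp (by positivity) (by positivity) s3
    (eLpNorm_const_mul_le_ofReal h₄ m4)
  have s5 := eLpNorm_add_le_ofReal (Continuous.aestronglyMeasurable (by fun_prop))
    (Continuous.aestronglyMeasurable (by fun_prop)) hp (by positivity) (by positivity) s4
    (eLpNorm_const_mul_le_ofReal h₅ m5)
  exact eLpNorm_add_le_ofReal (Continuous.aestronglyMeasurable (by fun_prop))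
    (Continuous.aestronglyMeasurable (by fun_prop)) hp (by positivity) (by positivity) s5
    (eLpNorm_const_mul_le_ofReal h₆ m6)

theorem IsHamiltonianFlow.lintegral_rpow_inv_le (hf : ContDiff ℝ 2 f) (hL : LSmooth f L)
    (hμ : IsProbabilityMeasure (targetMeasure f)) {Φ : Euc d × Euc d → ℝ → Euc d × Euc d}
    (hΦ : IsHamiltonianFlow f Φ) {X Ψ : Euc d × Euc d → ℝ} (hΨ : Continuous Ψ)
    (hΨ0 : ∀ z, 0 ≤ Ψ z) {η : ℝ} (hη : 0 < η) {ℓ : ℕ} (hℓ : ℓ ≠ 0)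
    (hX : ∀ z, |X z| ≤ η⁻¹ * ∫ s in (0:ℝ)..η, Ψ (Φ z s)) :
    (∫⁻ z, ENNReal.ofReal (|X z| ^ ℓ) ∂((targetMeasure f).prod (stdGaussian d))) ^ ((ℓ:ℝ)⁻¹)
      ≤ eLpNorm Ψ ℓ ((targetMeasure f).prod (stdGaussian d)) := by
  rw [eLpNorm_natCast_eq_lintegral hΨ0 hℓ]
  refine ENNReal.rpow_le_rpow ?_ (by positivity)
  calc ∫⁻ z, ENNReal.ofReal (|X z| ^ ℓ) ∂((targetMeasure f).prod (stdGaussian d))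
      ≤ ∫⁻ z, ENNReal.ofReal η⁻¹ * (∫⁻ s in Set.Ioc 0 η, ENNReal.ofReal (Ψ (Φ z s) ^ ℓ))
          ∂((targetMeasure f).prod (stdGaussian d)) := by
        refine lintegral_mono fun z => ?_
        have hc : Continuous (Φ z) := by
          have h1 := (hΦ z).2
          exact (continuous_iff_continuousAt.2 fun t => (h1.1 t).continuousAt).prodMk
            (continuous_iff_continuousAt.2 fun t => (h1.2 t).continuousAt)
        have hu : Continuous fun s => Ψ (Φ z s) := hΨ.comp hc
        have hi : IntegrableOn (fun s => Ψ (Φ z s) ^ ℓ) (Set.Ioc 0 η) := (hu.pow ℓ).integrableOn_Ioc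
        rw [← ofReal_integral_eq_lintegral_ofReal hi
          (Filter.Eventually.of_forall fun s => pow_nonneg (hΨ0 _) ℓ),
          ← ENNReal.ofReal_mul (by positivity), ← intervalIntegral.integral_of_le hη.le]
        exact ENNReal.ofReal_le_ofReal ((pow_le_pow_left₀ (abs_nonneg _) (hX z) ℓ).trans
          (pow_interval_average_le hη hu (fun s => hΨ0 _) ℓ))
    _ = ENNReal.ofReal η⁻¹ * ∫⁻ z, (∫⁻ s in Set.Ioc 0 η, ENNReal.ofReal (Ψ (Φ z s) ^ ℓ))
          ∂((targetMeasure f).prod (stdGaussian d)) :=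
        lintegral_const_mul' _ _ ENNReal.ofReal_ne_top
    _ ≤ ENNReal.ofReal η⁻¹ * (ENNReal.ofReal η * ∫⁻ z, ENNReal.ofReal (Ψ z ^ ℓ)
          ∂((targetMeasure f).prod (stdGaussian d))) := by
        gcongr
        exact hΦ.lintegral_lintegral_le hf hL hμ (F := fun z => Ψ z ^ ℓ) (hΨ.pow ℓ) η
    _ = _ := by
        rw [← mul_assoc, ← ENNReal.ofReal_mul (by positivity), inv_mul_cancel₀ hη.ne']
        simp

end StationaryMoments

section LeapfrogMoments

variable {d : ℕ} {f : Euc d → ℝ}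

lemma leapfrog_energy_eq_zero_of_lSmooth_zero (hf : ContDiff ℝ 3 f) (hL : LSmooth f 0)
    (hM : ∀ x, CubicBound (thirdDeriv f x) 0) {η : ℝ} (hη : 0 ≤ η) (z : Euc d × Euc d) :
    -(f (leapfrog f η 1 z).1) - ‖(leapfrog f η 1 z).2‖ ^ 2 / 2 + f z.1 + ‖z.2‖ ^ 2 / 2 = 0 := by
  obtain ⟨Φ, hΦ⟩ := hL.exists_isHamiltonianFlow (hf.of_le (by norm_num))
  have hz := (hΦ z).1
  have h := hL.abs_leapfrog_energy_le hf hM (hΦ z).2 hη (by simp) rfl rfl rfl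
  have hH : ∀ x, fderiv ℝ (gradient f) x = 0 := fun x => norm_le_zero_iff.1 (hL x)
  have hT : ∀ x y, thirdDeriv f x y y = 0 := fun x y =>
    norm_le_zero_iff.1 (by simpa using (hM x).norm_le y y)
  simp only [hH, hT, hz] at h
  rw [leapfrog_energy_eq, neg_eq_zero, ← abs_nonpos_iff]
  simpa using h

lemma majorant_moments_le {η m r D g γ : ℝ} (hη : 0 < η) (hm : 1 ≤ m) (hr : 0 < r) (hD : 0 < D)
    (hγ : 0 ≤ γ) (hg : g = γ + 1) :
    η ^ 3 * (2 * m * r ^ 3 * D + 40 * m ^ 2 * D * g * r ^ 3) / 4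
        + η ^ 3 / (4 * (2 * m * r ^ 3 * D)) * (2 * m ^ 2 * (r ^ 2) ^ 3 * D ^ 2)
        + η ^ 3 / (4 * (40 * m ^ 2 * D * g * r ^ 3))
          * (1536 * (m ^ 2) ^ 2 * D ^ 2 * (γ * r ^ 3) ^ 2)
        + (η ^ 5 * r ^ 2 * (m * g * r ^ 3) / 2 + 3 * η ^ 5 * r ^ 5
          + γ * r ^ 3 * η ^ 7 * r ^ 4 * D / 2) * D ^ 2
        + η ^ 5 * r ^ 2 / (2 * (m * g * r ^ 3)) * (32 * m ^ 2 * D ^ 2 * (γ * r ^ 3) ^ 2)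
        + η ^ 5 * r ^ 3 * (r ^ 2 * D ^ 2)
        + γ * r ^ 3 * η ^ 7 * r ^ 4 / (2 * D) * (3 * D ^ 2) ^ 2
      ≤ 25 * g * (η ^ 3 * m ^ 3 * r ^ 3 * D + η ^ 5 * m * r ^ 5 * D ^ 2 + η ^ 7 * r ^ 7 * D ^ 3) := by
  have hg1 : 1 ≤ g := by linarith
  have hγg : γ ≤ g := by linarith
  have hg0 : 0 < g := by linarith
  have hm0 : 0 < m := by linarith
  have hq : γ ^ 2 / g ≤ g := by rw [div_le_iff₀ hg0]; nlinarith
  have e1 : m ≤ g * m ^ 3 := by nlinarith [pow_le_pow_right₀ hm (show 1 ≤ 3 by norm_num)]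
  have e2 : g * m ^ 2 ≤ g * m ^ 3 := by gcongr; norm_num
  have e3 : γ ^ 2 / g * m ^ 2 ≤ g * m ^ 3 := (by gcongr : _ ≤ g * m ^ 2).trans e2
  have e4 : γ ^ 2 / g * m ≤ g * m := by gcongr
  have e5 : 1 ≤ g * m := one_le_mul_of_one_le_of_one_le hg1 hm
  have hx : 0 ≤ η ^ 3 * r ^ 3 * D := by positivity
  have hy : 0 ≤ η ^ 5 * r ^ 5 * D ^ 2 := by positivity
  have hw : 0 ≤ η ^ 7 * r ^ 7 * D ^ 3 := by positivity
  calc _ = (3 / 4 * m + 10 * (g * m ^ 2) + 48 / 5 * (γ ^ 2 / g * m ^ 2)) * (η ^ 3 * r ^ 3 * D)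
        + (g * m / 2 + 4 + 16 * (γ ^ 2 / g * m)) * (η ^ 5 * r ^ 5 * D ^ 2)
        + 5 * γ * (η ^ 7 * r ^ 7 * D ^ 3) := by field_simp; ring
    _ ≤ (25 * (g * m ^ 3)) * (η ^ 3 * r ^ 3 * D) + (25 * (g * m)) * (η ^ 5 * r ^ 5 * D ^ 2)
        + (25 * g) * (η ^ 7 * r ^ 7 * D ^ 3) := by
        gcongr
        · nlinarith [pow_pos hm0 3, mul_pos hg0 (pow_pos hm0 3)]
        · nlinarith
        · linarith
    _ = _ := by ring

theorem leapfrog_energy_moment_le (hf : ContDiff ℝ 3 f) {r m D γ η : ℝ} {ℓ : ℕ} (hr : 0 < r)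
    (hL : LSmooth f (r ^ 2)) (hγ : 0 ≤ γ) (hM : ∀ x, CubicBound (thirdDeriv f x) (γ * r ^ 3))
    (hs : SubexpTail f) (hd : 1 ≤ d) (hℓ : 1 ≤ ℓ) (hη : 0 < η) (hηr : η * r ≤ 1)
    (hm0 : 0 ≤ m) (hm : m ^ 2 = ℓ) (hD0 : 0 < D) (hD : D ^ 2 = (d : ℝ) + 2 * ((ℓ : ℝ) - 1)) :
    (∫⁻ z : Euc d × Euc d,
        ENNReal.ofReal (|(-(f (leapfrog f η 1 z).1) - ‖(leapfrog f η 1 z).2‖ ^ 2 / 2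
          + f z.1 + ‖z.2‖ ^ 2 / 2)| ^ ℓ)
        ∂((targetMeasure f).prod (stdGaussian d))) ^ ((ℓ : ℝ)⁻¹)
      ≤ ENNReal.ofReal (25 * (γ + 1) *
        (η ^ 3 * m ^ 3 * r ^ 3 * D + η ^ 5 * m * r ^ 5 * D ^ 2 + η ^ 7 * r ^ 7 * D ^ 3)) := by
  have hf2 : ContDiff ℝ 2 f := hf.of_le (by norm_num)
  have hm1 : 1 ≤ m := by
    have h1 : (1:ℝ) ≤ ℓ := by exact_mod_cast hℓ
    nlinarith
  have hmpos : 0 < m := by linarith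
  obtain ⟨Φ, hΦ⟩ := hL.exists_isHamiltonianFlow hf2
  have hpath := fun z => hL.abs_leapfrog_energy_le_average hf hM (hΦ z).2 hη hr hηr
    (show 0 < 2 * m * r ^ 3 * D by positivity)
    (show 0 < 40 * m ^ 2 * D * (γ + 1) * r ^ 3 by positivity)
    (show 0 < m * (γ + 1) * r ^ 3 by positivity) hD0
  have hmom := eLpNorm_energyMajorant_le hf hL hM hs hd hℓ
    (c₀ := η ^ 3 * (2 * m * r ^ 3 * D + 40 * m ^ 2 * D * (γ + 1) * r ^ 3) / 4)
    (c₁ := η ^ 3 / (4 * (2 * m * r ^ 3 * D)))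
    (c₂ := η ^ 3 / (4 * (40 * m ^ 2 * D * (γ + 1) * r ^ 3)))
    (c₃ := η ^ 5 * r ^ 2 * (m * (γ + 1) * r ^ 3) / 2 + 3 * η ^ 5 * r ^ 5
      + γ * r ^ 3 * η ^ 7 * r ^ 4 * D / 2)
    (c₄ := η ^ 5 * r ^ 2 / (2 * (m * (γ + 1) * r ^ 3)))
    (c₅ := η ^ 5 * r ^ 3) (c₆ := γ * r ^ 3 * η ^ 7 * r ^ 4 / (2 * D))
    (by positivity) (by positivity) (by positivity) (by positivity) (by positivity)
    (by positivity) (by positivity) hD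
  rw [← hm] at hmom
  refine (hΦ.lintegral_rpow_inv_le hf2 hL (hs.isProbabilityMeasure hf.continuous)
    (continuous_energyMajorant hf _ _ _ _ _ _ _)
    (energyMajorant_nonneg ?_ ?_ ?_ ?_ ?_ ?_ ?_) hη (by omega) fun z => ?_).trans
    (hmom.trans (ENNReal.ofReal_le_ofReal (majorant_moments_le hη hm1 hr hD0 hγ rfl)))
  iterate 7 positivity
  rw [leapfrog_energy_eq, abs_neg]
  have h := hpath z
  rwa [Prod.mk.eta, (hΦ z).1] at h

end LeapfrogMoments

/-- **Lemma (single leapfrog step Hamiltonian error moment bound).** -/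
theorem single_leapfrog_hamiltonian_moment_bound :
    ∃ c : ℝ, 0 < c ∧
    ∀ (d : ℕ) (f : Euc d → ℝ) (L γ η : ℝ) (ℓ : ℕ),
      ContDiff ℝ 3 f → LSmooth f L → StronglyHessLip f γ L → SubexpTail f →
      IsProbabilityMeasure (targetMeasure f) →
      1 ≤ ℓ → 0 < η → η^2 * L ≤ 1 →
      let dl : ℝ := (d : ℝ) + 2 * ((ℓ : ℝ) - 1)
      (∫⁻ z : Euc d × Euc d,
          ENNReal.ofReal (|(-(f (leapfrog f η 1 z).1) - ‖(leapfrog f η 1 z).2‖^2 / 2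
            + f z.1 + ‖z.2‖^2 / 2)| ^ ℓ)
          ∂((targetMeasure f).prod (stdGaussian d))) ^ ((ℓ : ℝ)⁻¹)
        ≤ ENNReal.ofReal (c * (γ + 1) *
            (η^3 * (ℓ : ℝ) ^ ((3:ℝ)/2) * L ^ ((3:ℝ)/2) * dl ^ ((1:ℝ)/2)
              + η^5 * (ℓ : ℝ) ^ ((1:ℝ)/2) * L ^ ((5:ℝ)/2) * dl
              + η^7 * L ^ ((7:ℝ)/2) * dl ^ ((3:ℝ)/2))) := by
  refine ⟨25, by norm_num, fun d f L γ η ℓ hf hL hS hs hμ hℓ hη hηL => ?_⟩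
  have hL0 := hL.nonneg
  have hM := hS.cubicBound hf
  have hℓ1 : (1:ℝ) ≤ ℓ := by exact_mod_cast hℓ
  have hvanish : (∀ z : Euc d × Euc d, -(f (leapfrog f η 1 z).1)
      - ‖(leapfrog f η 1 z).2‖ ^ 2 / 2 + f z.1 + ‖z.2‖ ^ 2 / 2 = 0) →
      (∫⁻ z : Euc d × Euc d,
          ENNReal.ofReal (|(-(f (leapfrog f η 1 z).1) - ‖(leapfrog f η 1 z).2‖ ^ 2 / 2
            + f z.1 + ‖z.2‖ ^ 2 / 2)| ^ ℓ)
          ∂((targetMeasure f).prod (stdGaussian d))) ^ ((ℓ : ℝ)⁻¹) = 0 := fun h => by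
    simp only [h, abs_zero, zero_pow (show ℓ ≠ 0 by omega), ENNReal.ofReal_zero, lintegral_zero]
    exact ENNReal.zero_rpow_of_pos (by positivity)
  intro dl
  rcases Nat.eq_zero_or_pos d with rfl | hd
  · refine (hvanish fun z => ?_).trans_le zero_le
    rw [Subsingleton.elim (leapfrog f η 1 z) z]
    ring
  rcases hL0.eq_or_lt with rfl | hLpos
  · rw [Real.zero_rpow (by norm_num), mul_zero] at hM
    exact (hvanish (leapfrog_energy_eq_zero_of_lSmooth_zero hf hL hM hη.le)).trans_le zero_le
  have hd1 : (1:ℝ) ≤ d := by exact_mod_cast hd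
  have hdl : 0 < dl := by simp only [dl]; linarith
  have hpow : ∀ {x : ℝ} (_ : 0 ≤ x) (n : ℕ), x ^ ((n:ℝ) / 2) = √x ^ n := fun {x} hx n => by
    rw [Real.sqrt_eq_rpow, ← Real.rpow_mul_natCast hx]
    congr 1
    ring
  have hp1 := fun {x : ℝ} (hx : 0 ≤ x) => hpow hx 1
  have hp3 := fun {x : ℝ} (hx : 0 ≤ x) => hpow hx 3
  have hp5 := hpow hL0 5
  have hp7 := hpow hL0 7
  norm_num only [pow_one] at hp1 hp3 hp5 hp7
  rw [hp3 hL0] at hM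
  have hr : 0 < √L := Real.sqrt_pos.2 hLpos
  have hγ : 0 ≤ γ := nonneg_of_mul_nonneg_left (hM 0).nonneg (by positivity)
  have hηr : η * √L ≤ 1 := by
    rw [← sq_le_one_iff₀ (by positivity), mul_pow, Real.sq_sqrt hL0]
    exact hηL
  have hbound := leapfrog_energy_moment_le hf hr (by rwa [Real.sq_sqrt hL0]) hγ hM hs hd hℓ hη hηr
    (Real.sqrt_nonneg _) (Real.sq_sqrt (show (0:ℝ) ≤ ℓ by linarith)) (Real.sqrt_pos.2 hdl)
    (Real.sq_sqrt hdl.le)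
  rw [Real.sq_sqrt hdl.le] at hbound
  rwa [hp3 (by positivity : (0:ℝ) ≤ ℓ), hp1 (by positivity : (0:ℝ) ≤ ℓ), hp3 hL0, hp5, hp7,
    hp1 hdl.le, hp3 hdl.le]
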